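/- arXiv:0709.0035 — 4 statements merged into one kernel-verified Lean document; each statement's English description precedes it below -/
import Mathlib

section
/- Let H be an N×M random matrix (M ≤ N) whose entries are i.i.d. circularly-symmetric complex Gaussian with mean zero and unit variance, let T ≥ 1, and let L be a full-rank MT×MT complex matrix generating a complex lattice of unit volume, i.e. det(L*L)^{1/2} = 1. Let H_T denote the NT×MT block-diagonal matrix with T copies of H on its diagonal, and let d(H_T L) = inf{‖H_T L z‖ : z ∈ ℤ[i]^{MT}, z ≠ 0} be the minimum distance of the faded lattice. Then limsup_{ε→0+} log Pr{d(H_T L) ≤ ε} / log ε ≤ 2M(N−M+1); equivalently, for every δ > 0 there exists ε₀ > 0 such that Pr{d(H_T L) ≤ ε} ≥ ε^{2M(N−M+1)+δ} for all 0 < ε < ε₀. -/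
open MeasureTheory ProbabilityTheory Matrix Filter Set

noncomputable section

/-- Euclidean norm of a complex vector indexed by a finite type. -/
def cnorm {ι : Type*} [Fintype ι] (v : ι → ℂ) : ℝ :=
  Real.sqrt (∑ i, ‖v i‖ ^ 2)

/-- Minimum distance of the complex lattice generated by the columns of `G`
(over the Gaussian integers): `d(G) = inf {‖G z‖ : z ∈ ℤ[i]^κ, z ≠ 0}`. -/
def latMinDist {ι κ : Type*} [Fintype ι] [Fintype κ] (G : Matrix ι κ ℂ) : ℝ :=
  sInf {r | ∃ z : κ → GaussianInt, z ≠ 0 ∧ r = cnorm (G.mulVec fun j => (z j : ℂ))}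

/-- Sample space measure for an `N × M` i.i.d. circularly-symmetric complex Gaussian
matrix of unit entry variance: each of the `2NM` real coordinates is an independent
real Gaussian of mean `0` and variance `1/2`. -/
def gaussMatMeasure (N M : ℕ) : Measure ((Fin N × Fin M × Bool) → ℝ) :=
  Measure.pi fun _ => gaussianReal 0 (1/2)

/-- The complex matrix built from a sample of real coordinates
(`false` ↦ real part, `true` ↦ imaginary part). -/
def matOf {N M : ℕ} (g : (Fin N × Fin M × Bool) → ℝ) : Matrix (Fin N) (Fin M) ℂ :=
  fun i j => (g (i, j, false) : ℂ) + (g (i, j, true) : ℂ) * Complex.I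

theorem aux_pigeon {α β : Type*} [Fintype α] [Fintype β]
    (f : (α → ℤ) → β → ℝ) (hf : ∀ x y, f (x - y) = f x - f y) (R : ℝ) (hR : 0 < R)
    (Q p : ℕ) (hp : 0 < p)
    (hb : ∀ x : α → ℤ, (∀ a, 0 ≤ x a ∧ x a ≤ Q) → ∀ b, |f x b| < R)
    (hcard : p ^ Fintype.card β < (Q + 1) ^ Fintype.card α) :
    ∃ z : α → ℤ, z ≠ 0 ∧ (∀ a, |z a| ≤ Q) ∧ ∀ b, |f z b| ≤ 2 * R / p := by
  classical
  have hp' : (0 : ℝ) < p := by exact_mod_cast hp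
  let e : (α → Fin (Q + 1)) → α → ℤ := fun x a => ((x a : ℕ) : ℤ)
  have he : ∀ x a, 0 ≤ e x a ∧ e x a ≤ Q := by
    intro x a
    have := (x a).2
    simp only [e]
    omega
  let c : (α → Fin (Q + 1)) → β → ℝ := fun x b => (f (e x) b + R) * p / (2 * R)
  have hc0 : ∀ x b, 0 ≤ c x b := by
    intro x b
    have h := (abs_lt.1 (hb (e x) (he x) b)).1
    have : 0 ≤ f (e x) b + R := by linarith
    simp only [c]
    positivity
  have hc1 : ∀ x b, c x b < p := by
    intro x b
    have h := (abs_lt.1 (hb (e x) (he x) b)).2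
    simp only [c]
    rw [div_lt_iff₀ (by positivity)]
    nlinarith
  let F : (α → Fin (Q + 1)) → (β → Fin p) := fun x b =>
    ⟨⌊c x b⌋₊, (Nat.floor_lt (hc0 x b)).2 (hc1 x b)⟩
  obtain ⟨x, y, hxy, hF⟩ := Fintype.exists_ne_map_eq_of_card_lt F (by simpa using hcard)
  refine ⟨e x - e y, ?_, ?_, ?_⟩
  · intro h
    apply hxy
    funext a
    have := congrFun h a
    simp only [e, Pi.sub_apply, Pi.zero_apply] at this
    apply Fin.ext
    omega
  · intro a
    have h1 := he x a
    have h2 := he y a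
    rw [Pi.sub_apply, abs_le]
    constructor <;> linarith
  · intro b
    have h : ⌊c x b⌋₊ = ⌊c y b⌋₊ := congrArg Fin.val (congrFun hF b)
    have h1 := Nat.floor_le (hc0 x b)
    have h2 := Nat.lt_floor_add_one (c x b)
    have h3 := Nat.floor_le (hc0 y b)
    have h4 := Nat.lt_floor_add_one (c y b)
    rw [h] at h1 h2
    rw [hf, Pi.sub_apply]
    have hx : f (e x) b - f (e y) b = (c x b - c y b) * (2 * R / p) := by
      simp only [c]
      field_simp
      ring
    rw [hx, abs_mul, abs_of_pos (show 0 < 2 * R / p by positivity)]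
    have : |c x b - c y b| ≤ 1 := by
      rw [abs_le]; constructor <;> linarith
    have h0 : 0 < 2 * R / p := by positivity
    nlinarith

theorem aux_pigeon_gauss {ι κ : Type*} [Fintype ι] [Fintype κ] (B : Matrix ι κ ℂ) (K : ℝ)
    (hK : 0 < K) (hB : ∀ i j, ‖B i j‖ ≤ K) (Q p : ℕ) (hQ : 0 < Q) (hp : 0 < p)
    (hκ : 0 < Fintype.card κ)
    (hcard : p ^ (2 * Fintype.card ι) < (Q + 1) ^ (2 * Fintype.card κ)) :
    ∃ z : κ → GaussianInt, z ≠ 0 ∧ (∀ j, ‖(z j : ℂ)‖ ≤ 2 * Q) ∧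
      ∀ i, ‖(B.mulVec fun j => (z j : ℂ)) i‖ ≤ 16 * K * Fintype.card κ * Q / p := by
  classical
  let G : (κ × Bool → ℤ) → κ → GaussianInt := fun x j => ⟨x (j, false), x (j, true)⟩
  let f : (κ × Bool → ℤ) → (ι × Bool) → ℝ := fun x b =>
    if b.2 then ((B.mulVec fun j => (G x j : ℂ)) b.1).im
    else ((B.mulVec fun j => (G x j : ℂ)) b.1).re
  have hκ' : (0 : ℝ) < Fintype.card κ := by exact_mod_cast hκ
  have hQ' : (0 : ℝ) < Q := by exact_mod_cast hQ
  have hG : ∀ x : κ × Bool → ℤ, (∀ a, |x a| ≤ Q) → ∀ j, ‖(G x j : ℂ)‖ ≤ 2 * Q := by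
    intro x hx j
    have h1 : |(x (j, false) : ℝ)| ≤ Q := by exact_mod_cast hx (j, false)
    have h2 : |(x (j, true) : ℝ)| ≤ Q := by exact_mod_cast hx (j, true)
    have := Complex.norm_le_abs_re_add_abs_im (G x j : ℂ)
    simp only [G, GaussianInt.re_toComplex, GaussianInt.im_toComplex] at this
    simp only [G]
    linarith
  have hsub : ∀ x y, (B.mulVec fun j => (G (x - y) j : ℂ)) =
      (B.mulVec fun j => (G x j : ℂ)) - (B.mulVec fun j => (G y j : ℂ)) := by
    intro x y
    rw [← Matrix.mulVec_sub]
    congr 1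
    funext j
    simp only [G, GaussianInt.toComplex_def', Pi.sub_apply]
    push_cast
    ring
  have hbd : ∀ v : κ → ℂ, (∀ j, ‖v j‖ ≤ 2 * Q) → ∀ i, ‖(B.mulVec v) i‖ ≤
      2 * K * Fintype.card κ * Q := by
    intro v hv i
    calc ‖(B.mulVec v) i‖ = ‖∑ j, B i j * v j‖ := rfl
      _ ≤ ∑ j, ‖B i j * v j‖ := norm_sum_le _ _
      _ ≤ ∑ j : κ, K * (2 * Q) := by
          refine Finset.sum_le_sum fun j _ => ?_
          rw [norm_mul]
          exact mul_le_mul (hB i j) (hv j) (norm_nonneg _) hK.le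
      _ = _ := by simp; ring
  obtain ⟨z, hz0, hzQ, hz⟩ := aux_pigeon f (by
      intro x y
      funext b
      simp only [f, Pi.sub_apply, hsub]
      split_ifs <;> simp) (4 * K * Fintype.card κ * Q) (by positivity) Q p hp (by
      intro x hx b
      have h1 := hbd _ (hG x (fun a => by rw [abs_of_nonneg (hx a).1]; exact (hx a).2)) b.1
      have h2 : 0 < K * Fintype.card κ * Q := by positivity
      refine lt_of_le_of_lt (b := 2 * K * Fintype.card κ * Q) ?_ (by linarith)
      refine le_trans ?_ h1
      simp only [f]
      split_ifs
      · exact Complex.abs_im_le_norm _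
      · exact Complex.abs_re_le_norm _) (by
      simpa [Fintype.card_prod, mul_comm] using hcard)
  refine ⟨G z, ?_, hG z hzQ, ?_⟩
  · intro h
    apply hz0
    funext ⟨j, b⟩
    have := congrFun h j
    simp only [G, Pi.zero_apply, Zsqrtd.ext_iff, Zsqrtd.re_zero, Zsqrtd.im_zero] at this
    cases b
    · exact this.1
    · exact this.2
  · intro i
    have h1 := hz (i, false)
    have h2 := hz (i, true)
    simp only [f] at h1 h2
    simp only [Bool.false_eq_true, if_false, if_true] at h1 h2
    have := Complex.norm_le_abs_re_add_abs_im ((B.mulVec fun j => (G z j : ℂ)) i)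
    have h3 : 16 * K * Fintype.card κ * Q / p = 2 * (2 * (4 * K * Fintype.card κ * Q) / p) := by
      ring
    linarith

theorem aux_cnorm_le {ι : Type*} [Fintype ι] (v : ι → ℂ) (C : ℝ) (hv : ∀ i, ‖v i‖ ≤ C) :
    cnorm v ≤ Fintype.card ι * C := by
  unfold cnorm
  have h0 : ∑ i, ‖v i‖ ≤ Fintype.card ι * C := by
    calc ∑ i, ‖v i‖ ≤ ∑ i : ι, C := Finset.sum_le_sum fun i _ => hv i
      _ = _ := by simp
  refine le_trans ?_ h0
  apply Real.sqrt_le_iff.2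
  exact ⟨Finset.sum_nonneg fun i _ => norm_nonneg _,
    Finset.sum_sq_le_sq_sum_of_nonneg fun i _ => norm_nonneg _⟩

theorem aux_latMinDist_le {ι κ : Type*} [Fintype ι] [Fintype κ] (G : Matrix ι κ ℂ)
    (z : κ → GaussianInt) (hz : z ≠ 0) : latMinDist G ≤ cnorm (G.mulVec fun j => (z j : ℂ)) := by
  refine csInf_le ⟨0, ?_⟩ ⟨z, hz, rfl⟩
  rintro r ⟨z, _, rfl⟩
  exact Real.sqrt_nonneg _

theorem aux_det (m N T : ℕ) (hT : 1 ≤ T)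
    (L : Matrix (Fin (m + 1) × Fin T) (Fin (m + 1) × Fin T) ℂ) :
    ∃ C : ℝ, 0 < C ∧ ∀ (H : Matrix (Fin N) (Fin (m + 1)) ℂ) (w : Fin m → ℂ) (η : ℝ) (q : ℕ),
      0 < q → 0 ≤ η → (∀ i j, ‖H i (Fin.castSucc j)‖ ≤ 4) → (∀ j, ‖w j‖ ≤ 1) →
      (∀ i, ‖H i (Fin.last m) - ∑ j, H i (Fin.castSucc j) * w j‖ ≤ 2 * η) →
      latMinDist ((Matrix.blockDiagonal fun _ : Fin T => H) * L) ≤ C * (q ^ m * η + 1 / q) := by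
  classical
  obtain ⟨K, hK0, hK⟩ : ∃ K : ℝ, 0 < K ∧ ∀ a b, ‖L a b‖ ≤ K := by
    refine ⟨1 + ∑ a, ∑ b, ‖L a b‖, by positivity, fun a b => ?_⟩
    have h1 : ‖L a b‖ ≤ ∑ b, ‖L a b‖ :=
      Finset.single_le_sum (f := fun b => ‖L a b‖) (fun _ _ => norm_nonneg _) (Finset.mem_univ b)
    have h2 : ∑ b, ‖L a b‖ ≤ ∑ a, ∑ b, ‖L a b‖ :=
      Finset.single_le_sum (f := fun a => ∑ b, ‖L a b‖)
        (fun _ _ => Finset.sum_nonneg fun _ _ => norm_nonneg _) (Finset.mem_univ a)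
    linarith
  set D : ℝ := (Fintype.card (Fin (m + 1) × Fin T) : ℝ) with hD
  have hcard0 : 0 < Fintype.card (Fin (m + 1) × Fin T) := by
    simp only [Fintype.card_prod, Fintype.card_fin]; positivity
  have hD0 : 0 < D := by rw [hD]; exact_mod_cast hcard0
  set E : ℝ := (Fintype.card (Fin N × Fin T) : ℝ) with hE
  have hE0 : 0 ≤ E := by positivity
  refine ⟨E * (m * 4 * (16 * (2 * K) * D) + 4 * K * D) + 1, by positivity, ?_⟩
  intro H w η q hq hη0 hH hw hη
  have hq' : (0 : ℝ) < q := by exact_mod_cast hq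
  let B : Matrix (Fin m × Fin T) (Fin (m + 1) × Fin T) ℂ := fun a b =>
    L (Fin.castSucc a.1, a.2) b + w a.1 * L (Fin.last m, a.2) b
  obtain ⟨z, hz0, hzQ, hz⟩ := aux_pigeon_gauss B (2 * K) (by positivity) (by
      intro a b
      calc ‖B a b‖ ≤ ‖L (Fin.castSucc a.1, a.2) b‖ + ‖w a.1 * L (Fin.last m, a.2) b‖ :=
            norm_add_le _ _
        _ ≤ K + 1 * K := by
            rw [norm_mul]
            exact add_le_add (hK _ _) (mul_le_mul (hw _) (hK _ _) (norm_nonneg _) zero_le_one)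
        _ = 2 * K := by ring) (q ^ m) (q ^ (m + 1)) (by positivity) (by positivity) hcard0 (by
      have h1 : (q ^ (m + 1)) ^ (2 * Fintype.card (Fin m × Fin T)) =
          (q ^ m) ^ (2 * Fintype.card (Fin (m + 1) × Fin T)) := by
        rw [← pow_mul, ← pow_mul]
        congr 1
        simp only [Fintype.card_prod, Fintype.card_fin]
        ring
      rw [h1]
      exact Nat.pow_lt_pow_left (Nat.lt_succ_self _) (by positivity))
  refine (aux_latMinDist_le _ z hz0).trans ?_
  set x := L.mulVec fun j => (z j : ℂ) with hx
  have hY : ∀ a, ‖(B.mulVec fun j => (z j : ℂ)) a‖ ≤ 16 * (2 * K) * D * (1 / q) := by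
    intro a
    refine (hz a).trans (le_of_eq ?_)
    push_cast
    rw [← hD]
    field_simp
    ring
  have hX : ∀ a, ‖x a‖ ≤ 2 * K * D * q ^ m := by
    intro a
    calc ‖x a‖ = ‖∑ j, L a j * (z j : ℂ)‖ := rfl
      _ ≤ ∑ j, ‖L a j * (z j : ℂ)‖ := norm_sum_le _ _
      _ ≤ ∑ j : (Fin (m + 1) × Fin T), K * (2 * q ^ m) := by
          refine Finset.sum_le_sum fun j _ => ?_
          rw [norm_mul]
          refine mul_le_mul (hK a j) ?_ (norm_nonneg _) hK0.le
          have := hzQ j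
          push_cast at this
          exact this
      _ = _ := by
          rw [Finset.sum_const, nsmul_eq_mul, Finset.card_univ, ← hD]; ring
  have hBx : ∀ j t, (B.mulVec fun j => (z j : ℂ)) (j, t) =
      x (Fin.castSucc j, t) + w j * x (Fin.last m, t) := by
    intro j t
    simp only [hx, Matrix.mulVec, dotProduct, B, Finset.mul_sum, ← Finset.sum_add_distrib]
    refine Finset.sum_congr rfl fun k _ => ?_
    ring
  have hHx : ∀ i t, ((Matrix.blockDiagonal fun _ : Fin T => H).mulVec x) (i, t) =
      ∑ j, H i j * x (j, t) := by
    intro i t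
    simp only [Matrix.mulVec, dotProduct, Matrix.blockDiagonal_apply, Fintype.sum_prod_type]
    refine Finset.sum_congr rfl fun k _ => ?_
    simp
  have key : ∀ i t, ((Matrix.blockDiagonal fun _ : Fin T => H).mulVec x) (i, t) =
      (∑ j, H i (Fin.castSucc j) * (B.mulVec fun j => (z j : ℂ)) (j, t)) +
      (H i (Fin.last m) - ∑ j, H i (Fin.castSucc j) * w j) * x (Fin.last m, t) := by
    intro i t
    rw [hHx, Fin.sum_univ_castSucc, sub_mul, Finset.sum_mul]
    have : ∑ j, H i (Fin.castSucc j) * (B.mulVec fun j => (z j : ℂ)) (j, t) =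
        ∑ j, H i (Fin.castSucc j) * x (Fin.castSucc j, t) +
        ∑ j, H i (Fin.castSucc j) * w j * x (Fin.last m, t) := by
      rw [← Finset.sum_add_distrib]
      refine Finset.sum_congr rfl fun k _ => ?_
      rw [hBx]; ring
    rw [this]; ring
  rw [← Matrix.mulVec_mulVec, ← hx]
  have hbound : ∀ a, ‖((Matrix.blockDiagonal fun _ : Fin T => H).mulVec x) a‖ ≤
      (m * 4 * (16 * (2 * K) * D) + 4 * K * D) * (q ^ m * η + 1 / q) := by
    rintro ⟨i, t⟩
    rw [key]
    refine (norm_add_le _ _).trans ?_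
    have h1 : ‖∑ j, H i (Fin.castSucc j) * (B.mulVec fun j => (z j : ℂ)) (j, t)‖ ≤
        m * (4 * (16 * (2 * K) * D * (1 / q))) := by
      refine (norm_sum_le _ _).trans ?_
      calc _ ≤ ∑ j : Fin m, 4 * (16 * (2 * K) * D * (1 / q)) := by
            refine Finset.sum_le_sum fun j _ => ?_
            rw [norm_mul]
            exact mul_le_mul (hH i j) (hY _) (norm_nonneg _) (by norm_num)
        _ = _ := by simp
    have h2 : ‖(H i (Fin.last m) - ∑ j, H i (Fin.castSucc j) * w j) * x (Fin.last m, t)‖ ≤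
        (2 * η) * (2 * K * D * q ^ m) := by
      rw [norm_mul]
      exact mul_le_mul (hη i) (hX _) (norm_nonneg _) (by positivity)
    have h3 : 0 ≤ m * 4 * (16 * (2 * K) * D) * (q ^ m * η) := by positivity
    have h4 : 0 ≤ 4 * K * D * (1 / q) := by positivity
    linarith
  refine (aux_cnorm_le _ _ hbound).trans ?_
  rw [← hE]
  have : 0 ≤ q ^ m * η + 1 / q := by positivity
  linarith

theorem aux_gauss_interval (F : ℝ) (hF : 0 ≤ F) : ∃ c : ℝ, 0 < c ∧ ∀ a η : ℝ, |a| ≤ F → 0 < η → η ≤ 1 →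
    ENNReal.ofReal (c * η) ≤ gaussianReal 0 (1/2) (Icc (a - η) (a + η)) := by
  have hv : (1/2 : NNReal) ≠ 0 := by norm_num
  refine ⟨gaussianPDFReal 0 (1/2) (F + 1) * 2, mul_pos (gaussianPDFReal_pos _ _ _ hv) two_pos, ?_⟩
  intro a η ha hη hη1
  rw [gaussianReal_apply _ hv]
  have ha' := abs_le.1 ha
  have hle : ∀ x ∈ Icc (a - η) (a + η), ENNReal.ofReal (gaussianPDFReal 0 (1/2) (F + 1)) ≤
      gaussianPDF 0 (1/2) x := by
    intro x hx
    rw [gaussianPDF]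
    apply ENNReal.ofReal_le_ofReal
    simp only [gaussianPDFReal]
    have h2 : x ^ 2 ≤ (F + 1) ^ 2 := by
      apply sq_le_sq'
      · linarith [hx.1]
      · linarith [hx.2]
    have : -(F + 1 - 0) ^ 2 ≤ -(x - 0) ^ 2 := by simpa using h2
    gcongr
  calc ENNReal.ofReal (gaussianPDFReal 0 (1/2) (F + 1) * 2 * η)
      = ENNReal.ofReal (gaussianPDFReal 0 (1/2) (F + 1)) * volume (Icc (a - η) (a + η)) := by
        rw [Real.volume_Icc, ← ENNReal.ofReal_mul (gaussianPDFReal_nonneg _ _ _)]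
        congr 1; ring
    _ = ∫⁻ x in Icc (a - η) (a + η), ENNReal.ofReal (gaussianPDFReal 0 (1/2) (F + 1)) := by
        rw [setLIntegral_const]
    _ ≤ _ := setLIntegral_mono' measurableSet_Icc hle

theorem aux_prod_lower {X Y : Type*} [MeasurableSpace X] [MeasurableSpace Y] (μ : Measure X)
    (ν : Measure Y) [SFinite ν] (s : Set (X × Y)) (U : Set X) (hU : MeasurableSet U)
    (c : ENNReal) (h : ∀ x ∈ U, c ≤ ν {y | (x, y) ∈ s}) : c * μ U ≤ (μ.prod ν) s := by
  rw [← measure_toMeasurable s, Measure.prod_apply (measurableSet_toMeasurable _ _)]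
  calc c * μ U = ∫⁻ x in U, c ∂μ := by rw [setLIntegral_const]
    _ ≤ ∫⁻ x in U, ν (Prod.mk x ⁻¹' toMeasurable (μ.prod ν) s) ∂μ := by
        refine setLIntegral_mono' hU fun x hx => (h x hx).trans (measure_mono ?_)
        intro y hy
        exact subset_toMeasurable _ _ hy
    _ ≤ _ := setLIntegral_le_lintegral _ _

instance aux_openPos : (gaussianReal 0 (1/2)).IsOpenPosMeasure :=
  (gaussianReal_absolutelyContinuous' 0 (by norm_num : (1/2 : NNReal) ≠ 0)).isOpenPosMeasure

theorem aux_prob {ι : Type*} [Fintype ι] (p : ι → Prop) [DecidablePred p]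
    (x₀ : ι → ℝ) (hx₀ : ∀ i, ¬ p i → x₀ i = 0) (U : Set (ι → ℝ)) (hU : U ∈ nhds x₀)
    (f : (ι → ℝ) → ι → ℝ) (F : ℝ) (hF : 0 ≤ F) (hf : ∀ x ∈ U, ∀ i, |f x i| ≤ F) :
    ∃ c : ℝ, 0 < c ∧ ∀ η : ℝ, 0 < η → η ≤ 1 → ∀ E : Set (ι → ℝ),
      (∀ g : ι → ℝ, (fun i => if p i then g i else 0) ∈ U →
        (∀ k, ¬ p k → |g k - f (fun i => if p i then g i else 0) k| ≤ η) → g ∈ E) →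
      c * η ^ (Fintype.card {i // ¬ p i}) ≤
        ((Measure.pi fun _ : ι => gaussianReal 0 (1/2)) E).toReal := by
  obtain ⟨c, hc, hcI⟩ := aux_gauss_interval F hF
  let ext : ({i // p i} → ℝ) → ι → ℝ := fun x i => if h : p i then x ⟨i, h⟩ else 0
  have hext : Continuous ext := by
    refine continuous_pi fun i => ?_
    by_cases h : p i
    · simp only [ext, h, dif_pos]; exact continuous_apply _
    · simp only [ext, h, dif_neg, not_false_iff]; exact continuous_const
  obtain ⟨V, hVU, hVo, hxV⟩ := mem_nhds_iff.1 hU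
  let V' := ext ⁻¹' V
  have hV'o : IsOpen V' := hVo.preimage hext
  have hV'ne : V'.Nonempty := by
    refine ⟨fun i => x₀ i, ?_⟩
    have : ext (fun i => x₀ i) = x₀ := by
      funext i
      by_cases h : p i
      · simp [ext, h]
      · simp [ext, h, hx₀ i h]
    simpa only [V', Set.mem_preimage, this] using hxV
  let μ : Measure ({i // p i} → ℝ) := Measure.pi fun _ => gaussianReal 0 (1/2)
  let ν : Measure ({i // ¬ p i} → ℝ) := Measure.pi fun _ => gaussianReal 0 (1/2)
  have hμ : μ V' ≠ 0 := (hV'o.measure_pos μ hV'ne).ne'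
  have hμt : μ V' ≠ ⊤ := measure_ne_top _ _
  refine ⟨c ^ (Fintype.card {i // ¬ p i}) * (μ V').toReal,
    mul_pos (pow_pos hc _) (ENNReal.toReal_pos hμ hμt), ?_⟩
  intro η hη hη1 E hE
  have hmp := measurePreserving_piEquivPiSubtypeProd (fun _ : ι => gaussianReal 0 (1/2)) p
  have hpre := hmp.symm.measure_preimage_equiv E
  have hlow := aux_prod_lower μ ν
    ((MeasurableEquiv.piEquivPiSubtypeProd (fun _ : ι => ℝ) p).symm ⁻¹' E) V'
    hV'o.measurableSet (ENNReal.ofReal ((c * η) ^ (Fintype.card {i // ¬ p i}))) (by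
      intro x hx
      have hxU : ext x ∈ U := hVU hx
      have hsub : (Set.univ.pi fun k : {i // ¬ p i} => Icc (f (ext x) k - η) (f (ext x) k + η)) ⊆
          {y | (x, y) ∈ (MeasurableEquiv.piEquivPiSubtypeProd (fun _ : ι => ℝ) p).symm ⁻¹' E} := by
        intro y hy
        apply hE
        · convert hxU using 1
          funext i
          by_cases h : p i
          · simp [ext, h, MeasurableEquiv.piEquivPiSubtypeProd]
          · simp [ext, h]
        · intro k hk
          have h1 : (fun i => if p i then
              (MeasurableEquiv.piEquivPiSubtypeProd (fun _ : ι => ℝ) p).symm (x, y) i else 0) =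
              ext x := by
            funext i
            by_cases h : p i
            · simp [ext, h, MeasurableEquiv.piEquivPiSubtypeProd]
            · simp [ext, h]
          rw [h1]
          have h2 := hy ⟨k, hk⟩ (Set.mem_univ _)
          have h3 : (MeasurableEquiv.piEquivPiSubtypeProd (fun _ : ι => ℝ) p).symm (x, y) k =
              y ⟨k, hk⟩ := by
            simp [MeasurableEquiv.piEquivPiSubtypeProd, hk]
          rw [h3, abs_le]
          constructor <;> linarith [h2.1, h2.2]
      refine le_trans ?_ (measure_mono hsub)
      rw [Measure.pi_pi, ENNReal.ofReal_pow (by positivity)]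
      calc _ = ∏ k : {i // ¬ p i}, ENNReal.ofReal (c * η) := by simp
        _ ≤ _ := Finset.prod_le_prod' fun k _ => hcI _ _ (hf _ hxU _) hη hη1)
  have hfin : (Measure.pi fun _ : ι => gaussianReal 0 (1/2)) E ≠ ⊤ := measure_ne_top _ _
  rw [← hpre] at hfin ⊢
  have := ENNReal.toReal_mono hfin hlow
  rw [ENNReal.toReal_mul, ENNReal.toReal_ofReal (by positivity)] at this
  calc _ = (c * η) ^ (Fintype.card {i // ¬ p i}) * (μ V').toReal := by rw [mul_pow]; ring
    _ ≤ _ := this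

theorem aux_event (m l T : ℕ) (hT : 1 ≤ T)
    (L : Matrix (Fin (m + 1) × Fin T) (Fin (m + 1) × Fin T) ℂ) :
    ∃ C c : ℝ, 0 < C ∧ 0 < c ∧ ∀ (η : ℝ) (q : ℕ), 0 < η → η ≤ 1 → 0 < q →
      c * η ^ (2 * (l + 1)) ≤ ((gaussMatMeasure (m + 1 + l) (m + 1))
          {g | latMinDist ((Matrix.blockDiagonal fun _ : Fin T => matOf g) * L) ≤
            C * (q ^ m * η + 1 / q)}).toReal := by
  classical
  obtain ⟨C, hC, hdet⟩ := aux_det m (m + 1 + l) T hT L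
  let p : (Fin (m + 1 + l) × Fin (m + 1) × Bool) → Prop :=
    fun a => ¬ (m ≤ a.1.val ∧ a.2.1 = Fin.last m)
  let top : Fin m → Fin (m + 1 + l) := fun i => ⟨i.val, by omega⟩
  let A : ((Fin (m + 1 + l) × Fin (m + 1) × Bool) → ℝ) → Matrix (Fin m) (Fin m) ℂ :=
    fun g i j => matOf g (top i) (Fin.castSucc j)
  let b : ((Fin (m + 1 + l) × Fin (m + 1) × Bool) → ℝ) → Fin m → ℂ :=
    fun g i => matOf g (top i) (Fin.last m)
  let w : ((Fin (m + 1 + l) × Fin (m + 1) × Bool) → ℝ) → Fin m → ℂ :=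
    fun g => (A g)⁻¹.mulVec (b g)
  let x₀ : (Fin (m + 1 + l) × Fin (m + 1) × Bool) → ℝ :=
    fun a => if a.1.val = a.2.1.val ∧ a.1.val < m ∧ a.2.2 = false then 1 else 0
  let U : Set ((Fin (m + 1 + l) × Fin (m + 1) × Bool) → ℝ) :=
    {g | (∀ a, |g a| ≤ 2) ∧ (A g).det ≠ 0 ∧ ∀ j, ‖w g j‖ ≤ 1}
  let f : ((Fin (m + 1 + l) × Fin (m + 1) × Bool) → ℝ) →
      (Fin (m + 1 + l) × Fin (m + 1) × Bool) → ℝ := fun g a =>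
    if a.2.2 then (∑ j, matOf g a.1 (Fin.castSucc j) * w g j).im
    else (∑ j, matOf g a.1 (Fin.castSucc j) * w g j).re
  have hmat : ∀ i j, Continuous fun g : (Fin (m + 1 + l) × Fin (m + 1) × Bool) → ℝ =>
      matOf g i j := by
    intro i j
    unfold matOf
    fun_prop
  have hAc : Continuous A := continuous_matrix fun i j => hmat _ _
  have hbc : Continuous b := continuous_pi fun i => hmat _ _
  have hA0 : A x₀ = 1 := by
    ext i j
    simp only [A, matOf, x₀, top, Matrix.one_apply, Fin.val_castSucc, Fin.ext_iff]
    by_cases h : i.val = j.val <;> simp [h]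
  have hb0 : b x₀ = 0 := by
    funext i
    have := i.2
    have h2 : i.val ≠ m := by omega
    simp [b, matOf, x₀, top, h2]
  have hAdet : (A x₀).det ≠ 0 := by rw [hA0]; simp
  have hwc : ContinuousAt w x₀ := by
    have h1 : ContinuousAt (fun g => ((A g).det)⁻¹ • (A g).adjugate) x₀ := by
      refine ContinuousAt.smul (ContinuousAt.inv₀ hAc.matrix_det.continuousAt hAdet) ?_
      exact hAc.matrix_adjugate.continuousAt
    have h2 : w = fun g => (((A g).det)⁻¹ • (A g).adjugate).mulVec (b g) := by
      funext g
      simp only [w, Matrix.inv_def, Ring.inverse_eq_inv']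
    rw [h2]
    rw [continuousAt_pi]
    intro i
    simp only [Matrix.mulVec, dotProduct]
    refine tendsto_finsetSum _ fun j _ => ?_
    refine Tendsto.mul ?_ ?_
    · exact ((continuous_apply j).comp (continuous_apply i)).continuousAt.comp h1
    · exact ((continuous_apply j).comp hbc).continuousAt
  have hw0 : w x₀ = 0 := by simp [w, hb0]
  have hU : U ∈ nhds x₀ := by
    have e1 : ∀ᶠ g in nhds x₀, ∀ a, |g a| ≤ 2 := by
      rw [eventually_all]
      intro a
      have hc : ContinuousAt (fun g : (Fin (m + 1 + l) × Fin (m + 1) × Bool) → ℝ => |g a|) x₀ := by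
        exact (continuous_apply a).abs.continuousAt
      have hlt : |x₀ a| < 2 := by
        simp only [x₀]; split_ifs <;> norm_num
      exact (hc.eventually_lt_const hlt).mono fun g hg => le_of_lt hg
    have e2 : ∀ᶠ g in nhds x₀, (A g).det ≠ 0 :=
      hAc.matrix_det.continuousAt.eventually_ne hAdet
    have e3 : ∀ᶠ g in nhds x₀, ∀ j, ‖w g j‖ ≤ 1 := by
      rw [eventually_all]
      intro j
      have hc : ContinuousAt (fun g => ‖w g j‖) x₀ := ((continuousAt_pi.1 hwc) j).norm
      have hlt : ‖w x₀ j‖ < 1 := by simp [hw0]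
      exact (hc.eventually_lt_const hlt).mono fun g hg => le_of_lt hg
    filter_upwards [e1, e2, e3] with g h1 h2 h3
    exact ⟨h1, h2, h3⟩
  have hmat4 : ∀ g ∈ U, ∀ i j, ‖matOf g i j‖ ≤ 4 := by
    intro g hg i j
    have h := Complex.norm_le_abs_re_add_abs_im (matOf g i j)
    have h1 := hg.1 (i, j, false)
    have h2 := hg.1 (i, j, true)
    have hre : (matOf g i j).re = g (i, j, false) := by simp [matOf]
    have him : (matOf g i j).im = g (i, j, true) := by simp [matOf]
    rw [hre, him] at h
    linarith
  have hf : ∀ g ∈ U, ∀ a, |f g a| ≤ 4 * m := by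
    intro g hg a
    have h1 : ‖∑ j, matOf g a.1 (Fin.castSucc j) * w g j‖ ≤ 4 * m := by
      refine (norm_sum_le _ _).trans ?_
      calc _ ≤ ∑ j : Fin m, (4 : ℝ) * 1 := by
            refine Finset.sum_le_sum fun j _ => ?_
            rw [norm_mul]
            exact mul_le_mul (hmat4 g hg _ _) (hg.2.2 j) (norm_nonneg _) (by norm_num)
        _ = _ := by simp; ring
    refine le_trans ?_ h1
    simp only [f]
    split_ifs
    · exact Complex.abs_im_le_norm _
    · exact Complex.abs_re_le_norm _
  obtain ⟨c, hc, hprob⟩ := aux_prob p x₀ (by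
    intro a ha
    simp only [p, not_not] at ha
    simp only [x₀]
    rw [if_neg]
    omega) U hU f (4 * m) (by positivity) hf
  refine ⟨C, c, hC, hc, ?_⟩
  intro η q hη hη1 hq
  have hcard : Fintype.card {a // ¬ p a} ≤ 2 * (l + 1) := by
    have : Function.Injective (fun a : {a // ¬ p a} =>
        ((⟨a.1.1.val - m, by have := a.1.1.2; omega⟩, a.1.2.2) : Fin (l + 1) × Bool)) := by
      rintro ⟨⟨i, j, s⟩, h⟩ ⟨⟨i', j', s'⟩, h'⟩ hh
      simp only [p, not_not] at h h'
      simp only [Prod.mk.injEq, Fin.mk.injEq] at hh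
      simp only [Subtype.mk.injEq, Prod.mk.injEq]
      refine ⟨Fin.ext (by omega), h.2.trans h'.2.symm, hh.2⟩
    have := Fintype.card_le_of_injective _ this
    simpa [mul_comm] using this
  have hle : c * η ^ (2 * (l + 1)) ≤ c * η ^ (Fintype.card {a // ¬ p a}) :=
    mul_le_mul_of_nonneg_left (pow_le_pow_of_le_one hη.le hη1 hcard) hc.le
  refine hle.trans ?_
  refine hprob η hη hη1 _ ?_
  intro g hgU hg
  set r : (Fin (m + 1 + l) × Fin (m + 1) × Bool) → ℝ := fun i => if p i then g i else 0 with hr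
  have hr1 : ∀ i j s, p (i, j, s) → r (i, j, s) = g (i, j, s) := by
    intro i j s h
    simp only [hr, if_pos h]
  have hpc : ∀ i (j : Fin m) s, p (i, Fin.castSucc j, s) := by
    intro i j s h
    exact (Fin.castSucc_lt_last j).ne h.2
  have hmr : ∀ i (j : Fin m), matOf g i (Fin.castSucc j) = matOf r i (Fin.castSucc j) := by
    intro i j
    simp only [matOf, hr1 i _ _ (hpc i j _)]
  refine hdet (matOf g) (w r) η q hq hη.le ?_ hgU.2.2 ?_
  · intro i j
    rw [hmr]
    exact hmat4 r hgU _ _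
  · intro i
    simp only [hmr]
    by_cases hi : m ≤ i.val
    · have hn : ∀ s, ¬ p (i, Fin.last m, s) := fun s h => h ⟨hi, rfl⟩
      have h1 := hg _ (hn false)
      have h2 := hg _ (hn true)
      simp only [f, Bool.false_eq_true, if_false, if_true] at h1 h2
      refine (Complex.norm_le_abs_re_add_abs_im _).trans ?_
      rw [Complex.sub_re, Complex.sub_im]
      have hre : (matOf g i (Fin.last m)).re = g (i, Fin.last m, false) := by simp [matOf]
      have him : (matOf g i (Fin.last m)).im = g (i, Fin.last m, true) := by simp [matOf]
      rw [hre, him]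
      linarith
    · have hp : ∀ s, p (i, Fin.last m, s) := fun s h => hi h.1
      have hl : matOf g i (Fin.last m) = matOf r i (Fin.last m) := by
        simp only [matOf, hr1 i _ _ (hp _)]
      have hAw : (A r).mulVec (w r) = b r := by
        simp only [w]
        rw [Matrix.mulVec_mulVec, Matrix.mul_nonsing_inv _ (isUnit_iff_ne_zero.2 hgU.2.1),
          Matrix.one_mulVec]
      have hthis : ∑ j, matOf r i (Fin.castSucc j) * w r j = matOf r i (Fin.last m) :=
        congrFun hAw ⟨i.val, by omega⟩
      rw [hl, hthis, sub_self, norm_zero]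
      positivity

/-- Let `H` be an `N × M` random matrix (`M ≤ N`) with i.i.d.
circularly-symmetric complex Gaussian entries of zero mean and unit variance, let `T ≥ 1`,
and let `L` be a full-rank `MT × MT` complex matrix generating a complex lattice of unit
volume (`det(LᴴL)^{1/2} = 1`).  With `H_T` the `NT × MT` block-diagonal matrix with `T`
copies of `H`, and `d(H_T L)` the minimum distance of the faded lattice,
`limsup_{ε→0⁺} log Pr{d(H_T L) ≤ ε}/log ε ≤ 2M(N−M+1)`; equivalently, for every `δ > 0`
there is `ε₀ > 0` with `Pr{d(H_T L) ≤ ε} ≥ ε^{2M(N−M+1)+δ}` for all `0 < ε < ε₀`. -/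
theorem faded_lattice_short_vector_probability_exponent
    (M N T : ℕ) (hM : 1 ≤ M) (hMN : M ≤ N) (hT : 1 ≤ T)
    (L : Matrix (Fin M × Fin T) (Fin M × Fin T) ℂ) (hL : L.det ≠ 0)
    (hvol : Real.sqrt ‖(L.conjTranspose * L).det‖ = 1) :
    ∀ δ : ℝ, 0 < δ → ∃ ε₀ : ℝ, 0 < ε₀ ∧ ∀ ε : ℝ, 0 < ε → ε < ε₀ →
      ε ^ (2 * (M : ℝ) * ((N : ℝ) - (M : ℝ) + 1) + δ) ≤
        ((gaussMatMeasure N M)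
          {g | latMinDist ((Matrix.blockDiagonal fun _ : Fin T => matOf g) * L) ≤ ε}).toReal := by
  obtain ⟨m, rfl⟩ : ∃ m, M = m + 1 := ⟨M - 1, by omega⟩
  obtain ⟨l, rfl⟩ := Nat.exists_eq_add_of_le hMN
  obtain ⟨C, c, hC, hc, hev⟩ := aux_event m l T hT L
  intro δ hδ
  set a : ℝ := 1 / (2 * (C + 1) * (2 * C + 1) ^ m) with ha
  have ha0 : 0 < a := by positivity
  have ha1 : a ≤ 1 := by
    rw [ha, div_le_one (by positivity)]
    have : 1 ≤ (2 * C + 1) ^ m := one_le_pow₀ (by linarith)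
    nlinarith
  set c' : ℝ := c * a ^ (2 * (l + 1)) with hc'
  have hc'0 : 0 < c' := by positivity
  refine ⟨min 1 (c' ^ (1 / δ)), lt_min one_pos (Real.rpow_pos_of_pos hc'0 _), ?_⟩
  intro ε hε hεlt
  have hε1 : ε ≤ 1 := (hεlt.trans_le (min_le_left _ _)).le
  have hε2 : ε ≤ c' ^ (1 / δ) := (hεlt.trans_le (min_le_right _ _)).le
  have hεδ : ε ^ δ ≤ c' := by
    calc ε ^ δ ≤ (c' ^ (1 / δ)) ^ δ := Real.rpow_le_rpow hε.le hε2 hδ.le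
      _ = c' := by
        rw [← Real.rpow_mul hc'0.le, one_div_mul_cancel hδ.ne', Real.rpow_one]
  set q : ℕ := ⌈2 * C / ε⌉₊ with hqd
  have hqge : 2 * C / ε ≤ q := Nat.le_ceil _
  have hq0' : (0 : ℝ) < q := lt_of_lt_of_le (by positivity) hqge
  have hq0 : 0 < q := by exact_mod_cast hq0'
  have hqle : (q : ℝ) ≤ (2 * C + 1) / ε := by
    have h1 : (q : ℝ) < 2 * C / ε + 1 := Nat.ceil_lt_add_one (by positivity)
    have h2 : 1 ≤ 1 / ε := by rw [le_div_iff₀ hε]; linarith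
    rw [add_div]; linarith
  set η : ℝ := a * ε ^ (m + 1) with hηd
  have hη0 : 0 < η := by positivity
  have hη1 : η ≤ 1 := mul_le_one₀ ha1 (by positivity) (pow_le_one₀ hε.le hε1)
  have hbound : C * (q ^ m * η + 1 / q) ≤ ε := by
    have h1 : C * (1 / q) ≤ ε / 2 := by
      rw [mul_one_div, div_le_iff₀ hq0']
      rw [div_le_iff₀ hε] at hqge
      linarith
    have h2 : C * (q ^ m * η) ≤ ε / 2 := by
      calc C * (q ^ m * η) ≤ C * (((2 * C + 1) / ε) ^ m * η) := by gcongr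
        _ = C / (C + 1) * (ε / 2) := by
          rw [hηd, ha, div_pow, pow_succ]; field_simp
        _ ≤ 1 * (ε / 2) := by
          apply mul_le_mul_of_nonneg_right _ (by positivity)
          rw [div_le_one (by positivity)]; linarith
        _ = ε / 2 := one_mul _
    linarith
  have hmain := hev η q hη0 hη1 hq0
  have hfin : (gaussMatMeasure (m + 1 + l) (m + 1))
      {g | latMinDist ((Matrix.blockDiagonal fun _ : Fin T => matOf g) * L) ≤ ε} ≠ ⊤ := by
    unfold gaussMatMeasure
    exact measure_ne_top _ _
  have hmono := ENNReal.toReal_mono hfin (measure_mono (μ := gaussMatMeasure (m + 1 + l) (m + 1))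
    (s := {g | latMinDist ((Matrix.blockDiagonal fun _ : Fin T => matOf g) * L) ≤
            C * (q ^ m * η + 1 / q)}) (fun g hg => le_trans hg hbound))
  refine le_trans ?_ (hmain.trans hmono)
  have hexp : 2 * ((m + 1 : ℕ) : ℝ) * (((m + 1 + l : ℕ) : ℝ) - ((m + 1 : ℕ) : ℝ) + 1) =
      (((m + 1) * (2 * (l + 1)) : ℕ) : ℝ) := by
    push_cast; ring
  rw [hexp, Real.rpow_add hε, Real.rpow_natCast]
  calc ε ^ ((m + 1) * (2 * (l + 1))) * ε ^ δ ≤ ε ^ ((m + 1) * (2 * (l + 1))) * c' := by gcongr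
    _ = c * η ^ (2 * (l + 1)) := by
      rw [hc', hηd, mul_pow, ← pow_mul]; ring
end
end

section
/- Consider a V-BLAST system with M = N ≥ 2 transmit and receive antennas: the channel matrix H is M×M with i.i.d. circularly-symmetric complex Gaussian entries of zero mean and unit variance, the transmitted vector is x = α s for a fixed finite constellation S ⊂ ℤ[i]^M (containing at least two points) and a power-normalizing scalar α > 0 with average power P, the noise w has i.i.d. circularly-symmetric complex Gaussian entries of variance σ², and ρ = MP/σ². Let P_ML(ρ) be the error probability of maximum-likelihood decoding (choosing the codeword αs′, s′ ∈ S, closest to y = Hx + w), and let P_NLD(ρ) be the error probability of naive lattice decoding (the event that the transmitted point αs is not the unique closest point of the infinite lattice αℤ[i]^M, viewed through H, to y). Then there exist constants c, c′ > 0 such that for all sufficiently large ρ, P_ML(ρ) ≤ c′ ρ^{−M} and P_NLD(ρ) ≥ c ρ^{−M} ln ρ; consequently P_NLD(ρ)/P_ML(ρ) → ∞ as ρ → ∞, i.e. the naive lattice decoder has an asymptotically unbounded SNR loss compared to ML decoding although both achieve diversity order M. -/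
open MeasureTheory ProbabilityTheory Matrix Filter Set

noncomputable section

/-- Sample space measure for a complex Gaussian noise vector indexed by `ι` with
per-entry (complex) variance `σ2`: each real coordinate is an independent real Gaussian
of mean `0` and variance `σ2/2`. -/
def noiseMeasure (ι : Type*) [Fintype ι] (σ2 : ℝ) : Measure ((ι × Bool) → ℝ) :=
  Measure.pi fun _ => gaussianReal 0 (σ2 / 2).toNNReal

/-- The complex noise vector built from a sample of real coordinates. -/
def noiseOf {ι : Type*} (w : (ι × Bool) → ℝ) : ι → ℂ :=
  fun i => (w (i, false) : ℂ) + (w (i, true) : ℂ) * Complex.I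

/-- Error probability of maximum-likelihood decoding for the V-BLAST system with
constellation `S ⊂ ℤ[i]^M`, scaling `α` and noise of per-entry variance `σ2`: the
probability (averaged over a uniformly chosen `s ∈ S`, the channel and the noise) that the
transmitted codeword `αs` is not the unique closest codeword to `y = H(αs) + w`. -/
def PeML (M : ℕ) (S : Finset (Fin M → GaussianInt)) (α σ2 : ℝ) : ℝ :=
  (∑ s ∈ S,
      (((gaussMatMeasure M M).prod (noiseMeasure (Fin M) σ2))
        {q | ∃ s' ∈ S, s' ≠ s ∧
          cnorm (((matOf q.1).mulVec (fun i => (α : ℂ) * (s i : ℂ)) + noiseOf q.2) -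
              (matOf q.1).mulVec fun i => (α : ℂ) * (s' i : ℂ)) ≤
            cnorm (((matOf q.1).mulVec (fun i => (α : ℂ) * (s i : ℂ)) + noiseOf q.2) -
              (matOf q.1).mulVec fun i => (α : ℂ) * (s i : ℂ))}).toReal) / S.card

/-- Error probability of naive lattice decoding for the V-BLAST system: the probability
(averaged over a uniformly chosen `s ∈ S`, the channel and the noise) that the transmitted
point `αs` is not the unique closest point of the infinite lattice `α·ℤ[i]^M`, viewed
through `H`, to `y = H(αs) + w`. -/
def PeNLD (M : ℕ) (S : Finset (Fin M → GaussianInt)) (α σ2 : ℝ) : ℝ :=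
  (∑ s ∈ S,
      (((gaussMatMeasure M M).prod (noiseMeasure (Fin M) σ2))
        {q | ∃ z : Fin M → GaussianInt, z ≠ s ∧
          cnorm (((matOf q.1).mulVec (fun i => (α : ℂ) * (s i : ℂ)) + noiseOf q.2) -
              (matOf q.1).mulVec fun i => (α : ℂ) * (z i : ℂ)) ≤
            cnorm (((matOf q.1).mulVec (fun i => (α : ℂ) * (s i : ℂ)) + noiseOf q.2) -
              (matOf q.1).mulVec fun i => (α : ℂ) * (s i : ℂ))}).toReal) / S.card


lemma prod_lower {A B : Type*} [MeasurableSpace A] [MeasurableSpace B] (μ : Measure A)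
    (ν : Measure B) [SFinite μ] [SFinite ν] (T : Set (A × B)) (G : Set A) (m : ENNReal)
    (h : ∀ x ∈ G, m ≤ ν {y | (x, y) ∈ T}) : m * μ G ≤ (μ.prod ν) T := by
  rw [← measure_toMeasurable T, Measure.prod_apply (measurableSet_toMeasurable _ _)]
  refine le_trans ?_ (mul_meas_ge_le_lintegral
    (measurable_measure_prodMk_left (measurableSet_toMeasurable _ _)) m)
  gcongr
  intro x hx
  refine (h x hx).trans (measure_mono ?_)
  intro y hy
  exact subset_toMeasurable _ _ hy

lemma pi_lower {ι : Type*} [Fintype ι] (μ : Measure ℝ) [IsProbabilityMeasure μ]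
    (p : ι → Prop) [DecidablePred p] (T : Set (ι → ℝ)) (I : ι → Set ℝ) (m : ENNReal)
    (h : ∀ x : ι → ℝ, (∀ k, p k → x k ∈ I k) →
      m ≤ (Measure.pi fun _ : {k // ¬ p k} => μ)
        {y | (fun k => if h : p k then x k else y ⟨k, h⟩) ∈ T}) :
    m * ∏ k : {k // p k}, μ (I k) ≤ (Measure.pi fun _ : ι => μ) T := by
  have hp := (measurePreserving_piEquivPiSubtypeProd (fun _ : ι => μ) p).symm
  rw [← hp.measure_preimage_equiv, ← Measure.pi_pi]
  apply prod_lower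
  intro x hx
  refine (h (fun k => if hk : p k then x ⟨k, hk⟩ else 0) ?_).trans (measure_mono ?_)
  · intro k hk
    simpa [hk] using hx ⟨k, hk⟩ (mem_univ _)
  · intro y hy
    simp only [mem_preimage, Set.mem_ofPred_eq] at hy ⊢
    convert! hy using 1
    ext k
    by_cases hk : p k <;> simp [MeasurableEquiv.piEquivPiSubtypeProd, Equiv.piEquivPiSubtypeProd, hk]

lemma pi_upper {ι : Type*} [Fintype ι] (μ : Measure ℝ) [IsProbabilityMeasure μ]
    (p : ι → Prop) [DecidablePred p] (T : Set (ι → ℝ)) (hT : MeasurableSet T) (m : ENNReal)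
    (h : ∀ x : ι → ℝ, (Measure.pi fun _ : {k // ¬ p k} => μ)
        {y | (fun k => if h : p k then x k else y ⟨k, h⟩) ∈ T} ≤ m) :
    (Measure.pi fun _ : ι => μ) T ≤ m := by
  have hp := (measurePreserving_piEquivPiSubtypeProd (fun _ : ι => μ) p).symm
  rw [← hp.measure_preimage_equiv, Measure.prod_apply (hp.measurable hT)]
  refine (lintegral_mono (g := fun _ => m) ?_).trans (by simp)
  intro x
  refine le_trans (measure_mono ?_) (h (fun k => if hk : p k then x ⟨k, hk⟩ else 0))
  intro y hy
  simp only [mem_preimage, Set.mem_ofPred_eq] at hy ⊢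
  convert! hy using 1
  ext k
  by_cases hk : p k <;> simp [MeasurableEquiv.piEquivPiSubtypeProd, Equiv.piEquivPiSubtypeProd, hk]

lemma half_ne : (1/2 : NNReal) ≠ 0 := by norm_num

lemma gauss_icc_upper (a r : ℝ) :
    gaussianReal 0 (1/2) (Icc (a - r) (a + r)) ≤ ENNReal.ofReal (2 * r) := by
  rw [gaussianReal_apply _ half_ne]
  calc ∫⁻ x in Icc (a - r) (a + r), gaussianPDF 0 (1/2) x
      ≤ ∫⁻ x in Icc (a - r) (a + r), 1 := by
        apply lintegral_mono
        intro x
        simp only [gaussianPDF, ENNReal.ofReal_le_one, gaussianPDFReal]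
        apply mul_le_one₀
        · apply inv_le_one_of_one_le₀
          rw [Real.one_le_sqrt]
          have := Real.pi_gt_three
          push_cast
          linarith
        · positivity
        · rw [Real.exp_le_one_iff]
          have : 0 ≤ (x - 0)^2 / (2 * ((1/2 : NNReal) : ℝ)) := by positivity
          rw [neg_div]; linarith
    _ = _ := by
        rw [setLIntegral_const, Real.volume_Icc, one_mul]; ring_nf

lemma gauss_icc_lower (R : ℝ) : ∃ δ : ℝ, 0 < δ ∧ ∀ a r : ℝ, |a| ≤ R → 0 ≤ r → r ≤ 1 →
    ENNReal.ofReal (δ * r) ≤ gaussianReal 0 (1/2) (Icc (a - r) (a + r)) := by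
  refine ⟨gaussianPDFReal 0 (1/2) (R+1) * 2, mul_pos (gaussianPDFReal_pos _ _ _ half_ne) two_pos, ?_⟩
  intro a r ha hr hr1
  rw [gaussianReal_apply _ half_ne]
  calc _ = ∫⁻ x in Icc (a - r) (a + r), ENNReal.ofReal (gaussianPDFReal 0 (1/2) (R+1)) := by
        rw [setLIntegral_const, Real.volume_Icc, ← ENNReal.ofReal_mul (gaussianPDFReal_nonneg _ _ _)]
        ring_nf
    _ ≤ _ := by
        apply setLIntegral_mono (measurable_gaussianPDF _ _)
        intro x hx
        simp only [gaussianPDF]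
        apply ENNReal.ofReal_le_ofReal
        simp only [gaussianPDFReal]
        obtain ⟨h1, h2⟩ := hx
        obtain ⟨h3, h4⟩ := abs_le.mp ha
        have hsq : (x - 0) ^ 2 ≤ (R + 1 - 0) ^ 2 := by
          apply sq_le_sq' <;> linarith
        gcongr

instance gauss_openPos (v : NNReal) [Fact (v ≠ 0)] :
    Measure.IsOpenPosMeasure (gaussianReal 0 v) :=
  (gaussianReal_absolutelyContinuous' 0 (Fact.out)).isOpenPosMeasure

lemma boxes_lower {κ : Type*} [Fintype κ] {β : Type*} (R : ℝ) (δ : ℝ) (hδ : 0 < δ)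
    (hg : ∀ a r : ℝ, |a| ≤ R → 0 ≤ r → r ≤ 1 →
    ENNReal.ofReal (δ * r) ≤ gaussianReal 0 (1/2) (Icc (a - r) (a + r)))
    (X : Finset β) (c : β → κ → ℝ) (r : β → ℝ) (T : Set (κ → ℝ))
    (hc : ∀ x ∈ X, ∀ k, |c x k| ≤ R) (hr : ∀ x ∈ X, 0 ≤ r x ∧ r x ≤ 1)
    (hdis : ∀ x ∈ X, ∀ x' ∈ X, ∀ y : κ → ℝ, (∀ k, |y k - c x k| ≤ r x) →
      (∀ k, |y k - c x' k| ≤ r x') → x = x')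
    (hsub : ∀ x ∈ X, ∀ y : κ → ℝ, (∀ k, |y k - c x k| ≤ r x) → y ∈ T) :
    ENNReal.ofReal (∑ x ∈ X, (δ * r x) ^ Fintype.card κ) ≤
      (Measure.pi fun _ : κ => gaussianReal 0 (1/2)) T := by
  set B : β → Set (κ → ℝ) := fun x => Set.univ.pi fun k => Icc (c x k - r x) (c x k + r x) with hB
  have hmem : ∀ x y, y ∈ B x ↔ ∀ k, |y k - c x k| ≤ r x := by
    intro x y
    simp only [hB, Set.mem_univ_pi, Set.mem_Icc, abs_le]
    refine forall_congr' fun k => ⟨fun h => ⟨by linarith [h.1], by linarith [h.2]⟩,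
      fun h => ⟨by linarith [h.1], by linarith [h.2]⟩⟩
  calc _ ≤ ∑ x ∈ X, (Measure.pi fun _ : κ => gaussianReal 0 (1/2)) (B x) := by
        rw [ENNReal.ofReal_sum_of_nonneg]
        · apply Finset.sum_le_sum
          intro x hx
          rw [hB, Measure.pi_pi, ENNReal.ofReal_pow (mul_nonneg hδ.le (hr x hx).1)]
          calc _ = ∏ k : κ, ENNReal.ofReal (δ * r x) := by simp
            _ ≤ _ := Finset.prod_le_prod' fun k _ => hg _ _ (hc x hx k) (hr x hx).1 (hr x hx).2
        · intro x hx
          exact pow_nonneg (mul_nonneg hδ.le (hr x hx).1) _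
    _ = (Measure.pi fun _ : κ => gaussianReal 0 (1/2)) (⋃ x ∈ X, B x) := by
        rw [measure_biUnion_finset]
        · intro x hx x' hx' hne
          rw [Function.onFun, Set.disjoint_left]
          intro y hy hy'
          exact hne (hdis x hx x' hx' y ((hmem _ _).1 hy) ((hmem _ _).1 hy'))
        · intro x _
          exact MeasurableSet.univ_pi fun k => measurableSet_Icc
    _ ≤ _ := by
        apply measure_mono
        intro y hy
        simp only [Set.mem_iUnion] at hy
        obtain ⟨x, hx, hy⟩ := hy
        exact hsub x hx y ((hmem _ _).1 hy)

lemma gi_norm_sq (q : GaussianInt) : ‖(q : ℂ)‖ ^ 2 = (q.re : ℝ) ^ 2 + (q.im : ℝ) ^ 2 := by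
  rw [← Complex.normSq_eq_norm_sq, Complex.normSq_apply, GaussianInt.intCast_re,
    GaussianInt.intCast_im]
  ring

lemma gi_one_le (q : GaussianInt) (hq : q ≠ 0) : 1 ≤ ‖(q : ℂ)‖ := by
  have h : (1:ℝ) ≤ ‖(q : ℂ)‖ ^ 2 := by
    rw [gi_norm_sq]
    have : (1:ℤ) ≤ q.re ^ 2 + q.im ^ 2 := by
      by_contra hc
      have h1 : q.re ^ 2 + q.im ^ 2 ≤ 0 := by linarith
      have h2 : q.re = 0 := by nlinarith [sq_nonneg q.re, sq_nonneg q.im]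
      have h3 : q.im = 0 := by nlinarith [sq_nonneg q.re, sq_nonneg q.im]
      exact hq (Zsqrtd.ext h2 h3)
    exact_mod_cast this
  nlinarith [norm_nonneg (q : ℂ)]

lemma gi_summable (M : ℕ) (hM : 2 ≤ M) :
    Summable fun t : GaussianInt => (‖(t : ℂ)‖ ^ (2 * M))⁻¹ := by
  have h1 := EisensteinSeries.summable_one_div_norm_rpow (k := ((2 * M : ℕ) : ℝ))
    (by exact_mod_cast (by omega : 2 < 2 * M))
  let f : GaussianInt → (Fin 2 → ℤ) := fun t => ![t.re, t.im]
  have hf : Function.Injective f := by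
    intro a b hab
    have h0 := congrFun hab 0
    have h1 := congrFun hab 1
    exact Zsqrtd.ext (by simpa [f] using h0) (by simpa [f] using h1)
  refine (h1.comp_injective hf).of_nonneg_of_le (fun t => by positivity) ?_
  intro t
  simp only [Function.comp]
  rw [Real.rpow_neg (norm_nonneg _), Real.rpow_natCast]
  by_cases ht : t = 0
  · subst ht
    simp [show 2 * M ≠ 0 by omega]
  · have hpos : 0 < ‖f t‖ := by
      rw [norm_pos_iff]
      intro h
      apply ht
      apply hf
      rw [h]; ext i; fin_cases i <;> simp [f]
    gcongr
    rw [pi_norm_le_iff_of_nonneg (norm_nonneg _)]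
    intro i
    have hs := gi_norm_sq t
    have : ∀ n : ℤ, ((n:ℝ))^2 ≤ ‖(t:ℂ)‖^2 → ‖n‖ ≤ ‖(t:ℂ)‖ := by
      intro n hn
      rw [Int.norm_eq_abs]
      exact abs_le_of_sq_le_sq hn (norm_nonneg _)
    fin_cases i
    · apply this; simp only [f]; rw [hs]; simp; positivity
    · apply this; simp only [f]; rw [hs]; simp; positivity

lemma prim_exists {M : ℕ} (j0 : Fin M) (d : Fin M → GaussianInt) (hd : d j0 ≠ 0) :
    ∃ e : Fin M → GaussianInt, e j0 ≠ 0 ∧ (∀ j, e j * d j0 = d j * e j0) ∧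
      ∀ f : Fin M → GaussianInt, f j0 ≠ 0 → (∀ j, f j * d j0 = d j * f j0) →
        ∃ t : GaussianInt, ∀ j, f j = t * e j := by
  let I : Ideal GaussianInt :=
    { carrier := {q | ∀ j, d j0 ∣ q * d j}
      add_mem' := by
        intro a b ha hb j
        rw [add_mul]; exact dvd_add (ha j) (hb j)
      zero_mem' := by intro j; simp
      smul_mem' := by
        intro c x hx j
        rw [smul_eq_mul, mul_assoc]; exact Dvd.dvd.mul_left (hx j) c }
  obtain ⟨q0, hq0⟩ := (IsPrincipalIdealRing.principal I).principal
  have hmem : ∀ x, x ∈ I ↔ ∃ t, t * q0 = x := by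
    intro x
    rw [hq0]
    exact Ideal.mem_span_singleton'
  have hq0I : q0 ∈ I := (hmem q0).2 ⟨1, one_mul _⟩
  have hdI : d j0 ∈ I := fun j => dvd_mul_right _ _
  choose e he using hq0I
  have hej0 : e j0 = q0 := by
    have := he j0
    rw [mul_comm] at this
    exact (mul_left_cancel₀ hd this).symm
  refine ⟨e, ?_, ?_, ?_⟩
  · rw [hej0]
    intro h
    obtain ⟨t, ht⟩ := (hmem _).1 hdI
    rw [h, mul_zero] at ht
    exact hd ht.symm
  · intro j
    rw [hej0, mul_comm, ← he j, mul_comm]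
  · intro f hf hfj
    have : f j0 ∈ I := fun j => ⟨f j, by rw [mul_comm, ← hfj j, mul_comm]⟩
    obtain ⟨t, ht⟩ := (hmem _).1 this
    refine ⟨t, fun j => mul_right_cancel₀ hd ?_⟩
    rw [hfj, ← ht]
    calc d j * (t * q0) = t * (q0 * d j) := by ring
      _ = t * (d j0 * e j) := by rw [he j]
      _ = _ := by ring

/-- The points of level `a`. -/
def lev {M : ℕ} (j0 : Fin M) (a : ℕ) : Finset (Fin M → GaussianInt) :=
  Fintype.piFinset fun j => if j = j0 then
    (Finset.range a).image (fun b : ℕ => (⟨(a:ℤ), (b:ℤ)⟩ : GaussianInt)) else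
    (Finset.range a ×ˢ Finset.range a).image
      (fun b : ℕ × ℕ => (⟨(b.1:ℤ), (b.2:ℤ)⟩ : GaussianInt))

lemma lev_mem {M : ℕ} (j0 : Fin M) (a : ℕ) (ha : 1 ≤ a) (d) (hd : d ∈ lev j0 a) :
    (d j0).re = a ∧ d j0 ≠ 0 ∧ ‖(d j0 : ℂ)‖ ≤ 2 * a ∧ ∀ j, ‖(d j : ℂ)‖ ≤ 2 * ‖(d j0 : ℂ)‖ := by
  rw [lev, Fintype.mem_piFinset] at hd
  have h0 := hd j0
  simp only [if_true, Finset.mem_image, Finset.mem_range] at h0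
  obtain ⟨b, hb, hbe⟩ := h0
  have hre : (d j0).re = a := by rw [← hbe]
  have him : (d j0).im = b := by rw [← hbe]
  have hsq := gi_norm_sq (d j0)
  rw [hre, him] at hsq
  push_cast at hsq
  have hba : (b:ℝ) ≤ a := by exact_mod_cast hb.le
  have hb0 : (0:ℝ) ≤ b := by positivity
  have ha1 : (1:ℝ) ≤ a := by exact_mod_cast ha
  have hlow : (a:ℝ) ≤ ‖(d j0 : ℂ)‖ := by
    apply le_of_sq_le_sq _ (norm_nonneg _)
    nlinarith
  refine ⟨hre, ?_, ?_, ?_⟩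
  · intro h
    rw [h] at hre
    simp at hre
    omega
  · apply le_of_sq_le_sq _ (by positivity)
    nlinarith
  · intro j
    by_cases hj : j = j0
    · subst hj; linarith [norm_nonneg (d j : ℂ)]
    · have h1 := hd j
      simp only [hj, if_false, Finset.mem_image, Finset.mem_product, Finset.mem_range] at h1
      obtain ⟨⟨x, y⟩, ⟨hx, hy⟩, hxy⟩ := h1
      have hsq' := gi_norm_sq (d j)
      rw [← hxy] at hsq'
      push_cast at hsq'
      have hx' : (x:ℝ) ≤ a := by exact_mod_cast hx.le
      have hy' : (y:ℝ) ≤ a := by exact_mod_cast hy.le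
      have hx0 : (0:ℝ) ≤ x := by positivity
      have hy0 : (0:ℝ) ≤ y := by positivity
      have : ‖(d j : ℂ)‖ ≤ 2 * a := by
        apply le_of_sq_le_sq _ (by positivity)
        rw [← hxy, hsq']
        nlinarith
      linarith

lemma lev_card {M : ℕ} (hM : 1 ≤ M) (j0 : Fin M) (a : ℕ) : (lev j0 a).card = a ^ (2 * M - 1) := by
  rw [lev, Fintype.card_piFinset]
  rw [← Finset.mul_prod_erase _ _ (Finset.mem_univ j0)]
  rw [if_pos rfl, Finset.card_image_of_injective, Finset.card_range]
  · rw [Finset.prod_congr rfl (g := fun _ => a * a)]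
    · rw [Finset.prod_const, Finset.card_erase_of_mem (Finset.mem_univ _), Finset.card_univ,
        Fintype.card_fin, ← pow_two, ← pow_mul, ← pow_succ']
      congr 1; omega
    · intro j hj
      rw [if_neg (Finset.ne_of_mem_erase hj), Finset.card_image_of_injective, Finset.card_product,
        Finset.card_range]
      rintro ⟨x, y⟩ ⟨x', y'⟩ h
      simp only [Zsqrtd.mk.injEq, Nat.cast_inj] at h
      exact Prod.ext h.1 h.2
  · intro x y h
    simpa using h

lemma lev_sum {M : ℕ} (hM : 2 ≤ M) (j0 : Fin M) (Q : ℕ) :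
    (4 ^ M : ℝ)⁻¹ * Real.log (Q + 1) ≤
      ∑ d ∈ (Finset.Icc 1 Q).biUnion (lev j0), (‖(d j0 : ℂ)‖ ^ (2 * M))⁻¹ := by
  rw [Finset.sum_biUnion]
  · have h1 := log_add_one_le_harmonic Q
    rw [harmonic_eq_sum_Icc] at h1
    push_cast at h1
    refine (mul_le_mul_of_nonneg_left h1 (by positivity)).trans ?_
    rw [Finset.mul_sum]
    apply Finset.sum_le_sum
    intro a ha
    have ha1 := (Finset.mem_Icc.1 ha).1
    have ha0 : (0:ℝ) < a := by exact_mod_cast ha1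
    have h2 : ∀ d ∈ lev j0 a, ((2 * (a:ℝ)) ^ (2 * M))⁻¹ ≤ (‖(d j0 : ℂ)‖ ^ (2 * M))⁻¹ := by
      intro d hd
      obtain ⟨-, h0, h1, -⟩ := lev_mem j0 a ha1 d hd
      have : 0 < ‖(d j0 : ℂ)‖ := by linarith [gi_one_le _ h0]
      gcongr
    refine le_trans ?_ (Finset.card_nsmul_le_sum _ _ _ h2)
    rw [lev_card (by omega), nsmul_eq_mul]
    push_cast
    apply le_of_eq
    rw [mul_pow, pow_mul 2 2 M]
    obtain ⟨m, rfl⟩ : ∃ m, M = m + 1 := ⟨M - 1, by omega⟩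
    rw [show 2 * (m + 1) - 1 = 2 * m + 1 by omega, show 2 * (m + 1) = 2 * m + 1 + 1 by omega]
    norm_num
    field_simp
    ring
  · intro a ha b hb hab
    rw [Function.onFun, Finset.disjoint_left]
    intro d hd hd'
    have h1 := (lev_mem j0 a (Finset.mem_Icc.1 ha).1 d hd).1
    have h2 := (lev_mem j0 b (Finset.mem_Icc.1 hb).1 d hd').1
    rw [h1] at h2
    exact hab (by exact_mod_cast h2)

lemma fractions {M : ℕ} (hM : 2 ≤ M) (j0 : Fin M) : ∃ c : ℝ, 0 < c ∧ ∀ Q : ℕ,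
    ∃ (X : Finset (Fin M → ℂ)) (e : (Fin M → ℂ) → Fin M → GaussianInt),
      (∀ x ∈ X, e x j0 ≠ 0 ∧ (∀ j, (e x j : ℂ) = x j * e x j0) ∧ ‖(e x j0 : ℂ)‖ ≤ 2 * Q ∧
        (∀ j, ‖x j‖ ≤ 2) ∧ x j0 = 1) ∧
      c * Real.log (Q + 1) ≤ ∑ x ∈ X, (‖(e x j0 : ℂ)‖ ^ (2 * M))⁻¹ := by
  classical
  have hsum := gi_summable M hM
  set C : ℝ := ∑' t : GaussianInt, (‖(t : ℂ)‖ ^ (2 * M))⁻¹ with hC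
  have hCpos : 0 < C := by
    refine lt_of_lt_of_le one_pos ?_
    have := hsum.sum_le_tsum {1} (fun t _ => by positivity)
    simpa using this
  refine ⟨C⁻¹ * (4 ^ M : ℝ)⁻¹, by positivity, ?_⟩
  intro Q
  set D := (Finset.Icc 1 Q).biUnion (lev j0) with hD
  have hDm : ∀ d ∈ D, d j0 ≠ 0 ∧ ‖(d j0 : ℂ)‖ ≤ 2 * Q ∧ ∀ j, ‖(d j : ℂ)‖ ≤ 2 * ‖(d j0 : ℂ)‖ := by
    intro d hd
    obtain ⟨a, ha, hda⟩ := Finset.mem_biUnion.1 hd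
    obtain ⟨h1, h2⟩ := Finset.mem_Icc.1 ha
    obtain ⟨-, h3, h4, h5⟩ := lev_mem j0 a h1 d hda
    refine ⟨h3, h4.trans ?_, h5⟩
    have : (a:ℝ) ≤ Q := by exact_mod_cast h2
    linarith
  set φ : (Fin M → GaussianInt) → (Fin M → ℂ) := fun d j => (d j : ℂ) / (d j0 : ℂ) with hφ
  have key : ∀ x ∈ D.image φ, ∃ e : Fin M → GaussianInt,
      (e j0 ≠ 0 ∧ (∀ j, (e j : ℂ) = x j * e j0) ∧ ‖(e j0 : ℂ)‖ ≤ 2 * Q ∧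
        (∀ j, ‖x j‖ ≤ 2) ∧ x j0 = 1) ∧
      ∑ d ∈ D with φ d = x, (‖(d j0 : ℂ)‖ ^ (2 * M))⁻¹ ≤ C * (‖(e j0 : ℂ)‖ ^ (2 * M))⁻¹ := by
    intro x hx
    obtain ⟨d, hd, rfl⟩ := Finset.mem_image.1 hx
    obtain ⟨hd0, hdQ, hdj⟩ := hDm d hd
    have hd0' : (d j0 : ℂ) ≠ 0 := by rwa [Ne, GaussianInt.toComplex_eq_zero]
    have hdn : 0 < ‖(d j0 : ℂ)‖ := norm_pos_iff.2 hd0'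
    obtain ⟨e, he0, hed, hef⟩ := prim_exists j0 d hd0
    have hprop : ∀ f ∈ D, φ f = φ d → ∃ t : GaussianInt, ∀ j, f j = t * e j := by
      intro f hf hfd
      obtain ⟨hf0, -, -⟩ := hDm f hf
      have hf0' : (f j0 : ℂ) ≠ 0 := by rwa [Ne, GaussianInt.toComplex_eq_zero]
      apply hef f hf0
      intro j
      have := congrFun hfd j
      simp only [hφ] at this
      rw [div_eq_div_iff hf0' hd0'] at this
      rw [← GaussianInt.toComplex_inj]
      simpa using this
    refine ⟨e, ⟨he0, ?_, ?_, ?_, ?_⟩, ?_⟩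
    · intro j
      have := congrArg GaussianInt.toComplex (hed j)
      simp only [map_mul] at this
      simp only [hφ]
      field_simp
      exact this
    · obtain ⟨t, ht⟩ := hprop d hd rfl
      have ht0 : t ≠ 0 := by
        rintro rfl
        apply hd0
        rw [ht j0, zero_mul]
      have h1 := gi_one_le t ht0
      refine le_trans ?_ hdQ
      rw [ht j0, map_mul, norm_mul]
      nlinarith [norm_nonneg (e j0 : ℂ)]
    · intro j
      simp only [hφ, norm_div]
      rw [div_le_iff₀ hdn]
      exact hdj j
    · simp only [hφ]
      exact div_self hd0'
    · choose! t ht using hprop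
      have hinj : Set.InjOn t (D.filter fun f => φ f = φ d : Finset _) := by
        intro f hf g hg hfg
        simp only [Finset.coe_filter, Set.mem_ofPred_eq] at hf hg
        ext1 j
        rw [ht f hf.1 hf.2 j, ht g hg.1 hg.2 j, hfg]
      calc _ = ∑ f ∈ D with φ f = φ d, (‖(t f : ℂ)‖ ^ (2 * M))⁻¹ * (‖(e j0 : ℂ)‖ ^ (2 * M))⁻¹ := by
            apply Finset.sum_congr rfl
            intro f hf
            rw [Finset.mem_filter] at hf
            rw [ht f hf.1 hf.2 j0, map_mul, norm_mul, mul_pow, mul_inv]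
        _ = (∑ u ∈ (D.filter fun f => φ f = φ d).image t, (‖(u : ℂ)‖ ^ (2 * M))⁻¹) *
              (‖(e j0 : ℂ)‖ ^ (2 * M))⁻¹ := by
            rw [Finset.sum_image hinj, Finset.sum_mul]
        _ ≤ _ := by
            gcongr
            exact hsum.sum_le_tsum _ (fun t _ => by positivity)
  choose! e he1 he2 using key
  refine ⟨D.image φ, e, he1, ?_⟩
  have h1 := lev_sum hM j0 Q
  rw [← hD, ← Finset.sum_fiberwise_of_maps_to (t := D.image φ) (g := φ)
    (fun d hd => Finset.mem_image_of_mem φ hd)] at h1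
  have h2 := h1.trans (Finset.sum_le_sum he2)
  rw [← Finset.mul_sum] at h2
  rw [mul_assoc, inv_mul_le_iff₀ hCpos]
  exact h2

lemma geom {M : ℕ} (j0 : Fin M) (H : Fin M → Fin M → ℂ)
    (hH : ∀ i j, j ≠ j0 → ‖H i j - (if i = j then 1 else 0)‖ ≤ 1 / (2 * M))
    (δ : Fin M → ℂ) (hδ : δ j0 = 0) (B : ℝ) (hB : ∀ i, ‖∑ j, H i j * δ j‖ ≤ B) (j : Fin M) :
    ‖δ j‖ ≤ 2 * B := by
  have hMpos : (0:ℝ) < M := by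
    have := j0.pos
    exact_mod_cast this
  obtain ⟨m, -, hm⟩ := Finset.exists_max_image Finset.univ (fun j => ‖δ j‖) ⟨j0, Finset.mem_univ _⟩
  refine (hm j (Finset.mem_univ _)).trans ?_
  have h1 : δ m = ∑ k, H m k * δ k - ∑ k, (H m k - (if m = k then 1 else 0)) * δ k := by
    rw [← Finset.sum_sub_distrib]
    simp [sub_mul]
  have h2 : ‖∑ k, (H m k - (if m = k then 1 else 0)) * δ k‖ ≤ ∑ k : Fin M, 1 / (2 * M) * ‖δ m‖ := by
    refine (norm_sum_le _ _).trans (Finset.sum_le_sum fun k _ => ?_)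
    rw [norm_mul]
    by_cases hk : k = j0
    · rw [hk, hδ, norm_zero, mul_zero]; positivity
    · exact mul_le_mul (hH m k hk) (hm k (Finset.mem_univ _)) (norm_nonneg _) (by positivity)
  rw [Finset.sum_const, Finset.card_univ, Fintype.card_fin, nsmul_eq_mul] at h2
  have h3 : (M:ℝ) * (1 / (2 * M) * ‖δ m‖) = ‖δ m‖ / 2 := by field_simp
  rw [h3] at h2
  have h4 : ‖δ m‖ ≤ B + ‖δ m‖ / 2 := by
    calc ‖δ m‖ = _ := by rw [h1]
      _ ≤ _ := norm_sub_le _ _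
      _ ≤ _ := add_le_add (hB m) h2
  linarith

lemma norm_re_im (a b : ℝ) (z : ℂ) (r : ℝ) (h1 : |a - z.re| ≤ r) (h2 : |b - z.im| ≤ r) :
    ‖(a : ℂ) + b * Complex.I - z‖ ≤ 2 * r := by
  refine (Complex.norm_le_abs_re_add_abs_im _).trans ?_
  simp
  linarith

lemma card_col {M : ℕ} (j0 : Fin M) :
    Fintype.card {k : Fin M × Fin M × Bool // ¬ k.2.1 ≠ j0} = 2 * M := by
  have E : {k : Fin M × Fin M × Bool // ¬ k.2.1 ≠ j0} ≃ Fin M × Bool :=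
    { toFun := fun k => (k.1.1, k.1.2.2)
      invFun := fun l => ⟨(l.1, j0, l.2), fun h => h rfl⟩
      left_inv := by
        rintro ⟨⟨i, j, b⟩, h⟩
        have h' : j = j0 := not_not.1 h
        subst h'
        rfl
      right_inv := fun _ => rfl }
  rw [Fintype.card_congr E]
  simp [mul_comm]

lemma core_lower (M : ℕ) (hM : 2 ≤ M) : ∃ c ε0 : ℝ, 0 < c ∧ 0 < ε0 ∧ ∀ ε : ℝ, 0 < ε → ε < ε0 →
    ENNReal.ofReal (c * ε ^ (2 * M) * Real.log (1 / ε)) ≤ gaussMatMeasure M M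
      {g | ∃ d : Fin M → GaussianInt, d ≠ 0 ∧
        ∀ i, ‖(matOf g).mulVec (fun j => (d j : ℂ)) i‖ ≤ ε} := by
  have hMpos : (0:ℝ) < M := by exact_mod_cast (by omega : 0 < M)
  have hM1 : (1:ℝ) ≤ M := by exact_mod_cast (by omega : 1 ≤ M)
  let j0 : Fin M := ⟨0, by omega⟩
  obtain ⟨c1, hc1, hfr⟩ := fractions hM j0
  obtain ⟨δ, hδ, hg⟩ := gauss_icc_lower (4 * M)
  let tgt : Fin M × Fin M × Bool → ℝ := fun k => if k.1 = k.2.1 ∧ k.2.2 = false then 1 else 0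
  let I : Fin M × Fin M × Bool → Set ℝ := fun k =>
    Icc (tgt k - 1 / (4 * M)) (tgt k + 1 / (4 * M))
  set p1 : ENNReal := ∏ k : {k : Fin M × Fin M × Bool // k.2.1 ≠ j0}, gaussianReal 0 (1/2) (I k)
    with hp1
  have hp1pos : 0 < p1 := by
    rw [pos_iff_ne_zero, hp1, Finset.prod_ne_zero_iff]
    intro k _
    rw [← pos_iff_ne_zero]
    refine lt_of_lt_of_le ?_ (hg _ _ ?_ ?_ ?_)
    · rw [ENNReal.ofReal_pos]; positivity
    · simp only [tgt]
      split_ifs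
      · simp; linarith
      · simp
    · positivity
    · rw [div_le_one (by positivity)]; linarith
  have hp1top : p1 ≠ ⊤ := by
    rw [hp1]
    exact ENNReal.prod_ne_top fun k _ => measure_ne_top _ _
  have hp1r : 0 < p1.toReal := ENNReal.toReal_pos hp1pos.ne' hp1top
  refine ⟨(δ / 2) ^ (2 * M) * c1 * (1 / 2) * p1.toReal, 1 / 256, by positivity, by norm_num, ?_⟩
  intro ε hε hε0
  set Q : ℕ := ⌊1 / (16 * ε)⌋₊ with hQ
  have hQle : (Q:ℝ) ≤ 1 / (16 * ε) := Nat.floor_le (by positivity)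
  have hQε : 16 * ε * Q ≤ 1 := by
    rw [le_div_iff₀ (by positivity)] at hQle
    linarith
  have hQlt : 1 / (16 * ε) < Q + 1 := Nat.lt_floor_add_one _
  obtain ⟨X, e, hX, hXsum⟩ := hfr Q
  set m : ℝ := ∑ x ∈ X, (δ * (ε / (2 * ‖(e x j0 : ℂ)‖))) ^ (2 * M) with hm
  have hlog : 1 / 2 * Real.log (1 / ε) ≤ Real.log (Q + 1) := by
    have h1 : Real.log (1 / (16 * ε)) ≤ Real.log (Q + 1) :=
      Real.log_le_log (by positivity) hQlt.le
    refine le_trans ?_ h1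
    have h2 : Real.log 256 ≤ Real.log (1 / ε) := by
      apply Real.log_le_log (by norm_num)
      rw [le_div_iff₀ hε]; linarith
    have h3 : Real.log 256 = 2 * Real.log 16 := by
      rw [show (256:ℝ) = 16 ^ 2 by norm_num, Real.log_pow]; norm_num
    have h4 : Real.log (1 / (16 * ε)) = Real.log (1 / ε) - Real.log 16 := by
      rw [show 1 / (16 * ε) = (1 / ε) / 16 by field_simp, Real.log_div (by positivity) (by norm_num)]
    rw [h4]; linarith
  have hmlow : (δ / 2) ^ (2 * M) * c1 * (1 / 2) * ε ^ (2 * M) * Real.log (1 / ε) ≤ m := by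
    have : m = (δ / 2) ^ (2 * M) * ε ^ (2 * M) * ∑ x ∈ X, (‖(e x j0 : ℂ)‖ ^ (2 * M))⁻¹ := by
      rw [hm, Finset.mul_sum]
      refine Finset.sum_congr rfl fun x hx => ?_
      rw [← inv_pow, ← mul_pow, ← mul_pow]
      congr 1
      have : ‖(e x j0 : ℂ)‖ ≠ 0 := by
        have := gi_one_le _ (hX x hx).1
        positivity
      field_simp
    rw [this]
    calc _ = (δ / 2) ^ (2 * M) * ε ^ (2 * M) * (c1 * (1 / 2 * Real.log (1 / ε))) := by ring
      _ ≤ (δ / 2) ^ (2 * M) * ε ^ (2 * M) * (c1 * Real.log (Q + 1)) := by gcongr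
      _ ≤ _ := by gcongr
  have hm0 : 0 ≤ m := Finset.sum_nonneg fun x _ => by positivity
  calc _ ≤ ENNReal.ofReal (m * p1.toReal) := by
        apply ENNReal.ofReal_le_ofReal
        calc _ = (δ / 2) ^ (2 * M) * c1 * (1 / 2) * ε ^ (2 * M) * Real.log (1 / ε) * p1.toReal := by
              ring
          _ ≤ _ := by gcongr
    _ = ENNReal.ofReal m * p1 := by rw [ENNReal.ofReal_mul hm0, ENNReal.ofReal_toReal hp1top]
    _ ≤ _ := by
      rw [hp1, gaussMatMeasure]
      apply pi_lower _ (fun k : Fin M × Fin M × Bool => k.2.1 ≠ j0)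
      intro x hx
      have hH : ∀ i j, j ≠ j0 → ‖matOf x i j - (if i = j then 1 else 0)‖ ≤ 1 / (2 * M) := by
        intro i j hj
        have h1 := hx (i, j, false) hj
        have h2 := hx (i, j, true) hj
        simp only [I, tgt, mem_Icc] at h1 h2
        have := norm_re_im (x (i, j, false)) (x (i, j, true)) (if i = j then 1 else 0) (1 / (4 * M))
          (by
            rw [abs_le]
            by_cases hij : i = j <;> simp [hij] at h1 ⊢ <;> constructor <;> linarith)
          (by
            rw [abs_le]
            by_cases hij : i = j <;> simp [hij] at h2 ⊢ <;> constructor <;> linarith)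
        refine this.trans (le_of_eq ?_)
        field_simp; norm_num
      let H' : Fin M → Fin M → ℂ := fun i j => if j = j0 then 0 else matOf x i j
      have hH' : ∀ i j, j ≠ j0 → ‖H' i j - (if i = j then 1 else 0)‖ ≤ 1 / (2 * M) := by
        intro i j hj
        simp only [H', hj, if_false]
        exact hH i j hj
      let cc : (Fin M → ℂ) → Fin M → ℂ := fun ξ i => - ∑ j, H' i j * ξ j
      rw [hm, ← card_col j0]
      have hepos : ∀ ξ ∈ X, 0 < ‖(e ξ j0 : ℂ)‖ := fun ξ hξ => by
        linarith [gi_one_le _ (hX ξ hξ).1]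
      let comb : ({k : Fin M × Fin M × Bool // ¬ k.2.1 ≠ j0} → ℝ) → (Fin M × Fin M × Bool) → ℝ :=
        fun y k => if h : k.2.1 ≠ j0 then x k else y ⟨k, h⟩
      have hclose : ∀ ξ ∈ X, ∀ y : {k : Fin M × Fin M × Bool // ¬ k.2.1 ≠ j0} → ℝ,
          (∀ k, |y k - (if k.1.2.2 then (cc ξ k.1.1).im else (cc ξ k.1.1).re)| ≤
            ε / (2 * ‖(e ξ j0 : ℂ)‖)) →
          ∀ i, ‖matOf (comb y) i j0 - cc ξ i‖ ≤ ε / ‖(e ξ j0 : ℂ)‖ := by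
        intro ξ hξ y hy i
        have h1 := hy ⟨(i, j0, false), by simp⟩
        have h2 := hy ⟨(i, j0, true), by simp⟩
        have := norm_re_im _ _ (cc ξ i) _ h1 h2
        have h3 : matOf (comb y) i j0 = (y ⟨(i, j0, false), by simp⟩ : ℂ) +
            (y ⟨(i, j0, true), by simp⟩ : ℂ) * Complex.I := by
          simp [matOf, comb]
        rw [h3]
        refine this.trans (le_of_eq ?_)
        have := (hepos ξ hξ).ne'
        field_simp
      refine boxes_lower (4 * M) δ hδ hg X
        (fun ξ k => if k.1.2.2 then (cc ξ k.1.1).im else (cc ξ k.1.1).re)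
        (fun ξ => ε / (2 * ‖(e ξ j0 : ℂ)‖)) _ ?_ ?_ ?_ ?_
      · intro ξ hξ k
        have hb : ‖cc ξ k.1.1‖ ≤ 4 * M := by
          simp only [cc, norm_neg]
          refine (norm_sum_le _ _).trans ?_
          calc _ ≤ ∑ j : Fin M, (4:ℝ) := by
                apply Finset.sum_le_sum
                intro j _
                rw [norm_mul]
                have h2 : ‖H' k.1.1 j‖ ≤ 2 := by
                  by_cases hj : j = j0
                  · simp [H', hj]
                  · have h3 := hH' k.1.1 j hj
                    have h4 : (1:ℝ) / (2 * M) ≤ 1 := by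
                      rw [div_le_one (by positivity)]; linarith
                    have h5 : ‖(if k.1.1 = j then (1:ℂ) else 0)‖ ≤ 1 := by split_ifs <;> simp
                    have h6 := norm_le_norm_add_norm_sub' (H' k.1.1 j) (if k.1.1 = j then (1:ℂ) else 0)
                    linarith
                have h3 := (hX ξ hξ).2.2.2.1 j
                nlinarith [norm_nonneg (H' k.1.1 j), norm_nonneg (ξ j)]
            _ = _ := by simp [mul_comm]
        split_ifs
        · exact (Complex.abs_im_le_norm _).trans hb
        · exact (Complex.abs_re_le_norm _).trans hb
      · intro ξ hξ
        have := gi_one_le _ (hX ξ hξ).1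
        refine ⟨by positivity, ?_⟩
        rw [div_le_one (by positivity)]
        linarith
      · intro ξ hξ ξ' hξ' y hy hy'
        have h1 := hclose ξ hξ y hy
        have h2 := hclose ξ' hξ' y hy'
        obtain ⟨he0, hej, heQ, -, hξ0⟩ := hX ξ hξ
        obtain ⟨he0', hej', heQ', -, hξ0'⟩ := hX ξ' hξ'
        have hp := hepos ξ hξ
        have hp' := hepos ξ' hξ'
        have h3 : ∀ i, ‖∑ j, H' i j * (ξ - ξ') j‖ ≤ ε / ‖(e ξ j0 : ℂ)‖ + ε / ‖(e ξ' j0 : ℂ)‖ := by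
          intro i
          have : ∑ j, H' i j * (ξ - ξ') j =
              (matOf (comb y) i j0 - cc ξ i) - (matOf (comb y) i j0 - cc ξ' i) := by
            simp only [cc, Pi.sub_apply, mul_sub, Finset.sum_sub_distrib]
            ring
          rw [this]
          exact (norm_sub_le _ _).trans (add_le_add (h1 i) (h2 i))
        have h4 := geom j0 H' hH' (ξ - ξ') (by simp [hξ0, hξ0']) _ h3
        ext1 j
        by_contra hne
        have hnum : e ξ j * e ξ' j0 - e ξ' j * e ξ j0 ≠ 0 := by
          intro h0
          have h5 := congrArg GaussianInt.toComplex h0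
          simp only [map_sub, map_mul, map_zero, hej j, hej' j] at h5
          have h6 : (ξ j - ξ' j) * ((e ξ j0 : ℂ) * (e ξ' j0 : ℂ)) = 0 := by
            rw [← h5]; ring
          rcases mul_eq_zero.1 h6 with h7 | h7
          · exact hne (sub_eq_zero.1 h7)
          · rcases mul_eq_zero.1 h7 with h8 | h8
            · rw [h8] at hp; simp at hp
            · rw [h8] at hp'; simp at hp'
        have h5 := gi_one_le _ hnum
        simp only [map_sub, map_mul, hej j, hej' j] at h5
        rw [show ξ j * (e ξ j0 : ℂ) * (e ξ' j0 : ℂ) - ξ' j * (e ξ' j0 : ℂ) * (e ξ j0 : ℂ) =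
          (ξ - ξ') j * ((e ξ j0 : ℂ) * (e ξ' j0 : ℂ)) by simp; ring, norm_mul, norm_mul] at h5
        have h6 := mul_le_mul_of_nonneg_right (h4 j) (mul_pos hp hp').le
        have h7 : 2 * (ε / ‖(e ξ j0 : ℂ)‖ + ε / ‖(e ξ' j0 : ℂ)‖) *
            (‖(e ξ j0 : ℂ)‖ * ‖(e ξ' j0 : ℂ)‖) = 2 * ε * (‖(e ξ j0 : ℂ)‖ + ‖(e ξ' j0 : ℂ)‖) := by
          field_simp
          ring
        rw [h7] at h6
        have h8 : 2 * ε * (‖(e ξ j0 : ℂ)‖ + ‖(e ξ' j0 : ℂ)‖) ≤ 2 * ε * (4 * Q) := by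
          gcongr; linarith
        nlinarith
      · intro ξ hξ y hy
        have h1 := hclose ξ hξ y hy
        obtain ⟨he0, hej, heQ, -, hξ0⟩ := hX ξ hξ
        refine ⟨e ξ, fun h => he0 (by rw [h]; rfl), ?_⟩
        intro i
        have hp := hepos ξ hξ
        change ‖(matOf (comb y)).mulVec (fun j => (e ξ j : ℂ)) i‖ ≤ ε
        have : (matOf (comb y)).mulVec (fun j => (e ξ j : ℂ)) i =
            (matOf (comb y) i j0 - cc ξ i) * (e ξ j0 : ℂ) := by
          simp only [mulVec, dotProduct, cc, sub_neg_eq_add]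
          rw [← Finset.add_sum_erase _ _ (Finset.mem_univ j0)]
          rw [← Finset.add_sum_erase _ (fun j => H' i j * ξ j) (Finset.mem_univ j0)]
          rw [add_mul, add_mul, Finset.sum_mul]
          simp only [H', if_true, zero_mul, zero_add]
          congr 1
          apply Finset.sum_congr rfl
          intro j hj
          have hj' := Finset.ne_of_mem_erase hj
          rw [if_neg hj', hej j, mul_assoc]
          congr 1
          simp [matOf, comb, hj']
        rw [this, norm_mul]
        calc _ ≤ ε / ‖(e ξ j0 : ℂ)‖ * ‖(e ξ j0 : ℂ)‖ := by gcongr; exact h1 i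
          _ = ε := by field_simp

lemma gauss_scale (σ2 : ℝ) (hσ : 0 < σ2) :
    MeasurePreserving (fun x => Real.sqrt σ2 * x) (gaussianReal 0 (1/2))
      (gaussianReal 0 (σ2 / 2).toNNReal) := by
  refine ⟨by fun_prop, ?_⟩
  rw [gaussianReal_map_const_mul, mul_zero]
  congr 1
  ext
  simp [Real.sq_sqrt hσ.le, max_eq_left (by positivity : (0:ℝ) ≤ σ2 / 2)]
  ring

instance gauss_open_half : Measure.IsOpenPosMeasure (gaussianReal 0 (1/2)) :=
  (gaussianReal_absolutelyContinuous' 0 half_ne).isOpenPosMeasure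

lemma gauss_tail : ∃ p0 : ENNReal, 0 < p0 ∧ p0 ≠ ⊤ ∧ ∀ σ2 : ℝ, 0 < σ2 →
    p0 ≤ gaussianReal 0 (σ2 / 2).toNNReal (Ici (Real.sqrt σ2 / 2)) ∧
    p0 ≤ gaussianReal 0 (σ2 / 2).toNNReal (Iic (-(Real.sqrt σ2 / 2))) := by
  refine ⟨min (gaussianReal 0 (1/2) (Ici (1/2))) (gaussianReal 0 (1/2) (Iic (-(1/2)))), ?_, ?_, ?_⟩
  · rw [lt_min_iff]
    constructor
    · exact Measure.measure_pos_of_nonempty_interior _ (by simp)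
    · exact Measure.measure_pos_of_nonempty_interior _ (by simp)
  · exact ((min_le_left _ _).trans_lt (measure_lt_top _ _)).ne
  · intro σ2 hσ
    have h := gauss_scale σ2 hσ
    have hs : 0 < Real.sqrt σ2 := Real.sqrt_pos.2 hσ
    constructor
    · rw [← h.measure_preimage measurableSet_Ici.nullMeasurableSet]
      refine (min_le_left _ _).trans (measure_mono ?_)
      intro x hx
      simp only [mem_Ici, mem_preimage] at hx ⊢
      nlinarith
    · rw [← h.measure_preimage measurableSet_Iic.nullMeasurableSet]
      refine (min_le_right _ _).trans (measure_mono ?_)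
      intro x hx
      simp only [mem_Iic, mem_preimage] at hx ⊢
      nlinarith

lemma norm_sq_ri (z : ℂ) : ‖z‖ ^ 2 = z.re ^ 2 + z.im ^ 2 := by
  rw [← Complex.normSq_eq_norm_sq, Complex.normSq_apply]; ring

lemma noise_lower (M : ℕ) : ∃ p : ENNReal, 0 < p ∧ p ≠ ⊤ ∧ ∀ σ2 : ℝ, 0 < σ2 → ∀ v : Fin M → ℂ,
    (∀ i, ‖v i‖ ≤ Real.sqrt σ2) →
    p ≤ noiseMeasure (Fin M) σ2 {w | cnorm (noiseOf w - v) ≤ cnorm (noiseOf w)} := by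
  obtain ⟨p0, hp0, hp0t, hp⟩ := gauss_tail
  refine ⟨p0 ^ Fintype.card (Fin M × Bool), by positivity, ENNReal.pow_ne_top hp0t, ?_⟩
  intro σ2 hσ v hv
  set s := Real.sqrt σ2 with hs
  let vr : Fin M × Bool → ℝ := fun k => if k.2 then (v k.1).im else (v k.1).re
  have hvr : ∀ k, |vr k| ≤ s := by
    intro k
    simp only [vr]
    split_ifs
    · exact (Complex.abs_im_le_norm _).trans (hv _)
    · exact (Complex.abs_re_le_norm _).trans (hv _)
  let A : Fin M × Bool → Set ℝ := fun k => if 0 ≤ vr k then Ici (s / 2) else Iic (-(s / 2))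
  calc p0 ^ Fintype.card (Fin M × Bool) = ∏ k : Fin M × Bool, p0 := by simp
    _ ≤ ∏ k : Fin M × Bool, gaussianReal 0 (σ2 / 2).toNNReal (A k) := by
        apply Finset.prod_le_prod'
        intro k _
        simp only [A]
        split_ifs
        · exact (hp σ2 hσ).1
        · exact (hp σ2 hσ).2
    _ = noiseMeasure (Fin M) σ2 (Set.univ.pi A) := by rw [noiseMeasure, Measure.pi_pi]
    _ ≤ _ := by
        apply measure_mono
        intro w hw
        have hw' : ∀ k, (w k - vr k) ^ 2 ≤ (w k) ^ 2 := by
          intro k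
          have h1 := hw k (mem_univ _)
          have h2 := abs_le.1 (hvr k)
          simp only [A] at h1
          split_ifs at h1 with h0
          · simp only [mem_Ici] at h1
            nlinarith
          · simp only [mem_Iic] at h1
            push Not at h0
            nlinarith
        simp only [Set.mem_ofPred_eq, cnorm]
        apply Real.sqrt_le_sqrt
        apply Finset.sum_le_sum
        intro i _
        rw [norm_sq_ri, norm_sq_ri]
        have h1 := hw' (i, false)
        have h2 := hw' (i, true)
        simp [vr, noiseOf] at h1 h2 ⊢
        linarith

lemma nld_lower (M : ℕ) (hM : 2 ≤ M) (α : ℝ) (hα : 0 < α) : ∃ c ε0 : ℝ, 0 < c ∧ 0 < ε0 ∧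
    ∀ σ2 : ℝ, 0 < σ2 → Real.sqrt σ2 / α < ε0 → ∀ s : Fin M → GaussianInt,
    c * (Real.sqrt σ2 / α) ^ (2 * M) * Real.log (1 / (Real.sqrt σ2 / α)) ≤
      (((gaussMatMeasure M M).prod (noiseMeasure (Fin M) σ2))
        {q | ∃ z : Fin M → GaussianInt, z ≠ s ∧
          cnorm (((matOf q.1).mulVec (fun i => (α : ℂ) * (s i : ℂ)) + noiseOf q.2) -
              (matOf q.1).mulVec fun i => (α : ℂ) * (z i : ℂ)) ≤
            cnorm (((matOf q.1).mulVec (fun i => (α : ℂ) * (s i : ℂ)) + noiseOf q.2) -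
              (matOf q.1).mulVec fun i => (α : ℂ) * (s i : ℂ))}).toReal := by
  obtain ⟨c, ε0, hc, hε0, hcore⟩ := core_lower M hM
  obtain ⟨p, hp, hpt, hnoise⟩ := noise_lower M
  refine ⟨p.toReal * c, ε0, mul_pos (ENNReal.toReal_pos hp.ne' hpt) hc, hε0, ?_⟩
  intro σ2 hσ hlt s
  have hs : 0 < Real.sqrt σ2 := Real.sqrt_pos.2 hσ
  have : IsProbabilityMeasure (gaussMatMeasure M M) := by unfold gaussMatMeasure; infer_instance
  have : IsProbabilityMeasure (noiseMeasure (Fin M) σ2) := by unfold noiseMeasure; infer_instance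
  have h1 := hcore _ (div_pos hs hα) hlt
  rw [← ENNReal.ofReal_le_iff_le_toReal (measure_ne_top _ _)]
  rw [show p.toReal * c * (Real.sqrt σ2 / α) ^ (2 * M) * Real.log (1 / (Real.sqrt σ2 / α)) =
    p.toReal * (c * (Real.sqrt σ2 / α) ^ (2 * M) * Real.log (1 / (Real.sqrt σ2 / α))) by ring,
    ENNReal.ofReal_mul ENNReal.toReal_nonneg, ENNReal.ofReal_toReal hpt]
  refine (mul_le_mul_right h1 p).trans ?_
  apply prod_lower
  rintro g ⟨d, hd0, hd⟩
  let v : Fin M → ℂ := fun i => (α : ℂ) * (matOf g).mulVec (fun j => (d j : ℂ)) i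
  refine (hnoise σ2 hσ v ?_).trans (measure_mono ?_)
  · intro i
    simp only [v, norm_mul, Complex.norm_real, Real.norm_eq_abs, abs_of_pos hα]
    have := hd i
    rw [le_div_iff₀ hα] at this
    linarith
  · intro w hw
    refine ⟨s + d, by simpa using hd0, ?_⟩
    have e1 : ((matOf g).mulVec (fun i => (α : ℂ) * (s i : ℂ)) + noiseOf w) -
              (matOf g).mulVec (fun i => (α : ℂ) * ((s + d) i : ℂ)) = noiseOf w - v := by
      have : (fun i => (α : ℂ) * ((s + d) i : ℂ)) =
          (fun i => (α : ℂ) * (s i : ℂ)) + (α : ℂ) • (fun i => (d i : ℂ)) := by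
        ext i; simp [mul_add]
      rw [this, mulVec_add, mulVec_smul]
      ext i
      simp [v]
    have e2 : ((matOf g).mulVec (fun i => (α : ℂ) * (s i : ℂ)) + noiseOf w) -
              (matOf g).mulVec (fun i => (α : ℂ) * (s i : ℂ)) = noiseOf w := by
      simp
    dsimp only
    rw [e1, e2]
    exact hw

lemma continuous_matvec {M : ℕ} (u : Fin M → ℂ) :
    Continuous fun g : (Fin M × Fin M × Bool) → ℝ => (matOf g).mulVec u := by
  unfold matOf mulVec dotProduct
  fun_prop

lemma continuous_noiseOf {M : ℕ} :
    Continuous fun w : (Fin M × Bool) → ℝ => noiseOf w := by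
  unfold noiseOf
  fun_prop

lemma continuous_cnorm {M : ℕ} : Continuous fun v : Fin M → ℂ => cnorm v := by
  unfold cnorm
  fun_prop

lemma col_upper (M : ℕ) (u : Fin M → ℂ) (j0 : Fin M) (hu : u j0 ≠ 0) (r : ℝ) (hr : 0 ≤ r) :
    gaussMatMeasure M M {g | ∀ i, ‖(matOf g).mulVec u i‖ ≤ r} ≤
      ENNReal.ofReal ((2 * (r / ‖u j0‖)) ^ (2 * M)) := by
  have hup : 0 < ‖u j0‖ := norm_pos_iff.2 hu
  unfold gaussMatMeasure
  apply pi_upper _ (fun k : Fin M × Fin M × Bool => k.2.1 ≠ j0)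
  · apply IsClosed.measurableSet
    rw [Set.ofPred_forall]
    refine isClosed_iInter fun i => ?_
    exact isClosed_le ((continuous_apply i).comp (continuous_matvec u)).norm continuous_const
  · intro x
    let cc : Fin M → ℂ := fun i => - (∑ j ∈ Finset.univ.erase j0, matOf x i j * u j) / u j0
    let c : {k : Fin M × Fin M × Bool // ¬ k.2.1 ≠ j0} → ℝ := fun k =>
      if k.1.2.2 then (cc k.1.1).im else (cc k.1.1).re
    calc _ ≤ (Measure.pi fun _ : {k : Fin M × Fin M × Bool // ¬ k.2.1 ≠ j0} => gaussianReal 0 (1/2))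
          (Set.univ.pi fun k => Icc (c k - r / ‖u j0‖) (c k + r / ‖u j0‖)) := by
          apply measure_mono
          intro y hy
          set comb : (Fin M × Fin M × Bool) → ℝ :=
            fun k => if h : k.2.1 ≠ j0 then x k else y ⟨k, h⟩ with hcomb
          have hy' : ∀ i, ‖(matOf comb).mulVec u i‖ ≤ r := hy
          have key : ∀ i, ‖matOf comb i j0 - cc i‖ ≤ r / ‖u j0‖ := by
            intro i
            rw [le_div_iff₀ hup, ← norm_mul]
            refine le_trans (le_of_eq ?_) (hy' i)
            congr 1
            simp only [mulVec, dotProduct, cc]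
            rw [← Finset.add_sum_erase _ _ (Finset.mem_univ j0), sub_mul, div_mul_cancel₀ _ hu,
              sub_neg_eq_add]
            congr 1
            apply Finset.sum_congr rfl
            intro j hj
            have hj' := Finset.ne_of_mem_erase hj
            simp [matOf, comb, hj']
          rintro ⟨⟨i, j, b⟩, hk⟩ -
          have hj : j = j0 := not_not.1 hk
          subst hj
          have h1 := key i
          rw [mem_Icc]
          cases b
          · have h2 := abs_le.1 ((Complex.abs_re_le_norm _).trans h1)
            simp [matOf, comb] at h2
            simp [c]
            constructor <;> linarith
          · have h2 := abs_le.1 ((Complex.abs_im_le_norm _).trans h1)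
            simp [matOf, comb] at h2
            simp [c]
            constructor <;> linarith
      _ = ∏ k, gaussianReal 0 (1/2) (Icc (c k - r / ‖u j0‖) (c k + r / ‖u j0‖)) := Measure.pi_pi _ _
      _ ≤ ∏ k : {k : Fin M × Fin M × Bool // ¬ k.2.1 ≠ j0}, ENNReal.ofReal (2 * (r / ‖u j0‖)) :=
          Finset.prod_le_prod' fun k _ => gauss_icc_upper _ _
      _ = _ := by
          rw [Finset.prod_const, Finset.card_univ, card_col, ENNReal.ofReal_pow (by positivity)]

lemma norm_le_cnorm {M : ℕ} (v : Fin M → ℂ) (i : Fin M) : ‖v i‖ ≤ cnorm v := by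
  apply Real.le_sqrt_of_sq_le
  exact Finset.single_le_sum (f := fun i => ‖v i‖ ^ 2) (fun j _ => by positivity) (Finset.mem_univ i)

lemma cnorm_noise_le {M : ℕ} (w : Fin M × Bool → ℝ) : cnorm (noiseOf w) ≤ ∑ k, |w k| := by
  apply Real.sqrt_le_iff.2
  refine ⟨Finset.sum_nonneg fun _ _ => abs_nonneg _, ?_⟩
  calc ∑ i, ‖noiseOf w i‖ ^ 2 = ∑ k : Fin M × Bool, |w k| ^ 2 := by
        rw [Fintype.sum_prod_type]
        apply Finset.sum_congr rfl
        intro i _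
        rw [norm_sq_ri]
        simp [noiseOf]
        ring
    _ ≤ _ := Finset.sum_sq_le_sq_sum_of_nonneg fun _ _ => abs_nonneg _

lemma noise_scale (M : ℕ) (σ2 : ℝ) (hσ : 0 < σ2) :
    MeasurePreserving (fun (w : Fin M × Bool → ℝ) k => Real.sqrt σ2 * w k)
      (Measure.pi fun _ => gaussianReal 0 (1/2)) (noiseMeasure (Fin M) σ2) :=
  measurePreserving_pi _ _ fun _ => gauss_scale σ2 hσ

lemma ml_pair (M : ℕ) (u : Fin M → ℂ) (hu : u ≠ 0) : ∃ K : ENNReal, K ≠ ⊤ ∧ ∀ σ2 : ℝ, 0 < σ2 →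
    ((gaussMatMeasure M M).prod (noiseMeasure (Fin M) σ2))
      {q | cnorm ((matOf q.1).mulVec u + noiseOf q.2) ≤ cnorm (noiseOf q.2)} ≤
      ENNReal.ofReal (σ2 ^ M) * K := by
  obtain ⟨j0, hj0⟩ : ∃ j0, u j0 ≠ 0 := by
    by_contra! h
    exact hu (funext h)
  have hup : 0 < ‖u j0‖ := norm_pos_iff.2 hj0
  let F : (Fin M × Bool → ℝ) → ℝ := fun w => (2 * ((2 * ∑ k, |w k|) / ‖u j0‖)) ^ (2 * M)
  have hFm : Measurable F := by
    simp only [F]; fun_prop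
  refine ⟨∫⁻ w, ENNReal.ofReal (F w) ∂(Measure.pi fun _ => gaussianReal 0 (1/2)), ?_, ?_⟩
  · have h1 : MemLp (fun w : Fin M × Bool → ℝ => ∑ k, |w k|) ((2 * M : ℕ) : ENNReal)
        (Measure.pi fun _ => gaussianReal 0 (1/2)) := by
      apply memLp_finsetSum
      intro k _
      have h2 : MemLp (fun x : ℝ => |x|) ((2 * M : ℕ) : ENNReal) (gaussianReal 0 (1/2)) :=
        (memLp_id_gaussianReal' _ (ENNReal.natCast_ne_top _)).norm
      exact h2.comp_measurePreserving
        (measurePreserving_eval (fun _ : Fin M × Bool => gaussianReal 0 (1/2)) k)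
    have h2 : Integrable F (Measure.pi fun _ => gaussianReal 0 (1/2)) := by
      have h3 := (h1.integrable_norm_pow').const_mul ((4 / ‖u j0‖) ^ (2 * M))
      refine h3.congr (Eventually.of_forall fun w => ?_)
      have h0 : 0 ≤ ∑ k, |w k| := Finset.sum_nonneg fun _ _ => abs_nonneg _
      simp only [F]
      rw [Real.norm_of_nonneg h0, ← mul_pow]
      congr 1
      field_simp
      ring
    exact h2.lintegral_lt_top.ne
  · intro σ2 hσ
    have : IsProbabilityMeasure (gaussMatMeasure M M) := by unfold gaussMatMeasure; infer_instance
    have : IsProbabilityMeasure (noiseMeasure (Fin M) σ2) := by unfold noiseMeasure; infer_instance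
    have hmeas : MeasurableSet {q : (Fin M × Fin M × Bool → ℝ) × (Fin M × Bool → ℝ) |
        cnorm ((matOf q.1).mulVec u + noiseOf q.2) ≤ cnorm (noiseOf q.2)} := by
      apply IsClosed.measurableSet
      exact isClosed_le
        (continuous_cnorm.comp (((continuous_matvec u).comp continuous_fst).add
          (continuous_noiseOf.comp continuous_snd)))
        (continuous_cnorm.comp (continuous_noiseOf.comp continuous_snd))
    rw [Measure.prod_apply_symm hmeas]
    calc _ ≤ ∫⁻ w, ENNReal.ofReal (F w) ∂(noiseMeasure (Fin M) σ2) := by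
          apply lintegral_mono
          intro w
          refine le_trans (measure_mono ?_) (col_upper M u j0 hj0 (2 * ∑ k, |w k|)
            (mul_nonneg two_pos.le (Finset.sum_nonneg fun _ _ => abs_nonneg _)))
          intro g hg i
          have hg' : cnorm ((matOf g).mulVec u + noiseOf w) ≤ cnorm (noiseOf w) := hg
          have h1 := norm_le_cnorm ((matOf g).mulVec u + noiseOf w) i
          have h2 := norm_le_cnorm (noiseOf w) i
          have h3 := cnorm_noise_le w
          have h4 : ‖(matOf g).mulVec u i‖ ≤ ‖((matOf g).mulVec u + noiseOf w) i‖ + ‖noiseOf w i‖ := by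
            have := norm_sub_le (((matOf g).mulVec u + noiseOf w) i) (noiseOf w i)
            simpa using this
          linarith
      _ = ∫⁻ w, ENNReal.ofReal (F fun k => Real.sqrt σ2 * w k)
            ∂(Measure.pi fun _ => gaussianReal 0 (1/2)) :=
          ((noise_scale M σ2 hσ).lintegral_comp hFm.ennreal_ofReal).symm
      _ = ∫⁻ w, ENNReal.ofReal (σ2 ^ M) * ENNReal.ofReal (F w)
            ∂(Measure.pi fun _ => gaussianReal 0 (1/2)) := by
          apply lintegral_congr
          intro w
          rw [← ENNReal.ofReal_mul (by positivity)]
          congr 1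
          simp only [F, abs_mul, abs_of_nonneg (Real.sqrt_nonneg σ2)]
          rw [← Finset.mul_sum]
          rw [show 2 * (2 * (Real.sqrt σ2 * ∑ k, |w k|) / ‖u j0‖) =
            Real.sqrt σ2 * (2 * (2 * (∑ k, |w k|) / ‖u j0‖)) by ring, mul_pow, pow_mul (Real.sqrt σ2),
            Real.sq_sqrt hσ.le]
      _ = _ := lintegral_const_mul _ hFm.ennreal_ofReal

lemma ml_pos (M : ℕ) (u : Fin M → ℂ) (hu : u ≠ 0) (σ2 : ℝ) (hσ : 0 < σ2) :
    0 < ((gaussMatMeasure M M).prod (noiseMeasure (Fin M) σ2))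
      {q | cnorm ((matOf q.1).mulVec u + noiseOf q.2) ≤ cnorm (noiseOf q.2)} := by
  obtain ⟨j0, hj0⟩ : ∃ j0, u j0 ≠ 0 := by
    by_contra! h
    exact hu (funext h)
  have : Measure.IsOpenPosMeasure (gaussianReal 0 (σ2 / 2).toNNReal) :=
    (gaussianReal_absolutelyContinuous' 0 (by simpa using hσ)).isOpenPosMeasure
  have : IsProbabilityMeasure (gaussMatMeasure M M) := by unfold gaussMatMeasure; infer_instance
  have : IsProbabilityMeasure (noiseMeasure (Fin M) σ2) := by unfold noiseMeasure; infer_instance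
  have : Measure.IsOpenPosMeasure (gaussMatMeasure M M) := by
    unfold gaussMatMeasure; infer_instance
  have : Measure.IsOpenPosMeasure (noiseMeasure (Fin M) σ2) := by
    unfold noiseMeasure; infer_instance
  have hopen : IsOpen {q : (Fin M × Fin M × Bool → ℝ) × (Fin M × Bool → ℝ) |
        cnorm ((matOf q.1).mulVec u + noiseOf q.2) < cnorm (noiseOf q.2)} :=
    isOpen_lt
        (continuous_cnorm.comp (((continuous_matvec u).comp continuous_fst).add
          (continuous_noiseOf.comp continuous_snd)))
        (continuous_cnorm.comp (continuous_noiseOf.comp continuous_snd))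
  refine lt_of_lt_of_le (hopen.measure_pos _ ?_) (measure_mono ?_)
  swap
  · intro q hq
    exact le_of_lt (show cnorm ((matOf q.1).mulVec u + noiseOf q.2) < cnorm (noiseOf q.2) from hq)
  let g : Fin M × Fin M × Bool → ℝ := fun k => if k = (j0, j0, false) then 1 else 0
  let w : Fin M × Bool → ℝ := fun l =>
    if l.2 then -((matOf g).mulVec u l.1).im else -((matOf g).mulVec u l.1).re
  have hw : noiseOf w = -(matOf g).mulVec u := by
    ext i
    apply Complex.ext <;> simp [noiseOf, w]
  have hgu : (matOf g).mulVec u j0 = u j0 := by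
    simp only [mulVec, dotProduct]
    rw [Finset.sum_eq_single j0]
    · simp [matOf, g]
    · intro j _ hj
      simp [matOf, g, hj]
    · simp
  refine ⟨(g, w), ?_⟩
  change cnorm ((matOf g).mulVec u + noiseOf w) < cnorm (noiseOf w)
  have h1 : cnorm ((matOf g).mulVec u + noiseOf w) = 0 := by
    rw [hw, add_neg_cancel]; simp [cnorm]
  rw [h1]
  refine lt_of_lt_of_le ?_ (norm_le_cnorm _ j0)
  rw [hw, Pi.neg_apply, hgu, norm_neg]
  exact norm_pos_iff.2 hj0

/-- difference vector -/
def dv {M : ℕ} (α : ℝ) (s s' : Fin M → GaussianInt) : Fin M → ℂ :=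
  fun i => (α : ℂ) * (s i : ℂ) - (α : ℂ) * (s' i : ℂ)

lemma dv_ne {M : ℕ} (α : ℝ) (hα : 0 < α) (s s' : Fin M → GaussianInt) (h : s' ≠ s) :
    dv α s s' ≠ 0 := by
  intro h0
  apply h
  ext1 i
  have := congrFun h0 i
  simp only [dv, Pi.zero_apply] at this
  have h1 := mul_left_cancel₀ (by exact_mod_cast hα.ne') (sub_eq_zero.1 this)
  exact (GaussianInt.toComplex_inj.1 h1).symm

lemma ml_iff {M : ℕ} (α : ℝ) (s s' : Fin M → GaussianInt) (H : Matrix (Fin M) (Fin M) ℂ)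
    (w : Fin M → ℂ) :
    cnorm ((H.mulVec (fun i => (α : ℂ) * (s i : ℂ)) + w) -
              H.mulVec fun i => (α : ℂ) * (s' i : ℂ)) ≤
            cnorm ((H.mulVec (fun i => (α : ℂ) * (s i : ℂ)) + w) -
              H.mulVec fun i => (α : ℂ) * (s i : ℂ)) ↔
    cnorm (H.mulVec (dv α s s') + w) ≤ cnorm w := by
  have h1 : H.mulVec (dv α s s') = H.mulVec (fun i => (α : ℂ) * (s i : ℂ)) -
      H.mulVec (fun i => (α : ℂ) * (s' i : ℂ)) := by
    rw [← mulVec_sub]; rfl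
  rw [h1, add_sub_cancel_left]
  rw [show (H.mulVec (fun i => (α : ℂ) * (s i : ℂ)) + w) -
              H.mulVec (fun i => (α : ℂ) * (s' i : ℂ)) = H.mulVec (fun i => (α : ℂ) * (s i : ℂ)) -
      H.mulVec (fun i => (α : ℂ) * (s' i : ℂ)) + w by abel]

lemma peml_upper (M : ℕ) (S : Finset (Fin M → GaussianInt)) (hS : 2 ≤ S.card) (α : ℝ)
    (hα : 0 < α) : ∃ K : ℝ, 0 < K ∧ ∀ σ2 : ℝ, 0 < σ2 → PeML M S α σ2 ≤ K * σ2 ^ M := by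
  classical
  have h : ∀ s s' : Fin M → GaussianInt, ∃ K : ENNReal, K ≠ ⊤ ∧ (s' ≠ s → ∀ σ2 : ℝ, 0 < σ2 →
    ((gaussMatMeasure M M).prod (noiseMeasure (Fin M) σ2))
      {q | cnorm ((matOf q.1).mulVec (dv α s s') + noiseOf q.2) ≤ cnorm (noiseOf q.2)} ≤
      ENNReal.ofReal (σ2 ^ M) * K) := by
    intro s s'
    by_cases hs : s' = s
    · exact ⟨0, by simp, fun h => absurd hs h⟩
    · obtain ⟨K, hK, hK'⟩ := ml_pair M _ (dv_ne α hα s s' hs)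
      exact ⟨K, hK, fun _ => hK'⟩
  choose K hK hK' using h
  have hn : ∀ s, 0 ≤ (∑ s' ∈ S.erase s, K s s').toReal := fun s => ENNReal.toReal_nonneg
  refine ⟨(∑ s ∈ S, (∑ s' ∈ S.erase s, K s s').toReal) + 1,
    by linarith [Finset.sum_nonneg (s := S) fun s _ => hn s], ?_⟩
  intro σ2 hσ
  have hcard : (1:ℝ) ≤ S.card := by exact_mod_cast (by omega : 1 ≤ S.card)
  have key : ∀ s ∈ S, (((gaussMatMeasure M M).prod (noiseMeasure (Fin M) σ2))
        {q | ∃ s' ∈ S, s' ≠ s ∧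
          cnorm (((matOf q.1).mulVec (fun i => (α : ℂ) * (s i : ℂ)) + noiseOf q.2) -
              (matOf q.1).mulVec fun i => (α : ℂ) * (s' i : ℂ)) ≤
            cnorm (((matOf q.1).mulVec (fun i => (α : ℂ) * (s i : ℂ)) + noiseOf q.2) -
              (matOf q.1).mulVec fun i => (α : ℂ) * (s i : ℂ))}).toReal ≤
      (∑ s' ∈ S.erase s, K s s').toReal * σ2 ^ M := by
    intro s hs
    have htop : ∑ s' ∈ S.erase s, K s s' ≠ ⊤ := ENNReal.sum_ne_top.2 fun s' _ => hK s s'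
    have h1 : ((gaussMatMeasure M M).prod (noiseMeasure (Fin M) σ2))
        {q | ∃ s' ∈ S, s' ≠ s ∧
          cnorm (((matOf q.1).mulVec (fun i => (α : ℂ) * (s i : ℂ)) + noiseOf q.2) -
              (matOf q.1).mulVec fun i => (α : ℂ) * (s' i : ℂ)) ≤
            cnorm (((matOf q.1).mulVec (fun i => (α : ℂ) * (s i : ℂ)) + noiseOf q.2) -
              (matOf q.1).mulVec fun i => (α : ℂ) * (s i : ℂ))} ≤
        ENNReal.ofReal (σ2 ^ M) * ∑ s' ∈ S.erase s, K s s' := by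
      rw [Finset.mul_sum]
      have hu := measure_biUnion_finset_le
        (μ := (gaussMatMeasure M M).prod (noiseMeasure (Fin M) σ2)) (S.erase s) (fun s' =>
        {q | cnorm ((matOf q.1).mulVec (dv α s s') + noiseOf q.2) ≤ cnorm (noiseOf q.2)})
      have hv := Finset.sum_le_sum fun s' (hs' : s' ∈ S.erase s) =>
        hK' s s' (Finset.ne_of_mem_erase hs') σ2 hσ
      refine le_trans (measure_mono ?_) (hu.trans hv)
      rintro q ⟨s', hs', hne, hq⟩
      simp only [Set.mem_iUnion]
      exact ⟨s', Finset.mem_erase.2 ⟨hne, hs'⟩, (ml_iff α s s' _ _).1 hq⟩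
    have h2 := ENNReal.toReal_mono (ENNReal.mul_ne_top ENNReal.ofReal_ne_top htop) h1
    rw [ENNReal.toReal_mul, ENNReal.toReal_ofReal (by positivity)] at h2
    linarith
  rw [PeML, div_le_iff₀ (by linarith)]
  refine (Finset.sum_le_sum key).trans ?_
  rw [← Finset.sum_mul]
  have h3 : 0 ≤ σ2 ^ M := by positivity
  have h4 : 0 ≤ ∑ s ∈ S, (∑ s' ∈ S.erase s, K s s').toReal := Finset.sum_nonneg fun s _ => hn s
  have h5 : 0 ≤ ((∑ s ∈ S, (∑ s' ∈ S.erase s, K s s').toReal) + 1) * σ2 ^ M := by positivity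
  nlinarith

lemma peml_pos (M : ℕ) (S : Finset (Fin M → GaussianInt)) (hS : 2 ≤ S.card) (α : ℝ)
    (hα : 0 < α) (σ2 : ℝ) (hσ : 0 < σ2) : 0 < PeML M S α σ2 := by
  obtain ⟨s, hs, s', hs', hne⟩ := Finset.one_lt_card.1 (by omega : 1 < S.card)
  have hcard : (0:ℝ) < S.card := by exact_mod_cast (by omega : 0 < S.card)
  have : IsProbabilityMeasure (gaussMatMeasure M M) := by unfold gaussMatMeasure; infer_instance
  have : IsProbabilityMeasure (noiseMeasure (Fin M) σ2) := by unfold noiseMeasure; infer_instance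
  refine div_pos (Finset.sum_pos' (fun _ _ => ENNReal.toReal_nonneg) ⟨s, hs, ?_⟩) hcard
  refine ENNReal.toReal_pos (ne_of_gt ?_) (measure_ne_top _ _)
  refine lt_of_lt_of_le (ml_pos M _ (dv_ne α hα s s' hne.symm) σ2 hσ) (measure_mono ?_)
  intro q hq
  exact ⟨s', hs', hne.symm, (ml_iff α s s' _ _).2 hq⟩

/-- V-BLAST with `M = N ≥ 2` antennas, fixed finite constellation
`S ⊂ ℤ[i]^M` with at least two points, fixed scaling `α > 0` of average power `P`, and
noise variance `σ² = M·P/ρ` at SNR `ρ = M·P/σ²`.  There are constants `c, c′ > 0` such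
that for all sufficiently large `ρ`, `P_ML(ρ) ≤ c′·ρ^{−M}` and
`P_NLD(ρ) ≥ c·ρ^{−M}·ln ρ`; consequently `P_NLD(ρ)/P_ML(ρ) → ∞` as `ρ → ∞`: the naive
lattice decoder has an asymptotically unbounded SNR loss compared to ML decoding although
both achieve diversity order `M`. -/
theorem naive_lattice_decoding_unbounded_gap_vs_ML
    (M : ℕ) (hM : 2 ≤ M)
    (S : Finset (Fin M → GaussianInt)) (hS : 2 ≤ S.card)
    (α : ℝ) (hα : 0 < α) (P : ℝ)
    (hP : P = (∑ s ∈ S, cnorm (fun i => (α : ℂ) * (s i : ℂ)) ^ 2) / S.card) :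
    ∃ c c' : ℝ, 0 < c ∧ 0 < c' ∧
      (∀ᶠ ρ : ℝ in Filter.atTop,
        PeML M S α ((M : ℝ) * P / ρ) ≤ c' * ρ ^ (-(M : ℝ)) ∧
        c * ρ ^ (-(M : ℝ)) * Real.log ρ ≤ PeNLD M S α ((M : ℝ) * P / ρ)) ∧
      Filter.Tendsto
        (fun ρ : ℝ => PeNLD M S α ((M : ℝ) * P / ρ) / PeML M S α ((M : ℝ) * P / ρ))
        Filter.atTop Filter.atTop := by
  have hM0 : (0:ℝ) < M := by exact_mod_cast (by omega : 0 < M)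
  have hcard : (0:ℝ) < S.card := by exact_mod_cast (by omega : 0 < S.card)
  have hPpos : 0 < P := by
    rw [hP]
    refine div_pos ?_ hcard
    obtain ⟨s, hs, s', hs', hne⟩ := Finset.one_lt_card.1 (by omega : 1 < S.card)
    obtain ⟨t, ht, ht0⟩ : ∃ t ∈ S, t ≠ 0 := by
      by_cases h : s = 0
      · exact ⟨s', hs', fun h' => hne (h.trans h'.symm)⟩
      · exact ⟨s, hs, h⟩
    refine Finset.sum_pos' (fun _ _ => sq_nonneg _) ⟨t, ht, ?_⟩
    obtain ⟨i, hi⟩ : ∃ i, t i ≠ 0 := by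
      by_contra! h
      exact ht0 (funext h)
    refine pow_pos (lt_of_lt_of_le ?_ (norm_le_cnorm _ i)) 2
    rw [norm_mul, Complex.norm_real, Real.norm_eq_abs]
    have := gi_one_le _ hi
    have := abs_pos.2 hα.ne'
    positivity
  obtain ⟨K, hK, hml⟩ := peml_upper M S hS α hα
  obtain ⟨c, ε0, hc, hε0, hnld⟩ := nld_lower M hM α hα
  set L : ℝ := (M : ℝ) * P with hL
  have hLpos : 0 < L := mul_pos hM0 hPpos
  have hml' : ∀ ρ : ℝ, 0 < ρ → PeML M S α (L / ρ) ≤ K * L ^ M * ρ ^ (-(M : ℝ)) := by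
    intro ρ hρ
    refine (hml _ (div_pos hLpos hρ)).trans (le_of_eq ?_)
    rw [Real.rpow_neg hρ.le, Real.rpow_natCast, div_pow]
    ring
  have hnld' : ∀ᶠ ρ : ℝ in atTop, c * (L / α ^ 2) ^ M * (1 / 4) * ρ ^ (-(M : ℝ)) * Real.log ρ ≤
      PeNLD M S α (L / ρ) := by
    filter_upwards [eventually_gt_atTop 0, eventually_gt_atTop (L / (α * ε0) ^ 2),
      Real.tendsto_log_atTop.eventually_ge_atTop (-2 * Real.log (α ^ 2 / L))] with ρ hρ hρ1 hρ2
    have hσ : 0 < L / ρ := div_pos hLpos hρ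
    have hlt : Real.sqrt (L / ρ) / α < ε0 := by
      rw [div_lt_iff₀ hα, Real.sqrt_lt' (by positivity), div_lt_iff₀ hρ]
      rw [div_lt_iff₀ (by positivity)] at hρ1
      calc L < _ := hρ1
        _ = _ := by ring
    have h1 := hnld (L / ρ) hσ hlt
    have h2 : (Real.sqrt (L / ρ) / α) ^ (2 * M) = (L / α ^ 2) ^ M * ρ ^ (-(M : ℝ)) := by
      rw [pow_mul, div_pow, Real.sq_sqrt hσ.le, Real.rpow_neg hρ.le, Real.rpow_natCast, ← inv_pow,
        ← mul_pow]
      congr 1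
      field_simp
    have h3 : Real.log (1 / (Real.sqrt (L / ρ) / α)) = (Real.log ρ + Real.log (α ^ 2 / L)) / 2 := by
      have e : 1 / (Real.sqrt (L / ρ) / α) = Real.sqrt (ρ * (α ^ 2 / L)) := by
        symm
        rw [Real.sqrt_eq_iff_mul_self_eq (by positivity) (by positivity), ← pow_two, div_pow, div_pow,
          Real.sq_sqrt hσ.le]
        field_simp
      rw [e, Real.log_sqrt (by positivity), Real.log_mul hρ.ne' (by positivity)]
    have h4 : 1 / 4 * Real.log ρ ≤ Real.log (1 / (Real.sqrt (L / ρ) / α)) := by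
      rw [h3]; linarith
    have h5 : ∀ s : Fin M → GaussianInt, c * (L / α ^ 2) ^ M * (1 / 4) * ρ ^ (-(M : ℝ)) * Real.log ρ ≤ _ :=
      fun s => le_trans (by
        rw [h2]
        calc _ = c * ((L / α ^ 2) ^ M * ρ ^ (-(M : ℝ))) * (1 / 4 * Real.log ρ) := by ring
          _ ≤ _ := by gcongr) (h1 s)
    rw [PeNLD, le_div_iff₀ hcard]
    refine le_trans (le_of_eq ?_) (Finset.card_nsmul_le_sum S _ _ fun s _ => h5 s)
    rw [nsmul_eq_mul]; ring
  refine ⟨c * (L / α ^ 2) ^ M * (1 / 4), K * L ^ M, by positivity, by positivity, ?_, ?_⟩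
  · filter_upwards [eventually_gt_atTop 0, hnld'] with ρ hρ h
    exact ⟨hml' ρ hρ, h⟩
  · have hb : Tendsto (fun ρ : ℝ => c * (L / α ^ 2) ^ M * (1 / 4) / (K * L ^ M) * Real.log ρ)
        atTop atTop := Real.tendsto_log_atTop.const_mul_atTop (by positivity)
    refine tendsto_atTop_mono' _ ?_ hb
    filter_upwards [eventually_gt_atTop 1, hnld'] with ρ hρ1 h
    have hρ : 0 < ρ := by linarith
    have hpos := peml_pos M S hS α hα (L / ρ) (div_pos hLpos hρ)
    rw [le_div_iff₀ hpos]
    refine le_trans ?_ h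
    have hlog : 0 ≤ Real.log ρ := Real.log_nonneg hρ1.le
    calc _ ≤ c * (L / α ^ 2) ^ M * (1 / 4) / (K * L ^ M) * Real.log ρ *
          (K * L ^ M * ρ ^ (-(M : ℝ))) := by
          gcongr
          exact hml' ρ hρ
      _ = _ := by
          have : K * L ^ M ≠ 0 := by positivity
          field_simp
end
end

section
/- Let M ≥ 2 and let H be an M×M random matrix whose entries are i.i.d. circularly-symmetric complex Gaussian with mean zero and unit variance, and let d(H) = inf{‖H z‖ : z ∈ ℤ[i]^M, z ≠ 0}. Then there exists a constant C′ > 0 (depending only on M) such that for all 0 < ε < 1, Pr{d(H) ≤ ε} ≥ C′ · ε^{2M} · ln(1/ε). -/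
open MeasureTheory ProbabilityTheory Matrix Filter Set

noncomputable section

lemma gi_norm_sq_s5 (g : GaussianInt) : ‖(g : ℂ)‖ ^ 2 = (g.re : ℝ) ^ 2 + (g.im : ℝ) ^ 2 := by
  rw [Complex.sq_norm, Complex.normSq_apply]; simp; ring

lemma gi_one_le_s5 (g : GaussianInt) (hg : g ≠ 0) : 1 ≤ ‖(g : ℂ)‖ := by
  have h : (1:ℝ) ≤ ‖(g : ℂ)‖ ^ 2 := by
    rw [gi_norm_sq_s5]
    have h1 : (1:ℤ) ≤ g.re ^ 2 + g.im ^ 2 := by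
      by_contra h
      have h0 : g.re ^ 2 + g.im ^ 2 = 0 := by nlinarith [sq_nonneg g.re, sq_nonneg g.im]
      have hr : g.re = 0 := by nlinarith [sq_nonneg g.re, sq_nonneg g.im]
      have hi : g.im = 0 := by nlinarith [sq_nonneg g.re, sq_nonneg g.im]
      exact hg (Zsqrtd.ext hr hi)
    exact_mod_cast h1
  nlinarith [norm_nonneg (g : ℂ)]

lemma int_summable : Summable fun a : ℤ => 1 / (1 + (a:ℝ) ^ 2) := by
  have h := Real.summable_one_div_int_pow.mpr (show 1 < 2 by norm_num)
  have h2 : Summable fun a : ℤ => 1 / (a:ℝ) ^ 2 + (if a = 0 then 1 else 0) :=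
    h.add (summable_of_ne_finset_zero (s := {0}) (by intro b hb; simp at hb; simp [hb]))
  refine Summable.of_nonneg_of_le (fun a => by positivity) (fun a => ?_) h2
  by_cases ha : a = 0
  · simp [ha]
  · simp only [ha, if_false, add_zero]
    have : (a:ℝ) ≠ 0 := by exact_mod_cast ha
    have : 0 < (a:ℝ) ^ 2 := by positivity
    apply one_div_le_one_div_of_le this; linarith

lemma gi_summable_s5 (m : ℕ) (hm : 1 ≤ m) :
    Summable fun g : GaussianInt => (1 / ‖(g : ℂ)‖) ^ (2 * (m + 1)) := by
  have h1 : Summable fun x : ℤ × ℤ => 1 / (1 + (x.1:ℝ) ^ 2) * (1 / (1 + (x.2:ℝ) ^ 2)) :=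
    int_summable.mul_of_nonneg int_summable (fun a => by positivity) (fun a => by positivity)
  have hinj : Function.Injective fun g : GaussianInt => (g.re, g.im) := by
    intro a b h; simp at h; exact Zsqrtd.ext h.1 h.2
  have h2 := (h1.comp_injective hinj).mul_left 3
  refine Summable.of_nonneg_of_le (fun a => by positivity) (fun g => ?_) h2
  simp only [Function.comp]
  by_cases hg : g = 0
  · subst hg; simp
  have hn := gi_one_le_s5 g hg
  have hs := gi_norm_sq_s5 g
  set s := ‖(g:ℂ)‖
  have hle : (1 / s) ^ (2 * (m + 1)) ≤ (1 / s) ^ 4 := by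
    apply pow_le_pow_of_le_one (by positivity)
    · rw [div_le_one (by linarith)]; exact hn
    · omega
  refine hle.trans ?_
  rw [← mul_assoc, div_pow, one_pow]
  rw [mul_one_div, mul_one_div, div_div, div_le_div_iff₀ (by positivity) (by positivity)]
  have h4 : s ^ 4 = (s ^ 2) ^ 2 := by ring
  have h1s : 1 ≤ s ^ 2 := by nlinarith
  rw [h4, hs]; rw [hs] at h1s
  nlinarith [sq_nonneg ((g.re:ℝ) ^ 2 - (g.im:ℝ) ^ 2), sq_nonneg ((g.re:ℝ) ^ 2), sq_nonneg ((g.im:ℝ) ^ 2), sq_nonneg ((g.re:ℝ) * (g.im:ℝ))]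

def IsDen {m : ℕ} (x : Fin m → ℂ) (q : GaussianInt) : Prop :=
  ∀ j, ∃ p : GaussianInt, (q : ℂ) * x j = p

lemma exists_min_den {m : ℕ} (x : Fin m → ℂ) (h : ∃ q, q ≠ 0 ∧ IsDen x q) :
    ∃ q0, q0 ≠ 0 ∧ IsDen x q0 ∧ ∀ q, q ≠ 0 → IsDen x q → ‖(q0:ℂ)‖ ≤ ‖(q:ℂ)‖ ∧ ∃ g : GaussianInt, q = g * q0 := by
  obtain ⟨q0, ⟨hq0, hd⟩, hmin⟩ := WellFounded.has_min (measure (fun q : GaussianInt => q.norm.natAbs)).wf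
    {q | q ≠ 0 ∧ IsDen x q} h
  have hmin' : ∀ q : GaussianInt, q ≠ 0 → IsDen x q → q0.norm.natAbs ≤ q.norm.natAbs := by
    intro q h1 h2
    have := hmin q ⟨h1, h2⟩
    exact not_lt.mp this
  refine ⟨q0, hq0, hd, fun q h1 h2 => ⟨?_, q / q0, ?_⟩⟩
  · have h3 := hmin' q h1 h2
    have h4 : (q0.norm.natAbs : ℝ) ≤ q.norm.natAbs := by exact_mod_cast h3
    rw [GaussianInt.natCast_natAbs_norm, GaussianInt.natCast_natAbs_norm] at h4
    rw [GaussianInt.intCast_real_norm, GaussianInt.intCast_real_norm, ← Complex.sq_norm, ← Complex.sq_norm] at h4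
    exact le_of_sq_le_sq h4 (norm_nonneg _)
  · by_contra hne
    have hr : q % q0 ≠ 0 := by
      intro h
      apply hne
      have := EuclideanDomain.div_add_mod q q0
      rw [h, add_zero] at this
      rw [mul_comm]; exact this.symm
    have hden : IsDen x (q % q0) := by
      intro j
      obtain ⟨p, hp⟩ := h2 j
      obtain ⟨p0, hp0⟩ := hd j
      refine ⟨p - (q / q0) * p0, ?_⟩
      have : q % q0 = q - q0 * (q / q0) := EuclideanDomain.mod_eq_sub_mul_div q q0
      rw [this]
      simp only [GaussianInt.toComplex_sub, GaussianInt.toComplex_mul]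
      linear_combination hp - (((q / q0 : GaussianInt)) : ℂ) * hp0
    have h5 := hmin' _ hr hden
    have h6 := GaussianInt.natAbs_norm_mod_lt q hq0
    omega

abbrev Idx (m : ℕ) := Σ _ : ℕ, ℕ × (Fin m → ℕ × ℕ)

def Qf {m : ℕ} (f : Idx m) : GaussianInt := ⟨(f.1 : ℤ) + 1, f.2.1⟩
def Pf {m : ℕ} (f : Idx m) (j : Fin m) : GaussianInt := ⟨(f.2.2 j).1, (f.2.2 j).2⟩
def Xf {m : ℕ} (f : Idx m) (j : Fin m) : ℂ := (Pf f j : ℂ) / (Qf f : ℂ)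

def FF (m n : ℕ) : Finset (Idx m) := (Finset.range n).sigma fun a =>
  Finset.range (a+1) ×ˢ Fintype.piFinset fun _ => Finset.range (a+1) ×ˢ Finset.range (a+1)

lemma Qf_ne {m : ℕ} (f : Idx m) : Qf f ≠ 0 := by
  intro h
  have := congrArg Zsqrtd.re h
  simp [Qf] at this
  omega

lemma Qf_sq {m : ℕ} (f : Idx m) : ‖(Qf f : ℂ)‖ ^ 2 = ((f.1:ℝ) + 1) ^ 2 + (f.2.1:ℝ) ^ 2 := by
  rw [gi_norm_sq_s5]; simp [Qf]

lemma Qf_upper {m n : ℕ} (f : Idx m) (hf : f ∈ FF m n) : ‖(Qf f : ℂ)‖ ^ 2 ≤ 2 * ((f.1:ℝ) + 1) ^ 2 := by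
  rw [Qf_sq]
  simp only [FF, Finset.mem_sigma, Finset.mem_product, Finset.mem_range] at hf
  have : (f.2.1 : ℝ) ≤ f.1 + 1 := by exact_mod_cast hf.2.1.le
  have h0 : (0:ℝ) ≤ f.2.1 := by positivity
  nlinarith

lemma nt_main (m : ℕ) (hm : 1 ≤ m) : ∃ K : ℝ, 0 < K ∧ ∀ n : ℕ, ∃ X : Finset (Fin m → ℂ),
    ∃ q : (Fin m → ℂ) → GaussianInt,
    (∀ x ∈ X, q x ≠ 0 ∧ ‖(q x : ℂ)‖ ≤ 2 * n ∧ IsDen x (q x) ∧ ∀ j, ‖x j‖ ≤ 2) ∧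
    K * Real.log (n + 1) ≤ ∑ x ∈ X, (1 / ‖(q x : ℂ)‖) ^ (2 * (m + 1)) := by
  classical
  set w : GaussianInt → ℝ := fun g => (1 / ‖(g : ℂ)‖) ^ (2 * (m + 1)) with hw
  have hws : Summable w := gi_summable_s5 m hm
  have hw0 : ∀ g, 0 ≤ w g := fun g => by positivity
  have hSpos : 0 < ∑' g, w g := hws.tsum_pos hw0 1 (by simp [hw])
  set S := ∑' g, w g
  refine ⟨(1/2)^(m+1) / S, by positivity, fun n => ?_⟩
  have hden : ∀ f : Idx m, IsDen (Xf f) (Qf f) := by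
    intro f j
    refine ⟨Pf f j, ?_⟩
    have : (Qf f : ℂ) ≠ 0 := by
      rw [Ne, GaussianInt.toComplex_eq_zero]; exact Qf_ne f
    simp only [Xf]; field_simp
  have hex : ∀ x : Fin m → ℂ, ∃ q0 : GaussianInt, (∃ q, q ≠ 0 ∧ IsDen x q) → (q0 ≠ 0 ∧ IsDen x q0 ∧ ∀ q, q ≠ 0 → IsDen x q → ‖(q0:ℂ)‖ ≤ ‖(q:ℂ)‖ ∧ ∃ g : GaussianInt, q = g * q0) := by
    intro x
    by_cases h : ∃ q, q ≠ 0 ∧ IsDen x q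
    · obtain ⟨q0, hq⟩ := exists_min_den x h
      exact ⟨q0, fun _ => hq⟩
    · exact ⟨0, fun h' => absurd h' h⟩
  choose q hq using hex
  refine ⟨(FF m n).image Xf, q, ?_, ?_⟩
  · intro x hx
    obtain ⟨f, hf, rfl⟩ := Finset.mem_image.mp hx
    obtain ⟨h1, h2, h3⟩ := hq (Xf f) ⟨Qf f, Qf_ne f, hden f⟩
    have hup := Qf_upper f hf
    have hsq := Qf_sq f
    simp only [FF, Finset.mem_sigma, Finset.mem_product, Finset.mem_range, Fintype.mem_piFinset] at hf
    refine ⟨h1, ?_, h2, ?_⟩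
    · refine (h3 _ (Qf_ne f) (hden f)).1.trans ?_
      have : (f.1:ℝ) + 1 ≤ n := by exact_mod_cast hf.1
      have h0 : (0:ℝ) ≤ f.1 := by positivity
      apply le_of_sq_le_sq _ (by positivity)
      nlinarith
    · intro j
      have hq0 : 0 < ‖(Qf f : ℂ)‖ := by
        have := gi_one_le_s5 _ (Qf_ne f); linarith
      simp only [Xf, norm_div]
      rw [div_le_iff₀ hq0]
      apply le_of_sq_le_sq _ (by positivity)
      rw [mul_pow, hsq, gi_norm_sq_s5]
      simp only [Pf]
      push_cast
      have ha : ((f.2.2 j).1 : ℝ) ≤ f.1 + 1 := by exact_mod_cast (hf.2.2 j).1.le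
      have hb : ((f.2.2 j).2 : ℝ) ≤ f.1 + 1 := by exact_mod_cast (hf.2.2 j).2.le
      have ha0 : (0:ℝ) ≤ (f.2.2 j).1 := by positivity
      have hb0 : (0:ℝ) ≤ (f.2.2 j).2 := by positivity
      nlinarith
  · have hfib : ∑ f ∈ FF m n, w (Qf f) ≤ ∑ x ∈ (FF m n).image Xf, w (q x) * S := by
      rw [← Finset.sum_fiberwise_of_maps_to (g := Xf) (t := (FF m n).image Xf)
        (fun f hf => Finset.mem_image_of_mem _ hf)]
      apply Finset.sum_le_sum
      intro x hx
      obtain ⟨f0, hf0, hfx⟩ := Finset.mem_image.mp hx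
      obtain ⟨h1, h2, h3⟩ := hq x ⟨Qf f0, Qf_ne f0, hfx ▸ hden f0⟩
      have hg : ∀ f : Idx m, ∃ g : GaussianInt, Xf f = x → Qf f = g * q x := by
        intro f
        by_cases h : Xf f = x
        · obtain ⟨g, hg⟩ := (h3 _ (Qf_ne f) (h ▸ hden f)).2
          exact ⟨g, fun _ => hg⟩
        · exact ⟨0, fun h' => absurd h' h⟩
      choose g hg using hg
      have hinj : Set.InjOn g ((FF m n).filter (fun f => Xf f = x) : Finset (Idx m)) := by
        intro f hf f' hf' hgg
        have e1 : Xf f = x := (Finset.mem_filter.mp hf).2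
        have e2 : Xf f' = x := (Finset.mem_filter.mp hf').2
        have hQ : Qf f = Qf f' := by rw [hg f e1, hg f' e2, hgg]
        have hP : ∀ j, Pf f j = Pf f' j := by
          intro j
          have hj : Xf f j = Xf f' j := by rw [e1, e2]
          have : (Qf f' : ℂ) ≠ 0 := by
            rw [Ne, GaussianInt.toComplex_eq_zero]; exact Qf_ne f'
          simp only [Xf, hQ] at hj
          rw [div_left_inj' this] at hj
          exact GaussianInt.toComplex_injective hj
        obtain ⟨a, b, c⟩ := f
        obtain ⟨a', b', c'⟩ := f'
        have hQ1 := congrArg Zsqrtd.re hQ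
        have hQ2 := congrArg Zsqrtd.im hQ
        simp [Qf] at hQ1 hQ2
        subst hQ1 hQ2
        have : c = c' := by
          funext j
          have h1 := congrArg Zsqrtd.re (hP j)
          have h2 := congrArg Zsqrtd.im (hP j)
          simp [Pf] at h1 h2
          exact Prod.ext h1 h2
        rw [this]
      calc ∑ f ∈ FF m n with Xf f = x, w (Qf f) = ∑ f ∈ FF m n with Xf f = x, w (q x) * w (g f) := by
            apply Finset.sum_congr rfl
            intro f hf
            rw [hg f (Finset.mem_filter.mp hf).2]
            simp only [hw, GaussianInt.toComplex_mul, norm_mul]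
            rw [← mul_pow]; congr 1; ring
        _ = w (q x) * ∑ y ∈ ((FF m n).filter (fun f => Xf f = x)).image g, w y := by
            rw [← Finset.mul_sum, Finset.sum_image hinj]
        _ ≤ w (q x) * S := by
            apply mul_le_mul_of_nonneg_left _ (hw0 _)
            exact hws.sum_le_tsum _ (fun i _ => hw0 i)
    have hlow : (1/2)^(m+1) * Real.log (n+1) ≤ ∑ f ∈ FF m n, w (Qf f) := by
      have h1 : ∀ f ∈ FF m n, (1/2:ℝ)^(m+1) * (1 / ((f.1:ℝ)+1)) ^ (2*(m+1)) ≤ w (Qf f) := by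
        intro f hf
        simp only [hw]
        have hup := Qf_upper f hf
        have hq0 : 0 < ‖(Qf f : ℂ)‖ := by
          have := gi_one_le_s5 _ (Qf_ne f); linarith
        rw [pow_mul, pow_mul, ← mul_pow]
        apply pow_le_pow_left₀ (by positivity)
        rw [div_pow, div_pow, one_pow, one_div_mul_one_div]
        exact one_div_le_one_div_of_le (by positivity) hup
      refine le_trans ?_ (Finset.sum_le_sum h1)
      rw [FF, Finset.sum_sigma]
      simp only [Finset.sum_const, Finset.card_product, Finset.card_range, Fintype.card_piFinset, Finset.prod_const, Finset.card_univ, Fintype.card_fin, nsmul_eq_mul]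
      have h2 : ∀ a ∈ Finset.range n, (((a+1) * ((a+1)*(a+1))^m : ℕ):ℝ) * ((1/2:ℝ)^(m+1) * (1 / ((a:ℝ)+1)) ^ (2*(m+1))) = (1/2:ℝ)^(m+1) * ((a:ℝ)+1)⁻¹ := by
        intro a _
        have : (a:ℝ) + 1 ≠ 0 := by positivity
        push_cast
        have e : (1 / ((a:ℝ)+1)) ^ (2*(m+1)) * ((((a:ℝ)+1) * ((a+1)*(a+1))^m)) = ((a:ℝ)+1)⁻¹ := by
          rw [one_div, inv_pow, ← pow_two, ← pow_mul]
          field_simp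
          ring
        linear_combination (1/2:ℝ)^(m+1) * e
      rw [Finset.sum_congr rfl h2, ← Finset.mul_sum]
      apply mul_le_mul_of_nonneg_left _ (by positivity)
      have := log_add_one_le_harmonic n
      simpa [harmonic] using this
    rw [← Finset.sum_mul] at hfib
    rw [div_mul_eq_mul_div, div_le_iff₀ hSpos]
    exact hlow.trans hfib

lemma gauss_interval (R c r : ℝ) (h : |c| + r ≤ R) :
    ENNReal.ofReal (gaussianPDFReal 0 (1/2) R * (2 * r)) ≤ gaussianReal 0 (1/2) {y | |y - c| ≤ r} := by
  have hS : {y : ℝ | |y - c| ≤ r} = Icc (c - r) (c + r) := by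
    ext y; rw [Set.mem_Icc]; change |y - c| ≤ r ↔ _; rw [abs_le]; constructor <;> rintro ⟨h1, h2⟩ <;> constructor <;> linarith
  rw [hS, gaussianReal_apply 0 (by norm_num)]
  have : ∀ y ∈ Icc (c - r) (c + r), ENNReal.ofReal (gaussianPDFReal 0 (1/2) R) ≤ gaussianPDF 0 (1/2) y := by
    intro y hy
    rw [gaussianPDF]
    apply ENNReal.ofReal_le_ofReal
    have hyR : |y| ≤ R := by
      have := abs_le.mp (le_refl |c|)
      rw [abs_le]; constructor <;> linarith [hy.1, hy.2]
    have h2 : y ^ 2 ≤ R ^ 2 := by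
      rw [← sq_abs y]; exact pow_le_pow_left₀ (abs_nonneg _) hyR 2
    simp only [gaussianPDFReal, sub_zero]
    gcongr
  calc _ = ∫⁻ y in Icc (c - r) (c + r), ENNReal.ofReal (gaussianPDFReal 0 (1/2) R) := by
        rw [setLIntegral_const, Real.volume_Icc, ← ENNReal.ofReal_mul (gaussianPDFReal_nonneg _ _ _)]
        congr 2; ring
    _ ≤ _ := setLIntegral_mono' measurableSet_Icc this

lemma gauss_box {ι : Type*} [Fintype ι] (R r : ℝ) (hr : 0 ≤ r) (c : ι → ℝ) (h : ∀ i, |c i| + r ≤ R) :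
    ENNReal.ofReal ((gaussianPDFReal 0 (1/2) R * (2 * r)) ^ Fintype.card ι) ≤
      (Measure.pi fun _ : ι => gaussianReal 0 (1/2)) {g | ∀ i, |g i - c i| ≤ r} := by
  have : {g : ι → ℝ | ∀ i, |g i - c i| ≤ r} = Set.pi univ fun i => {y | |y - c i| ≤ r} := by
    ext g; simp
  rw [this, Measure.pi_pi, ENNReal.ofReal_pow (by have := gaussianPDFReal_nonneg 0 (1/2) R; positivity)]
  rw [← Finset.card_univ, ← Finset.prod_const]
  exact Finset.prod_le_prod' fun i _ => gauss_interval R (c i) r (h i)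

def Eset {ι : Type*} (p : ι → Prop) (t : {i // p i} → ℝ) (δ r : ℝ)
    (c : ({i // p i} → ℝ) → {i // ¬ p i} → ℝ) : Set (ι → ℝ) :=
  {g | (∀ i : {i // p i}, |g i - t i| ≤ δ) ∧ ∀ i : {i // ¬ p i}, |g i - c (fun k => g k) i| ≤ r}

lemma Eset_meas {ι : Type*} [Fintype ι] (p : ι → Prop) (t : {i // p i} → ℝ) (δ r : ℝ)
    (c : ({i // p i} → ℝ) → {i // ¬ p i} → ℝ) (hc : Continuous c) : MeasurableSet (Eset p t δ r c) := by
  apply IsClosed.measurableSet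
  rw [Eset, Set.ofPred_and]
  apply IsClosed.inter
  · rw [Set.ofPred_forall]
    exact isClosed_iInter fun i => isClosed_le (by fun_prop) (by fun_prop)
  · rw [Set.ofPred_forall]
    refine isClosed_iInter fun i => isClosed_le ?_ (by fun_prop)
    have : Continuous fun g : ι → ℝ => c (fun k => g k) i := by
      have h1 : Continuous fun g : ι → ℝ => (fun k : {i // p i} => g k) := by fun_prop
      exact (continuous_apply i).comp (hc.comp h1)
    fun_prop

lemma Eset_lower {ι : Type*} [Fintype ι] (p : ι → Prop) [DecidablePred p] (t : {i // p i} → ℝ) (δ r R : ℝ)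
    (hδ : 0 ≤ δ) (hr : 0 ≤ r)
    (c : ({i // p i} → ℝ) → {i // ¬ p i} → ℝ) (hc : Continuous c) (ht : ∀ i, |t i| + δ ≤ R)
    (hcR : ∀ a : {i // p i} → ℝ, (∀ i, |a i - t i| ≤ δ) → ∀ i, |c a i| + r ≤ R) :
    ENNReal.ofReal ((gaussianPDFReal 0 (1/2) R * (2 * r)) ^ Fintype.card {i // ¬ p i}) *
    ENNReal.ofReal ((gaussianPDFReal 0 (1/2) R * (2 * δ)) ^ Fintype.card {i // p i}) ≤
      (Measure.pi fun _ : ι => gaussianReal 0 (1/2)) (Eset p t δ r c) := by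
  have hmp := measurePreserving_piEquivPiSubtypeProd (fun _ : ι => gaussianReal 0 (1/2)) p
  set e := MeasurableEquiv.piEquivPiSubtypeProd (fun _ : ι => ℝ) p with he
  have hE : MeasurableSet (Eset p t δ r c) := Eset_meas p t δ r c hc
  rw [← (hmp.symm e).measure_preimage_equiv (Eset p t δ r c)]
  rw [Measure.prod_apply (e.symm.measurable hE)]
  have hT : MeasurableSet {a : {i // p i} → ℝ | ∀ i, |a i - t i| ≤ δ} := by
    apply IsClosed.measurableSet
    rw [Set.ofPred_forall]
    exact isClosed_iInter fun i => isClosed_le (by fun_prop) (by fun_prop)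
  calc _ ≤ ENNReal.ofReal ((gaussianPDFReal 0 (1/2) R * (2 * r)) ^ Fintype.card {i // ¬ p i}) *
        (Measure.pi fun _ : {i // p i} => gaussianReal 0 (1/2)) {a | ∀ i, |a i - t i| ≤ δ} := by
        gcongr
        exact gauss_box R δ hδ t ht
    _ = ∫⁻ a in {a : {i // p i} → ℝ | ∀ i, |a i - t i| ≤ δ}, ENNReal.ofReal ((gaussianPDFReal 0 (1/2) R * (2 * r)) ^ Fintype.card {i // ¬ p i}) ∂(Measure.pi fun _ : {i // p i} => gaussianReal 0 (1/2)) := by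
        rw [setLIntegral_const]
    _ ≤ ∫⁻ a in {a : {i // p i} → ℝ | ∀ i, |a i - t i| ≤ δ}, (Measure.pi fun _ : {i // ¬ p i} => gaussianReal 0 (1/2)) (Prod.mk a ⁻¹' (e.symm ⁻¹' Eset p t δ r c)) ∂(Measure.pi fun _ : {i // p i} => gaussianReal 0 (1/2)) := by
        apply setLIntegral_mono' hT
        intro a ha
        refine (gauss_box R r hr (c a) (hcR a ha)).trans (measure_mono ?_)
        intro b hb
        have h1 : ∀ i : {i // p i}, e.symm (a, b) i = a i := by
          intro i; exact congrFun (congrArg Prod.fst (e.apply_symm_apply (a, b))) i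
        have h2 : ∀ i : {i // ¬ p i}, e.symm (a, b) i = b i := by
          intro i; exact congrFun (congrArg Prod.snd (e.apply_symm_apply (a, b))) i
        simp only [mem_preimage, Eset, Set.mem_ofPred_eq, h1, h2]
        exact ⟨ha, hb⟩
    _ ≤ _ := setLIntegral_le_lintegral _ _

abbrev II (m : ℕ) := Fin (m+1) × Fin (m+1) × Bool
def pp (m : ℕ) : II m → Prop := fun k => k.2.1 ≠ 0
instance (m : ℕ) : DecidablePred (pp m) := fun k => inferInstanceAs (Decidable (k.2.1 ≠ 0))

def tt (m : ℕ) (k : {k : II m // pp m k}) : ℝ := if k.1.1 = k.1.2.1 ∧ k.1.2.2 = false then 1 else 0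

def Acol {m : ℕ} (a : {k : II m // pp m k} → ℝ) (i : Fin (m+1)) (j : Fin m) : ℂ :=
  (a ⟨(i, j.succ, false), Fin.succ_ne_zero j⟩ : ℂ) + (a ⟨(i, j.succ, true), Fin.succ_ne_zero j⟩ : ℂ) * Complex.I

def Scol {m : ℕ} (x : Fin m → ℂ) (a : {k : II m // pp m k} → ℝ) (i : Fin (m+1)) : ℂ :=
  ∑ j, x j * Acol a i j

def cc {m : ℕ} (x : Fin m → ℂ) (a : {k : II m // pp m k} → ℝ) (k : {k : II m // ¬ pp m k}) : ℝ :=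
  if k.1.2.2 then (Scol x a k.1.1).im else (Scol x a k.1.1).re

lemma cc_cont {m : ℕ} (x : Fin m → ℂ) : Continuous (cc x) := by
  have hS : ∀ i, Continuous fun a => Scol x a i := by
    intro i; unfold Scol Acol; fun_prop
  refine continuous_pi fun k => ?_
  unfold cc
  split_ifs
  · exact Complex.continuous_im.comp (hS _)
  · exact Complex.continuous_re.comp (hS _)

lemma card_np (m : ℕ) : Fintype.card {k : II m // ¬ pp m k} = 2 * (m + 1) := by
  have e : {k : II m // ¬ pp m k} ≃ Fin (m+1) × Bool :=
    { toFun := fun k => (k.1.1, k.1.2.2)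
      invFun := fun y => ⟨(y.1, 0, y.2), by simp [pp]⟩
      left_inv := by
        rintro ⟨⟨i, j, b⟩, h⟩
        simp [pp] at h
        simp [h]
      right_inv := by rintro ⟨i, b⟩; rfl }
  rw [Fintype.card_congr e]
  simp [mul_comm]

lemma Acol_near {m : ℕ} (a : {k : II m // pp m k} → ℝ) (δ : ℝ) (ha : ∀ k, |a k - tt m k| ≤ δ)
    (i : Fin (m+1)) (j : Fin m) : ‖Acol a i j - (if i = j.succ then 1 else 0)‖ ≤ 2 * δ := by
  have h1 := ha ⟨(i, j.succ, false), Fin.succ_ne_zero j⟩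
  have h2 := ha ⟨(i, j.succ, true), Fin.succ_ne_zero j⟩
  refine (Complex.norm_le_abs_re_add_abs_im _).trans ?_
  simp only [tt] at h1 h2
  by_cases h : i = j.succ
  · simp [Acol, h] at h1 h2 ⊢; linarith
  · simp [Acol, h] at h1 h2 ⊢; linarith

lemma E_key1 {m : ℕ} (x : Fin m → ℂ) (δ r : ℝ) (g : II m → ℝ) (hg : g ∈ Eset (pp m) (tt m) δ r (cc x))
    (i : Fin (m+1)) : ‖matOf g i 0 - ∑ j, x j * matOf g i j.succ‖ ≤ 2 * r := by
  have h1 := hg.2 ⟨(i, 0, false), by simp [pp]⟩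
  have h2 := hg.2 ⟨(i, 0, true), by simp [pp]⟩
  have e : ∑ j, x j * matOf g i j.succ = Scol x (fun k => g k) i := rfl
  rw [e]
  refine (Complex.norm_le_abs_re_add_abs_im _).trans ?_
  simp [cc] at h1 h2
  simp [matOf]
  linarith

lemma E_disj {m n : ℕ} (hm : 1 ≤ m) (ε : ℝ) (hε : 0 < ε) (hn : n * ε ≤ 1 / 8)
    (x x' : Fin m → ℂ) (q q' : GaussianInt) (hne : x ≠ x') (hq : q ≠ 0) (hq' : q' ≠ 0)
    (hqn : ‖(q:ℂ)‖ ≤ 2 * n) (hqn' : ‖(q':ℂ)‖ ≤ 2 * n) (hd : IsDen x q) (hd' : IsDen x' q') :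
    Disjoint (Eset (pp m) (tt m) (1 / (4 * (m+1))) (ε / (2 * (m+1) * ‖(q:ℂ)‖)) (cc x))
      (Eset (pp m) (tt m) (1 / (4 * (m+1))) (ε / (2 * (m+1) * ‖(q':ℂ)‖)) (cc x')) := by
  rw [Set.disjoint_left]
  intro g hg hg'
  have : Nonempty (Fin m) := ⟨⟨0, hm⟩⟩
  obtain ⟨i0, hi0⟩ := Finite.exists_max (fun i => ‖x i - x' i‖)
  have hy : x i0 - x' i0 ≠ 0 := by
    intro h
    apply hne
    funext j
    have := hi0 j
    rw [h, norm_zero] at this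
    exact sub_eq_zero.mp (norm_le_zero_iff.mp this)
  have hQ := gi_one_le_s5 q hq
  have hQ' := gi_one_le_s5 q' hq'
  have k1 := E_key1 x _ _ g hg i0.succ
  have k2 := E_key1 x' _ _ g hg' i0.succ
  have hA : ∀ j, ‖matOf g i0.succ j.succ - (if i0 = j then 1 else 0)‖ ≤ 2 * (1 / (4 * (m+1))) := by
    intro j
    have := Acol_near (fun k : {k : II m // pp m k} => g k) _ hg.1 i0.succ j
    simp only [Fin.succ_inj] at this
    exact this
  set Y := ‖x i0 - x' i0‖ with hY
  have hYpos : 0 < Y := norm_pos_iff.mpr hy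
  have hint : 1 ≤ Y * ‖(q:ℂ)‖ * ‖(q':ℂ)‖ := by
    obtain ⟨p, hp⟩ := hd i0
    obtain ⟨p', hp'⟩ := hd' i0
    have e : (x i0 - x' i0) * q * q' = ((p * q' - p' * q : GaussianInt) : ℂ) := by
      simp only [GaussianInt.toComplex_sub, GaussianInt.toComplex_mul]
      linear_combination (q' : ℂ) * hp - (q : ℂ) * hp'
    rw [hY, ← norm_mul, ← norm_mul, e]
    apply gi_one_le_s5
    intro h0
    rw [h0, GaussianInt.toComplex_zero] at e
    have a1 : (q:ℂ) ≠ 0 := by rw [Ne, GaussianInt.toComplex_eq_zero]; exact hq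
    have a2 : (q':ℂ) ≠ 0 := by rw [Ne, GaussianInt.toComplex_eq_zero]; exact hq'
    exact mul_ne_zero (mul_ne_zero hy a1) a2 e
  have hsum : ‖∑ j, (x j - x' j) * (matOf g i0.succ j.succ - (if i0 = j then 1 else 0))‖ ≤ Y / 2 := by
    calc _ ≤ ∑ j : Fin m, Y * (2 * (1 / (4 * ((m:ℝ)+1)))) := by
          refine norm_sum_le_of_le _ fun j _ => ?_
          rw [norm_mul]
          exact mul_le_mul (hi0 j) (hA j) (norm_nonneg _) hYpos.le
      _ = Y / 2 * (m / (m+1)) := by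
          simp only [Finset.sum_const, Finset.card_univ, Fintype.card_fin, nsmul_eq_mul]
          field_simp
          norm_num
      _ ≤ Y / 2 := by
          apply mul_le_of_le_one_right (by positivity)
          rw [div_le_one (by positivity)]; linarith
  have hdec : x i0 - x' i0 = ((matOf g i0.succ 0 - ∑ j, x' j * matOf g i0.succ j.succ) -
      (matOf g i0.succ 0 - ∑ j, x j * matOf g i0.succ j.succ)) -
      ∑ j, (x j - x' j) * (matOf g i0.succ j.succ - (if i0 = j then 1 else 0)) := by
    simp only [mul_sub, sub_mul, Finset.sum_sub_distrib]
    simp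
  have hYle : Y ≤ 2 * (ε / (2 * (m+1) * ‖(q':ℂ)‖)) + 2 * (ε / (2 * (m+1) * ‖(q:ℂ)‖)) + Y / 2 := by
    conv_lhs => rw [hY, hdec]
    exact (norm_sub_le _ _).trans (add_le_add ((norm_sub_le _ _).trans (add_le_add k2 k1)) hsum)
  set a := ‖(q:ℂ)‖
  set b := ‖(q':ℂ)‖
  have hm1 : (1:ℝ) ≤ m := by exact_mod_cast hm
  have h3 : Y ≤ 4 * (ε / (2 * (m+1) * b)) + 4 * (ε / (2 * (m+1) * a)) := by linarith
  have h4 : Y * a * b ≤ 2 * ε * (a + b) / (m+1) := by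
    calc Y * a * b ≤ (4 * (ε / (2 * (m+1) * b)) + 4 * (ε / (2 * (m+1) * a))) * a * b := by gcongr
      _ = _ := by
        have : a ≠ 0 := by linarith
        have : b ≠ 0 := by linarith
        field_simp
        ring
  have h5 : 2 * ε * (a + b) / (m+1) ≤ ε * (a + b) := by
    rw [div_le_iff₀ (by positivity)]
    have : 0 ≤ ε * (a + b) := by positivity
    nlinarith
  nlinarith

lemma E_sub {m : ℕ} (ε : ℝ) (hε : 0 < ε) (δ : ℝ) (x : Fin m → ℂ) (q : GaussianInt) (hq : q ≠ 0)
    (hd : IsDen x q) :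
    Eset (pp m) (tt m) δ (ε / (2 * (m+1) * ‖(q:ℂ)‖)) (cc x) ⊆ {g | latMinDist (matOf g) ≤ ε} := by
  intro g hg
  change latMinDist (matOf g) ≤ ε
  choose p hp using hd
  have hQ := gi_one_le_s5 q hq
  have hle : latMinDist (matOf g) ≤ cnorm ((matOf g).mulVec fun j =>
      (((Fin.cons q (fun j => - p j) : Fin (m+1) → GaussianInt) j : GaussianInt) : ℂ)) := by
    apply csInf_le
    · refine ⟨0, ?_⟩
      rintro r ⟨z, _, rfl⟩
      exact Real.sqrt_nonneg _
    · refine ⟨_, ?_, rfl⟩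
      intro h
      exact hq (by simpa using congrFun h 0)
  refine hle.trans ?_
  unfold cnorm
  apply Real.sqrt_le_iff.mpr
  refine ⟨hε.le, ?_⟩
  have hi : ∀ i, ‖(matOf g).mulVec (fun j =>
      (((Fin.cons q (fun j => - p j) : Fin (m+1) → GaussianInt) j : GaussianInt) : ℂ)) i‖ ^ 2 ≤ (ε / (m+1)) ^ 2 := by
    intro i
    apply pow_le_pow_left₀ (norm_nonneg _)
    have e : (matOf g).mulVec (fun j =>
      (((Fin.cons q (fun j => - p j) : Fin (m+1) → GaussianInt) j : GaussianInt) : ℂ)) i =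
        q * (matOf g i 0 - ∑ j, x j * matOf g i j.succ) := by
      simp only [Matrix.mulVec, dotProduct, Fin.sum_univ_succ, Fin.cons_zero, Fin.cons_succ,
        GaussianInt.toComplex_neg, ← hp]
      rw [mul_sub, Finset.mul_sum, sub_eq_add_neg, ← Finset.sum_neg_distrib]
      congr 1
      · ring
      · exact Finset.sum_congr rfl fun j _ => by ring
    rw [e, norm_mul]
    calc _ ≤ ‖(q:ℂ)‖ * (2 * (ε / (2 * (m+1) * ‖(q:ℂ)‖))) := by
          gcongr; exact E_key1 x _ _ g hg i
      _ = _ := by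
          have : ‖(q:ℂ)‖ ≠ 0 := by linarith
          field_simp
  calc _ ≤ ∑ i : Fin (m+1), (ε / ((m:ℝ)+1)) ^ 2 := Finset.sum_le_sum fun i _ => hi i
    _ = ε ^ 2 / (m+1) := by
        simp only [Finset.sum_const, Finset.card_univ, Fintype.card_fin, nsmul_eq_mul]
        push_cast
        field_simp
    _ ≤ ε ^ 2 := by
        apply div_le_self (by positivity)
        have : (0:ℝ) ≤ m := by positivity
        linarith

lemma E_low {m : ℕ} : ∃ D : ℝ, 0 < D ∧ ∀ (ε : ℝ), 0 < ε → ε ≤ 1 → ∀ (x : Fin m → ℂ) (q : GaussianInt), q ≠ 0 →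
    (∀ j, ‖x j‖ ≤ 2) → ENNReal.ofReal (D * ε ^ (2 * (m+1)) * (1 / ‖(q:ℂ)‖) ^ (2 * (m+1))) ≤
      gaussMatMeasure (m+1) (m+1) (Eset (pp m) (tt m) (1 / (4 * (m+1))) (ε / (2 * (m+1) * ‖(q:ℂ)‖)) (cc x)) := by
  set R : ℝ := 4 * m + 2 with hR
  set κ := gaussianPDFReal 0 (1/2) R with hκ
  have hκ0 : 0 < κ := gaussianPDFReal_pos _ _ _ (by norm_num)
  refine ⟨(κ / (m+1)) ^ (2*(m+1)) * (κ * (2 * (1 / (4 * (m+1))))) ^ Fintype.card {k : II m // pp m k}, by positivity, ?_⟩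
  intro ε hε hε1 x q hq hx
  have hQ := gi_one_le_s5 q hq
  have hδ : (1:ℝ) / (4 * (m+1)) ≤ 1/4 := by
    apply one_div_le_one_div_of_le (by norm_num)
    have : (0:ℝ) ≤ m := by positivity
    linarith
  have hm0 : (0:ℝ) ≤ m := by positivity
  have hr : ε / (2 * (m+1) * ‖(q:ℂ)‖) ≤ 1 := by
    rw [div_le_one (by positivity)]
    nlinarith
  have hmain := Eset_lower (pp m) (tt m) (1 / (4 * (m+1))) (ε / (2 * (m+1) * ‖(q:ℂ)‖)) R (by positivity)
    (by positivity) (cc x) (cc_cont x) ?_ ?_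
  · refine le_trans (le_of_eq ?_) hmain
    rw [← ENNReal.ofReal_mul (by positivity), card_np]
    congr 1
    have e : gaussianPDFReal 0 (1 / 2) R * (2 * (ε / (2 * (m + 1) * ‖(q:ℂ)‖))) =
        κ / (m+1) * ε * (1 / ‖(q:ℂ)‖) := by
      rw [← hκ]
      have : ‖(q:ℂ)‖ ≠ 0 := by linarith
      field_simp
    rw [e, mul_pow (κ / (m+1) * ε), mul_pow (κ / (m+1)), ← hκ]
    have key : ∀ A B Z W : ℝ, A * B * Z * W = A * Z * W * B := by intros; ring
    rw [key]
  · intro k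
    have : |tt m k| ≤ 1 := by unfold tt; split_ifs <;> simp
    linarith
  · intro a ha k
    have hS : ‖Scol x a k.1.1‖ ≤ 4 * m := by
      calc _ ≤ ∑ j : Fin m, (4:ℝ) := by
            refine norm_sum_le_of_le _ fun j _ => ?_
            rw [norm_mul]
            have h1 := Acol_near a _ ha k.1.1 j
            have h2 : ‖Acol a k.1.1 j‖ ≤ 2 := by
              have h3 : ‖(if k.1.1 = j.succ then 1 else 0 : ℂ)‖ ≤ 1 := by split_ifs <;> simp
              have := norm_le_norm_sub_add (Acol a k.1.1 j) (if k.1.1 = j.succ then 1 else 0 : ℂ)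
              linarith
            have := mul_le_mul (hx j) h2 (norm_nonneg _) (by norm_num)
            linarith
        _ = _ := by simp [mul_comm]
    have hc : |cc x a k| ≤ 4 * m := by
      unfold cc; split_ifs
      · exact (Complex.abs_im_le_norm _).trans hS
      · exact (Complex.abs_re_le_norm _).trans hS
    linarith

lemma core (m : ℕ) (hm : 1 ≤ m) : ∃ C : ℝ, 0 < C ∧ ∀ ε : ℝ, 0 < ε → ε ≤ 1/64 →
      C * ε ^ (2 * (m+1)) * Real.log (1 / ε) ≤
        ((gaussMatMeasure (m+1) (m+1)) {g | latMinDist (matOf g) ≤ ε}).toReal := by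
  obtain ⟨K, hK, hX⟩ := nt_main m hm
  obtain ⟨D, hD, hlow⟩ := E_low (m := m)
  have : IsProbabilityMeasure (gaussMatMeasure (m+1) (m+1)) := by
    unfold gaussMatMeasure; infer_instance
  refine ⟨D * K / 2, by positivity, fun ε hε hε1 => ?_⟩
  set n := ⌊1 / (8 * ε)⌋₊ with hn
  obtain ⟨X, q, hXq, hsum⟩ := hX n
  have hn1 : (n:ℝ) * ε ≤ 1/8 := by
    have := Nat.floor_le (show 0 ≤ 1 / (8 * ε) by positivity)
    calc (n:ℝ) * ε ≤ 1 / (8 * ε) * ε := by gcongr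
      _ = 1/8 := by field_simp
  have hlog : Real.log (1/ε) / 2 ≤ Real.log (n + 1) := by
    have h1 : 1 / (8 * ε) ≤ n + 1 := (Nat.lt_floor_add_one _).le
    have h2 : 1 / ε ≤ ((n:ℝ) + 1) ^ 2 := by
      calc 1 / ε ≤ (1 / (8 * ε)) ^ 2 := by
            rw [div_pow, div_le_div_iff₀ hε (by positivity)]
            nlinarith
        _ ≤ _ := by gcongr
    have h3 := Real.log_le_log (by positivity) h2
    rw [Real.log_pow] at h3
    push_cast at h3
    linarith
  rw [← ENNReal.ofReal_le_iff_le_toReal (measure_ne_top _ _)]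
  calc _ ≤ ENNReal.ofReal (∑ x ∈ X, D * ε ^ (2 * (m+1)) * (1 / ‖(q x:ℂ)‖) ^ (2 * (m+1))) := by
        apply ENNReal.ofReal_le_ofReal
        rw [← Finset.mul_sum]
        calc _ = D * ε ^ (2 * (m+1)) * (K * (Real.log (1/ε) / 2)) := by ring
          _ ≤ D * ε ^ (2 * (m+1)) * (K * Real.log (n+1)) := by gcongr
          _ ≤ _ := by gcongr
    _ = ∑ x ∈ X, ENNReal.ofReal (D * ε ^ (2 * (m+1)) * (1 / ‖(q x:ℂ)‖) ^ (2 * (m+1))) :=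
        ENNReal.ofReal_sum_of_nonneg fun x _ => by positivity
    _ ≤ ∑ x ∈ X, gaussMatMeasure (m+1) (m+1) (Eset (pp m) (tt m) (1 / (4 * (m+1))) (ε / (2 * (m+1) * ‖(q x:ℂ)‖)) (cc x)) :=
        Finset.sum_le_sum fun x hx => hlow ε hε (by linarith) x (q x) (hXq x hx).1 (hXq x hx).2.2.2
    _ = gaussMatMeasure (m+1) (m+1) (⋃ x ∈ X, Eset (pp m) (tt m) (1 / (4 * (m+1))) (ε / (2 * (m+1) * ‖(q x:ℂ)‖)) (cc x)) := by
        rw [measure_biUnion_finset]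
        · intro x hx x' hx' hne
          obtain ⟨a1, a2, a3, _⟩ := hXq x hx
          obtain ⟨b1, b2, b3, _⟩ := hXq x' hx'
          exact E_disj hm ε hε hn1 x x' (q x) (q x') hne a1 b1 a2 b2 a3 b3
        · intro x _
          exact Eset_meas _ _ _ _ _ (cc_cont x)
    _ ≤ _ := by
        apply measure_mono
        refine iUnion₂_subset fun x hx => ?_
        exact E_sub ε hε _ x (q x) (hXq x hx).1 (hXq x hx).2.2.1

/-- For `M ≥ 2` and an `M × M` random matrix `H` with i.i.d.
circularly-symmetric complex Gaussian entries of zero mean and unit variance, there is a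
constant `C' > 0` (depending only on `M`) such that for all `0 < ε < 1`,
`Pr{d(H) ≤ ε} ≥ C' · ε^(2M) · ln(1/ε)`. -/
theorem naive_lattice_min_dist_lower_bound (M : ℕ) (hM : 2 ≤ M) :
    ∃ C' : ℝ, 0 < C' ∧ ∀ ε : ℝ, 0 < ε → ε < 1 →
      C' * ε ^ (2 * M) * Real.log (1 / ε) ≤
        ((gaussMatMeasure M M) {g | latMinDist (matOf g) ≤ ε}).toReal := by
  obtain ⟨m, rfl⟩ : ∃ m, M = m + 1 := ⟨M - 1, by omega⟩
  obtain ⟨C, hC, h⟩ := core m (by omega)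
  have : IsProbabilityMeasure (gaussMatMeasure (m+1) (m+1)) := by
    unfold gaussMatMeasure; infer_instance
  refine ⟨C * (1/64) ^ (2 * (m+1)), by positivity, fun ε hε hε1 => ?_⟩
  have hl : 0 ≤ Real.log (1 / ε) := Real.log_nonneg (by rw [le_div_iff₀ hε]; linarith)
  rcases le_total ε (1/64) with h1 | h1
  · refine le_trans ?_ (h ε hε h1)
    have : ((1:ℝ)/64) ^ (2 * (m+1)) ≤ 1 := pow_le_one₀ (by norm_num) (by norm_num)
    have h2 : C * (1/64) ^ (2 * (m+1)) ≤ C := mul_le_of_le_one_right hC.le this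
    gcongr
  · have h2 := h (1/64) (by norm_num) le_rfl
    have h3 : ((gaussMatMeasure (m+1) (m+1)) {g | latMinDist (matOf g) ≤ 1/64}).toReal ≤
        ((gaussMatMeasure (m+1) (m+1)) {g | latMinDist (matOf g) ≤ ε}).toReal := by
      apply ENNReal.toReal_mono (measure_ne_top _ _)
      apply measure_mono
      intro g hg
      exact le_trans (show latMinDist (matOf g) ≤ 1/64 from hg) h1
    refine le_trans ?_ (h2.trans h3)
    have h4 : ε ^ (2 * (m+1)) ≤ 1 := pow_le_one₀ hε.le hε1.le
    have h5 : Real.log (1/ε) ≤ Real.log (1 / (1/64)) := by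
      apply Real.log_le_log (by positivity)
      exact one_div_le_one_div_of_le (by norm_num) h1
    have h6 : C * (1/64) ^ (2 * (m+1)) * ε ^ (2 * (m+1)) ≤ C * (1/64) ^ (2 * (m+1)) :=
      mul_le_of_le_one_right (by positivity) h4
    exact mul_le_mul h6 h5 hl (by positivity)
end
end

section
/- Let M ≥ 2 and let H be an M×M random matrix whose entries are i.i.d. circularly-symmetric complex Gaussian with mean zero and unit variance, and let d(H) = inf{‖H z‖ : z ∈ ℤ[i]^M, z ≠ 0}. Then Pr{d(H) ≤ ε} / ε^{2M} → ∞ as ε → 0+. -/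
open MeasureTheory ProbabilityTheory Matrix Filter Set

noncomputable section

abbrev gam : Measure ℝ := gaussianReal 0 (1/2)

lemma gam_le (c r : ℝ) : gam (Icc (c - r) (c + r)) ≤ ENNReal.ofReal (2 * r) := by
  rw [gaussianReal_apply _ (by norm_num)]
  calc ∫⁻ x in Icc (c - r) (c + r), gaussianPDF 0 (1/2) x
      ≤ ∫⁻ x in Icc (c - r) (c + r), 1 := by
        apply lintegral_mono
        intro x
        simp only [gaussianPDF, gaussianPDFReal]
        rw [← ENNReal.ofReal_one]
        apply ENNReal.ofReal_le_ofReal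
        apply mul_le_one₀
        · apply inv_le_one_of_one_le₀
          rw [Real.one_le_sqrt]
          have := Real.pi_gt_three
          push_cast
          linarith
        · positivity
        · rw [Real.exp_le_one_iff]
          apply div_nonpos_of_nonpos_of_nonneg
          · nlinarith [sq_nonneg (x - 0)]
          · positivity
    _ = _ := by
        rw [setLIntegral_one, Real.volume_Icc]
        congr 1; ring

lemma gam_ge {K c r : ℝ} (hc : |c| ≤ K) (hr : r ≤ 1) :
    ENNReal.ofReal (gaussianPDFReal 0 (1/2) (K + 1)) * ENNReal.ofReal (2 * r)
      ≤ gam (Icc (c - r) (c + r)) := by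
  rw [gaussianReal_apply _ (by norm_num)]
  calc _ = ∫⁻ x in Icc (c - r) (c + r), ENNReal.ofReal (gaussianPDFReal 0 (1/2) (K + 1)) := by
        rw [setLIntegral_const, Real.volume_Icc]
        congr 2; ring
    _ ≤ _ := by
        apply setLIntegral_mono (by fun_prop)
        intro x hx
        simp only [gaussianPDF, gaussianPDFReal]
        apply ENNReal.ofReal_le_ofReal
        refine mul_le_mul_of_nonneg_left ?_ (by positivity)
        rw [Real.exp_le_exp]
        refine div_le_div_of_nonneg_right ?_ (by positivity)
        obtain ⟨h1, h2⟩ := hx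
        rw [abs_le] at hc
        nlinarith

lemma pi_box {κ : Type*} [Fintype κ] (c : κ → ℝ) (r : ℝ) :
    (Measure.pi fun _ : κ => gam) {x | ∀ t, |x t - c t| ≤ r} =
      ∏ t, gam (Icc (c t - r) (c t + r)) := by
  rw [← Measure.pi_pi]
  congr 1
  ext x
  simp only [Set.mem_ofPred_eq, Set.mem_pi, mem_univ, true_imp_iff, mem_Icc, abs_le]
  refine forall_congr' fun t => ?_
  constructor <;> rintro ⟨a, b⟩ <;> constructor <;> linarith

lemma pi_fubini {ι : Type*} [Fintype ι] (p : ι → Prop) [DecidablePred p] {A : Set (ι → ℝ)}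
    (hA : MeasurableSet A) :
    (Measure.pi fun _ : ι => gam) A = ∫⁻ y, (Measure.pi fun _ : {x // p x} => gam)
      {x | (MeasurableEquiv.piEquivPiSubtypeProd (fun _ : ι => ℝ) p).symm (x, y) ∈ A}
      ∂(Measure.pi fun _ : {x // ¬ p x} => gam) := by
  have h := (measurePreserving_piEquivPiSubtypeProd (fun _ : ι => gam) p).symm
  rw [← h.measure_preimage hA.nullMeasurableSet, Measure.prod_apply_symm]
  · rfl
  · exact (MeasurableEquiv.measurable _) hA

lemma pi_upper_s6 {ι : Type*} [Fintype ι] (p : ι → Prop) [DecidablePred p] {A : Set (ι → ℝ)}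
    (hA : MeasurableSet A) (r : ℝ)
    (h : ∀ g ∈ A, ∀ g' ∈ A, (∀ t, ¬ p t → g t = g' t) → ∀ t, p t → |g t - g' t| ≤ r) :
    (Measure.pi fun _ : ι => gam) A ≤ ENNReal.ofReal (2 * r) ^ Fintype.card {x // p x} := by
  rw [pi_fubini p hA]
  calc _ ≤ ∫⁻ y, ENNReal.ofReal (2 * r) ^ Fintype.card {x // p x}
            ∂(Measure.pi fun _ : {x // ¬ p x} => gam) := by
        apply lintegral_mono
        intro y
        dsimp only
        set e := MeasurableEquiv.piEquivPiSubtypeProd (fun _ : ι => ℝ) p with he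
        have hp : ∀ x : {x // p x} → ℝ, ∀ t, (ht : p t) → e.symm (x, y) t = x ⟨t, ht⟩ := by
          intro x t ht
          simp [he, MeasurableEquiv.piEquivPiSubtypeProd, Equiv.piEquivPiSubtypeProd, ht]
        have hn : ∀ x : {x // p x} → ℝ, ∀ t, (ht : ¬ p t) → e.symm (x, y) t = y ⟨t, ht⟩ := by
          intro x t ht
          simp [he, MeasurableEquiv.piEquivPiSubtypeProd, Equiv.piEquivPiSubtypeProd, ht]
        by_cases hne : ∃ x0, e.symm (x0, y) ∈ A
        · obtain ⟨x0, hx0⟩ := hne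
          calc _ ≤ (Measure.pi fun _ : {x // p x} => gam) {x | ∀ t, |x t - x0 t| ≤ r} := by
                apply measure_mono
                intro x hx t
                have := h _ hx _ hx0 (fun t ht => by rw [hn _ t ht, hn _ t ht]) t t.2
                rwa [hp _ _ t.2, hp _ _ t.2] at this
            _ ≤ ∏ t : {x // p x}, ENNReal.ofReal (2 * r) := by
                rw [pi_box]
                exact Finset.prod_le_prod' fun t _ => gam_le _ _
            _ = _ := by simp
        · have : {x | e.symm (x, y) ∈ A} = ∅ := by
            ext x; simp; exact fun hx => hne ⟨x, hx⟩
          rw [this]; simp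
    _ = _ := by simp

lemma pi_lower_s6 {ι : Type*} [Fintype ι] (p : ι → Prop) [DecidablePred p] {A : Set (ι → ℝ)}
    (hA : MeasurableSet A) (K r : ℝ) (hr : r ≤ 1)
    (h : ∀ y : ι → ℝ, (∀ t, ¬ p t → |y t| ≤ 1) → ∃ c : ι → ℝ, (∀ t, |c t| ≤ K) ∧
      ∀ g : ι → ℝ, (∀ t, ¬ p t → g t = y t) → (∀ t, p t → |g t - c t| ≤ r) → g ∈ A) :
    (ENNReal.ofReal (gaussianPDFReal 0 (1/2) (K + 1)) * ENNReal.ofReal (2 * r))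
        ^ Fintype.card {x // p x} *
      (ENNReal.ofReal (gaussianPDFReal 0 (1/2) (0 + 1)) * ENNReal.ofReal (2 * 1))
        ^ Fintype.card {x // ¬ p x}
     ≤ (Measure.pi fun _ : ι => gam) A := by
  rw [pi_fubini p hA]
  set e := MeasurableEquiv.piEquivPiSubtypeProd (fun _ : ι => ℝ) p with he
  set q := (ENNReal.ofReal (gaussianPDFReal 0 (1/2) (K + 1)) * ENNReal.ofReal (2 * r))
        ^ Fintype.card {x // p x} with hq
  have hp : ∀ x y, ∀ t, (ht : p t) → e.symm (x, y) t = x ⟨t, ht⟩ := by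
    intro x y t ht
    simp [he, MeasurableEquiv.piEquivPiSubtypeProd, Equiv.piEquivPiSubtypeProd, ht]
  have hn : ∀ x y, ∀ t, (ht : ¬ p t) → e.symm (x, y) t = y ⟨t, ht⟩ := by
    intro x y t ht
    simp [he, MeasurableEquiv.piEquivPiSubtypeProd, Equiv.piEquivPiSubtypeProd, ht]
  let B : Set ({x // ¬ p x} → ℝ) := {y | ∀ t, |y t - (fun _ => (0 : ℝ)) t| ≤ 1}
  calc _ ≤ q * (Measure.pi fun _ : {x // ¬ p x} => gam) B := by
        gcongr
        rw [pi_box, ← Finset.card_univ, ← Finset.prod_const]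
        exact Finset.prod_le_prod' fun t _ => gam_ge (by simp) le_rfl
    _ = ∫⁻ y in B, q ∂(Measure.pi fun _ : {x // ¬ p x} => gam) := by
        rw [setLIntegral_const]
    _ ≤ ∫⁻ y in B, (Measure.pi fun _ : {x // p x} => gam) {x | e.symm (x, y) ∈ A}
          ∂(Measure.pi fun _ : {x // ¬ p x} => gam) := by
        apply setLIntegral_mono' 
        · have : B = Set.pi univ (fun _ => Icc (-1) 1) := by
            ext x; simp [B, abs_le, Pi.le_def, forall_and]
          rw [this]
          exact MeasurableSet.univ_pi fun _ => measurableSet_Icc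
        intro y hy
        obtain ⟨c, hc, hg⟩ := h (e.symm (fun _ => 0, y)) (by
          intro t ht
          rw [hn _ _ t ht]
          simpa using hy ⟨t, ht⟩)
        calc q ≤ (Measure.pi fun _ : {x // p x} => gam) {x | ∀ t, |x t - c t| ≤ r} := by
              rw [pi_box _ r, hq, ← Finset.card_univ, ← Finset.prod_const]
              exact Finset.prod_le_prod' fun t _ => gam_ge (hc _) hr
          _ ≤ _ := by
              apply measure_mono
              intro x hx
              apply hg
              · intro t ht
                rw [hn _ _ t ht, hn _ _ t ht]
              · intro t ht
                rw [hp _ _ t ht]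
                exact hx ⟨t, ht⟩
    _ ≤ _ := setLIntegral_le_lintegral _ _

/-- Good vectors: the coordinate `0` is nonzero and dominates up to a factor 2. -/
def Good {m : ℕ} (z : Fin (m + 2) → GaussianInt) : Prop :=
  z 0 ≠ 0 ∧ ∀ j, ‖(z j : ℂ)‖ ≤ 2 * ‖(z 0 : ℂ)‖

def ratio {m : ℕ} (z : Fin (m + 2) → GaussianInt) : Fin (m + 2) → ℂ :=
  fun j => (z j : ℂ) / (z 0 : ℂ)

lemma exists_primitive {m : ℕ} (z : Fin (m + 2) → GaussianInt) (hz : Good z) :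
    ∃ p c : Fin (m + 2) → GaussianInt, ∑ j, c j * p j = 1 ∧ Good p ∧ ratio p = ratio z := by
  obtain ⟨g, hg⟩ := (IsPrincipalIdealRing.principal (Ideal.span (Set.range z))).principal
  have hmem : ∀ j, ∃ a, z j = g * a := by
    intro j
    have : z j ∈ Ideal.span (Set.range z) := Ideal.subset_span ⟨j, rfl⟩
    rw [hg] at this
    exact Ideal.mem_span_singleton.1 this
  choose p hp using hmem
  have hgm : g ∈ Ideal.span (Set.range z) := by
    rw [hg]; exact Submodule.mem_span_singleton_self g
  obtain ⟨c, hc⟩ := Ideal.mem_span_range_iff_exists_fun.1 hgm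
  have hg0 : g ≠ 0 := by
    rintro rfl
    exact hz.1 (by simp [hp 0])
  have hp0 : p 0 ≠ 0 := by
    intro h
    exact hz.1 (by simp [hp 0, h])
  have hgC : (g : ℂ) ≠ 0 := by simpa using hg0
  refine ⟨p, c, ?_, ⟨hp0, ?_⟩, ?_⟩
  · apply mul_left_cancel₀ hg0
    rw [mul_one, Finset.mul_sum]
    conv_rhs => rw [← hc]
    refine Finset.sum_congr rfl fun j _ => ?_
    rw [hp j]; ring
  · intro j
    have h := hz.2 j
    rw [hp j, hp 0] at h
    simp only [GaussianInt.toComplex_mul, norm_mul] at h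
    have : 0 < ‖(g : ℂ)‖ := norm_pos_iff.2 hgC
    nlinarith
  · funext j
    simp only [ratio]
    rw [hp j, hp 0]
    simp only [GaussianInt.toComplex_mul]
    rw [mul_div_mul_left _ _ hgC]

lemma eq_mul_of_ratio {m : ℕ} (z p c : Fin (m + 2) → GaussianInt) (hz : z 0 ≠ 0) (hp : p 0 ≠ 0)
    (hc : ∑ j, c j * p j = 1) (h : ratio p = ratio z) :
    ∃ a, ∀ j, z j = a * p j := by
  have hzC : (z 0 : ℂ) ≠ 0 := by simpa using hz
  have hpC : (p 0 : ℂ) ≠ 0 := by simpa using hp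
  have h1 : ∀ j, p j * z 0 = z j * p 0 := by
    intro j
    have := congrFun h j
    simp only [ratio] at this
    rw [div_eq_div_iff hpC hzC] at this
    rw [← GaussianInt.toComplex_inj]
    simpa using this
  have h2 : ∀ i j, z i * p j = z j * p i := by
    intro i j
    apply mul_right_cancel₀ hz
    apply mul_right_cancel₀ hp
    linear_combination z i * p 0 * h1 j - z j * p 0 * h1 i
  refine ⟨∑ j, c j * z j, fun i => ?_⟩
  calc z i = z i * ∑ j, c j * p j := by rw [hc, mul_one]
    _ = _ := by
      rw [Finset.mul_sum, Finset.sum_mul]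
      refine Finset.sum_congr rfl fun j _ => ?_
      linear_combination c j * h2 i j

lemma summable_gauss (k : ℕ) (hk : 2 < k) :
    Summable fun a : GaussianInt => (‖(a : ℂ)‖ ^ k)⁻¹ := by
  have h := EisensteinSeries.summable_one_div_norm_rpow (k := k) (by exact_mod_cast hk)
  let f : GaussianInt → (Fin 2 → ℤ) := fun a => ![a.re, a.im]
  have hf : Function.Injective f := by
    intro a b hab
    have h0 := congrFun hab 0
    have h1 := congrFun hab 1
    simp [f] at h0 h1
    exact Zsqrtd.ext h0 h1
  refine Summable.of_nonneg_of_le (fun _ => by positivity) ?_ (h.comp_injective hf)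
  intro a
  simp only [Function.comp, Real.rpow_neg (norm_nonneg _), Real.rpow_natCast]
  by_cases ha : a = 0
  · subst ha
    have : k ≠ 0 := by omega
    simp [this]
  have hfa : f a ≠ 0 := by
    intro h0
    apply ha
    apply hf
    rw [h0]
    ext i; fin_cases i <;> simp [f]
  have : 0 < ‖f a‖ := norm_pos_iff.2 hfa
  apply inv_anti₀ (by positivity)
  gcongr
  rw [pi_norm_le_iff_of_nonneg (norm_nonneg _)]
  intro i
  fin_cases i
  · have := Complex.abs_re_le_norm (a : ℂ)
    rw [← GaussianInt.intCast_re] at this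
    simpa [f, Int.norm_eq_abs] using this
  · have := Complex.abs_im_le_norm (a : ℂ)
    rw [← GaussianInt.intCast_im] at this
    simpa [f, Int.norm_eq_abs] using this

abbrev Par (m N : ℕ) : Type :=
  Fin (N + 1) × (Fin (m + 1) → Fin (N + 1) × Fin (N + 1))

def mkz {m : ℕ} (s : Σ N, Par m N) : Fin (m + 2) → GaussianInt :=
  Fin.cons ⟨(s.1 : ℤ) + 1, ((s.2.1 : ℕ) : ℤ)⟩
    (fun j => ⟨(((s.2.2 j).1 : ℕ) : ℤ), (((s.2.2 j).2 : ℕ) : ℤ)⟩)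

lemma mkz_inj {m : ℕ} : Function.Injective (mkz (m := m)) := by
  rintro ⟨N, k, f⟩ ⟨N', k', f'⟩ h
  have h0 := congrFun h 0
  simp only [mkz, Fin.cons_zero, Zsqrtd.mk.injEq] at h0
  obtain ⟨h1, h2⟩ := h0
  have : N = N' := by omega
  subst this
  have hk : k = k' := by ext; exact_mod_cast h2
  subst hk
  have : f = f' := by
    funext j
    have hj := congrFun h j.succ
    simp only [mkz, Fin.cons_succ, Zsqrtd.mk.injEq] at hj
    apply Prod.ext <;> ext
    · exact_mod_cast hj.1
    · exact_mod_cast hj.2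
  rw [this]

lemma norm_mk_le (x y N : ℝ) (hx : |x| ≤ N) (hy : |y| ≤ N) : ‖(⟨x, y⟩ : ℂ)‖ ≤ 2 * N :=
  (Complex.norm_le_abs_re_add_abs_im _).trans (by simp only; linarith)

lemma mkz_bound {m : ℕ} (s : Σ N, Par m N) :
    (∀ j, ‖(mkz s j : ℂ)‖ ≤ 2 * ((s.1 : ℝ) + 1)) ∧ (s.1 : ℝ) + 1 ≤ ‖(mkz s 0 : ℂ)‖ := by
  have hfin : ∀ a : Fin (s.1 + 1), |((a : ℕ) : ℝ)| ≤ (s.1 : ℝ) + 1 := by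
    intro a
    rw [abs_of_nonneg (by positivity)]
    have : (a : ℕ) ≤ s.1 + 1 := a.2.le
    exact_mod_cast this
  constructor
  · intro j
    refine Fin.cases ?_ (fun j => ?_) j
    · rw [GaussianInt.toComplex_def₂]
      apply norm_mk_le
      · simp only [mkz, Fin.cons_zero]
        push_cast
        rw [abs_of_nonneg (by positivity)]
      · simp only [mkz, Fin.cons_zero]
        push_cast
        exact hfin _
    · rw [GaussianInt.toComplex_def₂]
      apply norm_mk_le
      · simp only [mkz, Fin.cons_succ]
        push_cast
        exact hfin _
      · simp only [mkz, Fin.cons_succ]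
        push_cast
        exact hfin _
  · have h := Complex.abs_re_le_norm (mkz s 0 : ℂ)
    rw [← GaussianInt.intCast_re] at h
    simp only [mkz, Fin.cons_zero] at h
    push_cast at h
    rw [abs_of_nonneg (by positivity)] at h
    simpa [mkz] using h

lemma mkz_good {m : ℕ} (s : Σ N, Par m N) : Good (mkz s) := by
  obtain ⟨h1, h2⟩ := mkz_bound s
  refine ⟨?_, fun j => (h1 j).trans (by linarith)⟩
  intro h
  rw [h] at h2
  simp at h2
  have : (0 : ℝ) ≤ s.1 := by positivity
  linarith

lemma not_summable_mkz (m : ℕ) :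
    ¬ Summable fun s : Σ N, Par m N => (‖(mkz s 0 : ℂ)‖ ^ (2 * (m + 2)))⁻¹ := by
  intro h
  have h2 : Summable fun s : Σ N, Par m N => ((2 * ((s.1 : ℝ) + 1)) ^ (2 * (m + 2)))⁻¹ := by
    refine Summable.of_nonneg_of_le (fun _ => by positivity) ?_ h
    intro s
    have hb := mkz_bound s
    have : (0 : ℝ) < s.1 + 1 := by positivity
    apply inv_anti₀
    · have := hb.2
      have : 0 < ‖(mkz s 0 : ℂ)‖ := by linarith
      positivity
    · gcongr
      exact hb.1 0
  have h3 := h2.sigma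
  simp only [tsum_fintype, Finset.sum_const, Finset.card_univ, Fintype.card_prod, Fintype.card_fun,
    Fintype.card_fin, nsmul_eq_mul] at h3
  have h4 := h3.mul_left ((2 : ℝ) ^ (2 * (m + 2)))
  apply mt (summable_nat_add_iff (f := fun n : ℕ ↦ 1 / (n : ℝ)) 1).mp
    Real.not_summable_one_div_natCast
  refine h4.congr fun N => ?_
  have : (N : ℝ) + 1 ≠ 0 := by positivity
  push_cast
  generalize (N : ℝ) + 1 = x at *
  have e : (2 * x) ^ (2 * (m + 2)) = 2 ^ (2 * (m + 2)) * (x * (x * x) ^ (m + 1) * x) := by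
    rw [mul_pow, ← pow_two, ← pow_mul]; ring
  rw [e]
  field_simp

/-- pairwise non-proportional family with non-summable weights. -/
lemma exists_family (m : ℕ) : ∃ (L : Type) (P : L → (Fin (m + 2) → GaussianInt)),
    (∀ l, Good (P l)) ∧ (∀ l l', l ≠ l' → ratio (P l) ≠ ratio (P l')) ∧
    ¬ Summable fun l => (‖(P l 0 : ℂ)‖ ^ (2 * (m + 2)))⁻¹ := by
  let L : Type := {r : Fin (m + 2) → ℂ // ∃ z, Good z ∧ ratio z = r}
  have hL : ∀ l : L, ∃ p c : Fin (m + 2) → GaussianInt, ∑ j, c j * p j = 1 ∧ Good p ∧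
      ratio p = l.1 := by
    rintro ⟨r, z, hz, rfl⟩
    exact exists_primitive z hz
  choose P c h1 h2 h3 using hL
  refine ⟨L, P, h2, ?_, ?_⟩
  · intro l l' hne h
    rw [h3, h3] at h
    exact hne (Subtype.ext h)
  · intro hs
    have hprod := (summable_gauss (2 * (m + 2)) (by omega)).mul_of_nonneg hs
      (fun _ => by positivity) (fun _ => by positivity)
    let l : (Σ N, Par m N) → L := fun s => ⟨ratio (mkz s), mkz s, mkz_good s, rfl⟩
    have ha : ∀ s, ∃ a, ∀ j, mkz s j = a * P (l s) j := fun s =>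
      eq_mul_of_ratio _ _ _ (mkz_good s).1 (h2 _).1 (h1 (l s)) (h3 (l s))
    choose a ha using ha
    let F : (Σ N, Par m N) → GaussianInt × L := fun s => (a s, l s)
    have hF : Function.Injective F := by
      intro s s' hss
      apply mkz_inj
      have e1 : a s = a s' := congrArg Prod.fst hss
      have e2 : l s = l s' := congrArg Prod.snd hss
      funext j
      rw [ha, ha, e1, e2]
    refine not_summable_mkz m ((hprod.comp_injective hF).congr fun s => ?_)
    simp only [Function.comp, F]
    rw [ha s 0]
    simp only [GaussianInt.toComplex_mul, norm_mul, mul_pow, mul_inv]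

lemma norm_le_cnorm_s6 {ι : Type*} [Fintype ι] (v : ι → ℂ) (i : ι) : ‖v i‖ ≤ cnorm v := by
  unfold cnorm
  apply Real.le_sqrt_of_sq_le
  exact Finset.single_le_sum (f := fun i => ‖v i‖ ^ 2) (fun _ _ => by positivity)
    (Finset.mem_univ i)

lemma cnorm_le {n : ℕ} (v : Fin n → ℂ) (b : ℝ) (hb : 0 ≤ b) (h : ∀ i, ‖v i‖ ≤ b) :
    cnorm v ≤ n * b := by
  unfold cnorm
  rw [Real.sqrt_le_left (by positivity)]
  calc ∑ i, ‖v i‖ ^ 2 ≤ ∑ i : Fin n, b ^ 2 := by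
        gcongr with i; exact h i
    _ = n * b ^ 2 := by simp
    _ ≤ (n * b) ^ 2 := by
        rw [mul_pow]
        gcongr
        have : n ≤ n ^ 2 := Nat.le_self_pow (by norm_num) n
        exact_mod_cast this

def Ev {n : ℕ} (z : Fin n → GaussianInt) (ε : ℝ) : Set ((Fin n × Fin n × Bool) → ℝ) :=
  {g | cnorm ((matOf g).mulVec fun j => (z j : ℂ)) ≤ ε}

lemma Ev_meas {n : ℕ} (z : Fin n → GaussianInt) (ε : ℝ) : MeasurableSet (Ev z ε) := by
  apply IsClosed.measurableSet
  apply isClosed_le _ continuous_const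
  unfold cnorm matOf Matrix.mulVec dotProduct
  fun_prop

lemma card_cols {n : ℕ} (S : Finset (Fin n)) :
    Fintype.card {t : Fin n × Fin n × Bool // t.2.1 ∈ S} = n * (S.card * 2) := by
  let e : {t : Fin n × Fin n × Bool // t.2.1 ∈ S} ≃ Fin n × S × Bool :=
    { toFun := fun t => (t.1.1, ⟨t.1.2.1, t.2⟩, t.1.2.2)
      invFun := fun t => ⟨(t.1, t.2.1.1, t.2.2), t.2.1.2⟩
      left_inv := fun t => rfl
      right_inv := fun t => rfl }
  rw [Fintype.card_congr e]
  simp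

lemma matOf_re {n : ℕ} (g : (Fin n × Fin n × Bool) → ℝ) (i j) :
    (matOf g i j).re = g (i, j, false) := by simp [matOf]

lemma matOf_im {n : ℕ} (g : (Fin n × Fin n × Bool) → ℝ) (i j) :
    (matOf g i j).im = g (i, j, true) := by simp [matOf]

lemma one_le_norm {a : GaussianInt} (ha : a ≠ 0) : 1 ≤ ‖(a : ℂ)‖ := by
  have h1 : (1 : ℝ) ≤ ‖(a : ℂ)‖ ^ 2 := by
    rw [← Complex.normSq_eq_norm_sq, ← GaussianInt.intCast_real_norm]
    have := GaussianInt.norm_pos.2 ha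
    exact_mod_cast this
  nlinarith [norm_nonneg (a : ℂ)]

lemma upper_event {m : ℕ} (z w : Fin (m + 2) → GaussianInt) (hz : Good z) (hw : Good w)
    (h : ratio z ≠ ratio w) : ∃ C : ℝ, 0 ≤ C ∧ ∀ ε : ℝ, 0 < ε →
      (gaussMatMeasure (m + 2) (m + 2)) (Ev z ε ∩ Ev w ε)
        ≤ ENNReal.ofReal (C * ε ^ (4 * (m + 2))) := by
  obtain ⟨k, hk⟩ := Function.ne_iff.1 h
  have hz0 : (z 0 : ℂ) ≠ 0 := by simpa using hz.1
  have hw0 : (w 0 : ℂ) ≠ 0 := by simpa using hw.1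
  simp only [ratio] at hk
  rw [Ne, div_eq_div_iff hz0 hw0] at hk
  have hk0 : (0 : Fin (m + 2)) ≠ k := by
    rintro rfl
    exact hk (by ring)
  set Δ : ℂ := z 0 * w k - z k * w 0 with hΔ
  have hΔ0 : Δ ≠ 0 := by
    intro h0
    apply hk
    linear_combination -h0
  have hΔn : 0 < ‖Δ‖ := norm_pos_iff.2 hΔ0
  set D : ℝ := 2 * (‖(z 0 : ℂ)‖ + ‖(z k : ℂ)‖ + ‖(w 0 : ℂ)‖ + ‖(w k : ℂ)‖) / ‖Δ‖ with hD
  have hD0 : 0 ≤ D := by positivity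
  refine ⟨(2 * D) ^ (4 * (m + 2)), by positivity, fun ε hε => ?_⟩
  have hu := pi_upper_s6 (fun t : Fin (m + 2) × Fin (m + 2) × Bool => t.2.1 ∈ ({0, k} : Finset _))
    ((Ev_meas z ε).inter (Ev_meas w ε)) (D * ε) (by
      intro g hg g' hg' hag t ht
      obtain ⟨i, j, b⟩ := t
      set d : Fin (m + 2) → ℂ := fun j => matOf g i j - matOf g' i j with hd
      have hd0 : ∀ j, j ∉ ({0, k} : Finset (Fin (m + 2))) → d j = 0 := by
        intro j hj
        simp only [hd, matOf]
        rw [hag (i, j, false) hj, hag (i, j, true) hj]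
        ring
      have key : ∀ v : Fin (m + 2) → GaussianInt, g ∈ Ev v ε → g' ∈ Ev v ε →
          ‖d 0 * v 0 + d k * v k‖ ≤ 2 * ε := by
        intro v h1 h2
        have e : d 0 * v 0 + d k * v k = ((matOf g).mulVec fun j => (v j : ℂ)) i -
            ((matOf g').mulVec fun j => (v j : ℂ)) i := by
          simp only [Matrix.mulVec, dotProduct]
          rw [← Finset.sum_sub_distrib, ← Finset.sum_pair (f := fun j => d j * v j) hk0]
          rw [Finset.sum_subset (Finset.subset_univ ({0, k} : Finset (Fin (m + 2))))
            (fun j _ hj => by rw [hd0 j hj, zero_mul])]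
          refine Finset.sum_congr rfl fun j _ => ?_
          simp only [hd]; ring
        rw [e]
        have a1 := (norm_le_cnorm_s6 _ i).trans (show _ ≤ ε from h1)
        have a2 := (norm_le_cnorm_s6 _ i).trans (show _ ≤ ε from h2)
        exact (norm_sub_le _ _).trans (by linarith)
      have kz := key z hg.1 hg'.1
      have kw := key w hg.2 hg'.2
      set X := d 0 * z 0 + d k * z k with hX
      set Y := d 0 * w 0 + d k * w k with hY
      have n1 : ‖d 0‖ * ‖Δ‖ ≤ 2 * ε * (‖(z k : ℂ)‖ + ‖(w k : ℂ)‖) := by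
        have : d 0 * Δ = w k * X - z k * Y := by simp only [hX, hY, hΔ]; ring
        rw [← norm_mul, this]
        refine (norm_sub_le _ _).trans ?_
        rw [norm_mul, norm_mul]
        nlinarith [norm_nonneg (z k : ℂ), norm_nonneg (w k : ℂ)]
      have n2 : ‖d k‖ * ‖Δ‖ ≤ 2 * ε * (‖(z 0 : ℂ)‖ + ‖(w 0 : ℂ)‖) := by
        have : d k * Δ = z 0 * Y - w 0 * X := by simp only [hX, hY, hΔ]; ring
        rw [← norm_mul, this]
        refine (norm_sub_le _ _).trans ?_
        rw [norm_mul, norm_mul]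
        nlinarith [norm_nonneg (z 0 : ℂ), norm_nonneg (w 0 : ℂ)]
      have hdj : ‖d j‖ ≤ D * ε := by
        have p1 : 0 ≤ ε * ‖(z 0 : ℂ)‖ := by positivity
        have p2 : 0 ≤ ε * ‖(w 0 : ℂ)‖ := by positivity
        have p3 : 0 ≤ ε * ‖(z k : ℂ)‖ := by positivity
        have p4 : 0 ≤ ε * ‖(w k : ℂ)‖ := by positivity
        rw [hD, div_mul_eq_mul_div, le_div_iff₀ hΔn]
        simp only [Finset.mem_insert, Finset.mem_singleton] at ht
        rcases ht with rfl | rfl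
        · linarith
        · linarith
      cases b
      · have := (Complex.abs_re_le_norm (d j)).trans hdj
        simpa only [hd, Complex.sub_re, matOf_re] using this
      · have := (Complex.abs_im_le_norm (d j)).trans hdj
        simpa only [hd, Complex.sub_im, matOf_im] using this)
  refine hu.trans (le_of_eq ?_)
  rw [card_cols, Finset.card_pair hk0, ← ENNReal.ofReal_pow (by positivity), ← mul_pow]
  congr 1
  rw [mul_assoc]
  congr 1
  ring

lemma lower_event (m : ℕ) : ∃ C : ℝ, 0 < C ∧ ∀ z : Fin (m + 2) → GaussianInt, Good z →
    ∀ ε : ℝ, 0 < ε → ε ≤ 1 →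
      ENNReal.ofReal (C * (‖(z 0 : ℂ)‖ ^ (2 * (m + 2)))⁻¹ * ε ^ (2 * (m + 2))) ≤
        (gaussMatMeasure (m + 2) (m + 2)) (Ev z ε) := by
  set K : ℝ := 4 * (m + 2) with hK
  have hq1 : 0 < gaussianPDFReal 0 (1/2) (K + 1) := gaussianPDFReal_pos _ _ _ (by norm_num)
  have hq2 : 0 < gaussianPDFReal 0 (1/2) (0 + 1) := gaussianPDFReal_pos _ _ _ (by norm_num)
  set q1 := gaussianPDFReal 0 (1/2) (K + 1)
  set q2 := gaussianPDFReal 0 (1/2) (0 + 1)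
  set n2 := Fintype.card {t : Fin (m + 2) × Fin (m + 2) × Bool //
    ¬ t.2.1 ∈ ({0} : Finset (Fin (m + 2)))} with hn2
  refine ⟨(q1 / (m + 2)) ^ (2 * (m + 2)) * (q2 * 2) ^ n2, by positivity, fun z hz ε hε hε1 => ?_⟩
  have hz1 : 1 ≤ ‖(z 0 : ℂ)‖ := one_le_norm hz.1
  have hz0 : (z 0 : ℂ) ≠ 0 := by simpa using hz.1
  have hzp : 0 < ‖(z 0 : ℂ)‖ := by linarith
  set r : ℝ := ε / (2 * (m + 2) * ‖(z 0 : ℂ)‖) with hr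
  have hr0 : 0 < r := by positivity
  have hr1 : r ≤ 1 := by
    rw [hr, div_le_one (by positivity)]
    have : (0 : ℝ) ≤ m := by positivity
    nlinarith
  have hl := pi_lower_s6 (fun t : Fin (m + 2) × Fin (m + 2) × Bool => t.2.1 ∈ ({0} : Finset _))
    (Ev_meas z ε) K r hr1 (by
      intro y hy
      let c : Fin (m + 2) → ℂ := fun i => - ∑ j : Fin (m + 1), matOf y i j.succ * (z j.succ / z 0)
      have hc : ∀ i, ‖c i‖ ≤ K := by
        intro i
        simp only [c, norm_neg]
        calc _ ≤ ∑ j : Fin (m + 1), ‖matOf y i j.succ * (z j.succ / z 0)‖ := norm_sum_le _ _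
          _ ≤ ∑ j : Fin (m + 1), (4 : ℝ) := by
              gcongr with j
              have b1 : ‖matOf y i j.succ‖ ≤ 2 := by
                refine (Complex.norm_le_abs_re_add_abs_im _).trans ?_
                rw [matOf_re, matOf_im]
                have h1 := hy (i, j.succ, false) (by simp)
                have h2 := hy (i, j.succ, true) (by simp)
                linarith
              have b2 : ‖(z j.succ / z 0 : ℂ)‖ ≤ 2 := by
                rw [norm_div, div_le_iff₀ hzp]
                exact hz.2 _
              rw [norm_mul]
              nlinarith [norm_nonneg (matOf y i j.succ), norm_nonneg (z j.succ / z 0 : ℂ)]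
          _ = 4 * (m + 1) := by simp; ring
          _ ≤ K := by rw [hK]; linarith
      refine ⟨fun t => if t.2.2 then (c t.1).im else (c t.1).re, ?_, ?_⟩
      · rintro ⟨i, j, b⟩
        cases b
        · simpa using (Complex.abs_re_le_norm _).trans (hc i)
        · simpa using (Complex.abs_im_le_norm _).trans (hc i)
      · intro g hg1 hg2
        show cnorm _ ≤ ε
        have : ε = ((m + 2 : ℕ) : ℝ) * (2 * r * ‖(z 0 : ℂ)‖) := by
          rw [hr]; push_cast; field_simp
        rw [this]
        apply cnorm_le _ _ (by positivity)
        intro i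
        have e : ((matOf g).mulVec fun j => (z j : ℂ)) i = (matOf g i 0 - c i) * z 0 := by
          simp only [Matrix.mulVec, dotProduct, c]
          rw [Fin.sum_univ_succ, sub_neg_eq_add, add_mul, Finset.sum_mul]
          congr 1
          refine Finset.sum_congr rfl fun j _ => ?_
          have : matOf g i j.succ = matOf y i j.succ := by
            simp only [matOf]
            rw [hg1 (i, j.succ, false) (by simp), hg1 (i, j.succ, true) (by simp)]
          rw [this]
          field_simp
        rw [e, norm_mul]
        gcongr
        refine (Complex.norm_le_abs_re_add_abs_im _).trans ?_
        rw [Complex.sub_re, Complex.sub_im, matOf_re, matOf_im]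
        have h1 := hg2 (i, 0, false) (by simp)
        have h2 := hg2 (i, 0, true) (by simp)
        simp at h1 h2
        linarith)
  refine le_trans (le_of_eq ?_) hl
  rw [card_cols, Finset.card_singleton, ← hn2, ← ENNReal.ofReal_mul hq1.le,
    ← ENNReal.ofReal_mul hq2.le, ← ENNReal.ofReal_pow (by positivity),
    ← ENNReal.ofReal_pow (by positivity), ← ENNReal.ofReal_mul (by positivity)]
  congr 1
  have e1 : (m + 2) * (1 * 2) = 2 * (m + 2) := by ring
  have e2 : q1 * (2 * r) = q1 / (m + 2) * (‖(z 0 : ℂ)‖)⁻¹ * ε := by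
    rw [hr]; field_simp
  rw [e1, e2, mul_one, mul_pow (q1 / (m + 2) * (‖(z 0 : ℂ)‖)⁻¹) ε, mul_pow (q1 / (m + 2)), inv_pow]
  ring

lemma bonf {Ω L : Type*} [MeasurableSpace Ω] [DecidableEq L] (μ : Measure Ω)
    [IsProbabilityMeasure μ]
    (A : L → Set Ω) (hA : ∀ l, MeasurableSet (A l)) (Z : Finset L) (S : Set Ω)
    (hS : ∀ l ∈ Z, A l ⊆ S) :
    ∑ l ∈ Z, (μ.real (A l) - ∑ k ∈ Z.erase l, μ.real (A l ∩ A k)) ≤ μ.real S := by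
  let B : L → Set Ω := fun l => A l \ ⋃ k ∈ Z.erase l, A k
  have hB : ∀ l, MeasurableSet (B l) := fun l =>
    (hA l).diff (Finset.measurableSet_biUnion _ fun k _ => hA k)
  calc _ ≤ ∑ l ∈ Z, μ.real (B l) := by
        refine Finset.sum_le_sum fun l _ => ?_
        have h1 : μ.real (A l) ≤ μ.real (B l) + μ.real (⋃ k ∈ Z.erase l, A l ∩ A k) := by
          refine (measureReal_mono ?_).trans (measureReal_union_le _ _)
          intro x hx
          by_cases h : x ∈ ⋃ k ∈ Z.erase l, A k
          · right
            simp only [mem_iUnion] at h ⊢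
            obtain ⟨k, hk, hxk⟩ := h
            exact ⟨k, hk, hx, hxk⟩
          · exact Or.inl ⟨hx, h⟩
        have h2 := measureReal_biUnion_finset_le (μ := μ) (Z.erase l) (fun k => A l ∩ A k)
        linarith
    _ = μ.real (⋃ l ∈ Z, B l) := by
        rw [measureReal_biUnion_finset _ (fun l _ => hB l)]
        intro l hl k hk hlk
        rw [Function.onFun, Set.disjoint_left]
        intro x hx hx'
        apply hx.2
        simp only [mem_iUnion]
        exact ⟨k, Finset.mem_erase.2 ⟨hlk.symm, hk⟩, hx'.1⟩
    _ ≤ _ := by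
        refine measureReal_mono ?_ (measure_ne_top _ _)
        intro x hx
        simp only [mem_iUnion] at hx
        obtain ⟨l, hl, hx⟩ := hx
        exact hS l hl hx.1

lemma Ev_subset {n : ℕ} (z : Fin n → GaussianInt) (hz : z ≠ 0) (ε : ℝ) :
    Ev z ε ⊆ {g | latMinDist (matOf g) ≤ ε} := by
  intro g hg
  have hb : BddBelow {r | ∃ w : Fin n → GaussianInt, w ≠ 0 ∧
      r = cnorm ((matOf g).mulVec fun j => (w j : ℂ))} := by
    refine ⟨0, ?_⟩
    rintro r ⟨w, _, rfl⟩
    exact Real.sqrt_nonneg _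
  have h1 : latMinDist (matOf g) ≤ cnorm ((matOf g).mulVec fun j => (z j : ℂ)) :=
    csInf_le hb ⟨z, hz, rfl⟩
  exact h1.trans hg

/-- For `M ≥ 2` and an `M × M` random matrix `H` with i.i.d.
circularly-symmetric complex Gaussian entries of zero mean and unit variance,
`Pr{d(H) ≤ ε} / ε^(2M) → ∞` as `ε → 0⁺`. -/
theorem naive_lattice_min_dist_ratio_tendsto_atTop (M : ℕ) (hM : 2 ≤ M) :
    Tendsto (fun ε : ℝ =>
        ((gaussMatMeasure M M) {g | latMinDist (matOf g) ≤ ε}).toReal / ε ^ (2 * M))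
      (nhdsWithin 0 (Set.Ioi 0)) atTop := by
  classical
  obtain ⟨m, rfl⟩ : ∃ m, M = m + 2 := ⟨M - 2, by omega⟩
  have : IsProbabilityMeasure (gaussMatMeasure (m + 2) (m + 2)) := by
    unfold gaussMatMeasure; infer_instance
  set μ := gaussMatMeasure (m + 2) (m + 2) with hμ
  obtain ⟨L, P, hgood, hpair, hns⟩ := exists_family m
  obtain ⟨C, hC, hlow⟩ := lower_event m
  have hup : ∀ l k, ∃ D : ℝ, 0 ≤ D ∧ (l ≠ k → ∀ ε : ℝ, 0 < ε →
      μ (Ev (P l) ε ∩ Ev (P k) ε) ≤ ENNReal.ofReal (D * ε ^ (4 * (m + 2)))) := by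
    intro l k
    by_cases hlk : l = k
    · exact ⟨0, le_rfl, fun h => absurd hlk h⟩
    · obtain ⟨D, h0, h⟩ := upper_event (P l) (P k) (hgood l) (hgood k) (hpair l k hlk)
      exact ⟨D, h0, fun _ => h⟩
  choose D hD0 hD using hup
  rw [tendsto_atTop]
  intro b
  obtain ⟨Z, hZ⟩ : ∃ Z : Finset L, (b + 1) / C <
      ∑ l ∈ Z, (‖(P l 0 : ℂ)‖ ^ (2 * (m + 2)))⁻¹ := by
    by_contra! hcon
    exact hns (summable_of_sum_le (fun _ => by positivity) hcon)
  rw [div_lt_iff₀ hC] at hZ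
  set T : ℝ := ∑ l ∈ Z, ∑ k ∈ Z.erase l, D l k with hT
  have hT0 : 0 ≤ T := Finset.sum_nonneg fun l _ => Finset.sum_nonneg fun k _ => hD0 l k
  have hev : ∀ᶠ ε : ℝ in nhdsWithin 0 (Set.Ioi 0), 0 < ε ∧ ε < 1 / (T + 1) := by
    have := Ioo_mem_nhdsGT (show (0 : ℝ) < 1 / (T + 1) by positivity)
    filter_upwards [this] with ε h using h
  filter_upwards [hev] with ε hε
  obtain ⟨hε, hεT⟩ := hε
  rw [lt_div_iff₀ (by positivity)] at hεT
  have hε1 : ε ≤ 1 := by nlinarith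
  rw [le_div_iff₀ (by positivity)]
  have hb := bonf μ (fun l => Ev (P l) ε) (fun l => Ev_meas _ _) Z
    {g | latMinDist (matOf g) ≤ ε}
    (fun l _ => Ev_subset _ (fun h => (hgood l).1 (by rw [h]; rfl)) ε)
  refine le_trans ?_ hb
  rw [Finset.sum_sub_distrib]
  have h1 : C * (∑ l ∈ Z, (‖(P l 0 : ℂ)‖ ^ (2 * (m + 2)))⁻¹) * ε ^ (2 * (m + 2)) ≤
      ∑ l ∈ Z, μ.real (Ev (P l) ε) := by
    rw [Finset.mul_sum, Finset.sum_mul]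
    refine Finset.sum_le_sum fun l _ => ?_
    exact (ENNReal.ofReal_le_iff_le_toReal (measure_ne_top _ _)).1 (hlow (P l) (hgood l) ε hε hε1)
  have h2 : ∑ l ∈ Z, ∑ k ∈ Z.erase l, μ.real (Ev (P l) ε ∩ Ev (P k) ε) ≤
      T * ε ^ (4 * (m + 2)) := by
    rw [hT, Finset.sum_mul]
    refine Finset.sum_le_sum fun l _ => ?_
    rw [Finset.sum_mul]
    refine Finset.sum_le_sum fun k hk => ?_
    have := hD0 l k
    exact ENNReal.toReal_le_of_le_ofReal (by positivity)
      (hD l k (Finset.ne_of_mem_erase hk).symm ε hε)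
  have h3 : T * ε ^ (4 * (m + 2)) ≤ 1 * ε ^ (2 * (m + 2)) := by
    have e : ε ^ (4 * (m + 2)) = ε ^ (2 * (m + 2)) * ε ^ (2 * (m + 2)) := by
      rw [← pow_add]; congr 1; ring
    have h4 : ε ^ (2 * (m + 2)) ≤ ε := pow_le_of_le_one hε.le hε1 (by omega)
    rw [e, ← mul_assoc]
    gcongr
    nlinarith
  have h5 : 0 < ε ^ (2 * (m + 2)) := by positivity
  nlinarith
end
end
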